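/- There exist constants c > 0 and d₀ ∈ ℕ such that the following holds for every d ≥ d₀: if K ⊂ ℝ^d is a convex body whose centre of mass is the origin and K ∩ ℤ^d = {0}, then vol(K) ≤ exp(−c·d/(log d)^8) · 4^d. -/

import Mathlib

open MeasureTheory Pointwise

/-- The centre of mass of `K`. -/
noncomputable def centroid {d : ℕ} (K : Set (EuclideanSpace ℝ (Fin d))) :
    EuclideanSpace ℝ (Fin d) :=
  (volume K).toReal⁻¹ • ∫ x in K, x

/-- The integer lattice `ℤ^d` inside `ℝ^d`. -/
def intLattice (d : ℕ) : Set (EuclideanSpace ℝ (Fin d)) :=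
  {x | ∀ i, ∃ n : ℤ, x i = (n : ℝ)}

section Auxiliary

open Set
open scoped ENNReal

set_option linter.unusedSectionVars false

/-- One-dimensional Brunn–Minkowski inequality for compact sets. -/
lemma Real.volume_add_le_of_isCompact {t : ℝ} (h0 : 0 < t) (h1 : t < 1) {A B C : Set ℝ}
    (hA : IsCompact A) (hB : IsCompact B) (hAn : A.Nonempty) (hBn : B.Nonempty)
    (hC : ∀ x ∈ A, ∀ y ∈ B, (1 - t) * x + t * y ∈ C) :
    ENNReal.ofReal (1 - t) * volume A + ENNReal.ofReal t * volume B ≤ volume C := by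
  obtain ⟨M, hM, hMA⟩ := hA.exists_isGreatest hAn
  obtain ⟨m, hm, hmB⟩ := hB.exists_isLeast hBn
  let f : ℝ → ℝ := fun x => (1 - t) * x + t * m
  let g : ℝ → ℝ := fun y => (1 - t) * M + t * y
  have hf : volume (f '' A) = ENNReal.ofReal (1 - t) * volume A := by
    have : f '' A = (fun x => x + t * m) '' ((1 - t) • A) := by
      rw [← image_smul, image_image]; rfl
    rw [this, image_add_right, measure_preimage_add_right, Measure.addHaar_smul]
    simp [abs_of_pos (sub_pos.2 h1)]
  have hg : volume (g '' B) = ENNReal.ofReal t * volume B := by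
    have : g '' B = (fun x => (1 - t) * M + x) '' (t • B) := by
      rw [← image_smul, image_image]; rfl
    rw [this, image_add_left, measure_preimage_add, Measure.addHaar_smul]
    simp [abs_of_pos h0]
  have hcg : IsCompact (g '' B) := hB.image (by fun_prop)
  have hd : AEDisjoint volume (f '' A) (g '' B) := by
    refine measure_mono_null (t := {(1 - t) * M + t * m}) ?_ (by simp)
    rintro z ⟨⟨x, hx, rfl⟩, ⟨y, hy, hxy⟩⟩
    have h2 := hMA hx
    have h3 := hmB hy
    simp only [f, g] at hxy
    have h4 : (1 - t) * x ≤ (1 - t) * M := mul_le_mul_of_nonneg_left h2 (by linarith)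
    have h5 : t * m ≤ t * y := mul_le_mul_of_nonneg_left h3 h0.le
    simp only [mem_singleton_iff, f]; linarith
  rw [← hf, ← hg, ← measure_union₀ hcg.measurableSet.nullMeasurableSet hd]
  apply measure_mono
  rintro z (⟨x, hx, rfl⟩ | ⟨y, hy, rfl⟩)
  · exact hC x hx m hm
  · exact hC M hM y hy

/-- One-dimensional Brunn–Minkowski inequality. -/
lemma Real.volume_add_le {t : ℝ} (h0 : 0 < t) (h1 : t < 1) {A B C : Set ℝ}
    (hA : MeasurableSet A) (hB : MeasurableSet B) (hAn : A.Nonempty) (hBn : B.Nonempty)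
    (hC : ∀ x ∈ A, ∀ y ∈ B, (1 - t) * x + t * y ∈ C) :
    ENNReal.ofReal (1 - t) * volume A + ENNReal.ofReal t * volume B ≤ volume C := by
  have key : ∀ K ⊆ A, IsCompact K → ∀ L ⊆ B, IsCompact L →
      ENNReal.ofReal (1 - t) * volume K + ENNReal.ofReal t * volume L ≤ volume C := by
    intro K hK hKc L hL hLc
    obtain ⟨a, ha⟩ := hAn
    obtain ⟨b, hb⟩ := hBn
    calc _ ≤ ENNReal.ofReal (1 - t) * volume (insert a K)
        + ENNReal.ofReal t * volume (insert b L) := by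
          gcongr <;> exact subset_insert _ _
      _ ≤ volume C := Real.volume_add_le_of_isCompact h0 h1 (hKc.insert a) (hLc.insert b)
          (insert_nonempty _ _) (insert_nonempty _ _)
          fun x hx y hy => hC x (insert_subset ha hK hx) y (insert_subset hb hL hy)
  have e : Nonempty {K : Set ℝ // K ⊆ A ∧ IsCompact K} := ⟨∅, by simp⟩
  have e' : Nonempty {K : Set ℝ // K ⊆ B ∧ IsCompact K} := ⟨∅, by simp⟩
  have hA' : volume A = ⨆ K : {K : Set ℝ // K ⊆ A ∧ IsCompact K}, volume K.1 := by
    rw [hA.measure_eq_iSup_isCompact, iSup_subtype]; simp only [iSup_and]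
  have hB' : volume B = ⨆ K : {K : Set ℝ // K ⊆ B ∧ IsCompact K}, volume K.1 := by
    rw [hB.measure_eq_iSup_isCompact, iSup_subtype]; simp only [iSup_and]
  rw [hA', hB', ENNReal.mul_iSup, ENNReal.mul_iSup]
  exact ENNReal.iSup_add_iSup_le fun K L => key K.1 K.2.1 K.2.2 L.1 L.2.1 L.2.2

/-- Layer-cake formula for a bounded extended nonnegative function. -/
lemma lintegral_eq_setLIntegral_meas_lt {f : ℝ → ℝ≥0∞} (hf : Measurable f) {S : ℝ}
    (hS : ∀ x, f x ≤ ENNReal.ofReal S) :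
    ∫⁻ x, f x = ∫⁻ s in Ioo 0 S, volume {x | ENNReal.ofReal s < f x} := by
  have hfin : ∀ x, f x ≠ ∞ := fun x => ((hS x).trans_lt ENNReal.ofReal_lt_top).ne
  have h1 : ∀ x, f x = ENNReal.ofReal (f x).toReal := fun x => (ENNReal.ofReal_toReal (hfin x)).symm
  have h2 : ∀ s, 0 ≤ s → {x | s < (f x).toReal} = {x | ENNReal.ofReal s < f x} := by
    intro s hs
    ext x
    exact (ENNReal.ofReal_lt_iff_lt_toReal hs (hfin x)).symm
  calc ∫⁻ x, f x = ∫⁻ x, ENNReal.ofReal (f x).toReal := by simp_rw [← h1]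
    _ = ∫⁻ s in Ioi 0, volume {x | s < (f x).toReal} :=
        lintegral_eq_lintegral_meas_lt _ (.of_forall fun x => ENNReal.toReal_nonneg)
          hf.ennreal_toReal.aemeasurable
    _ = ∫⁻ s in Ioi 0, volume {x | ENNReal.ofReal s < f x} :=
        setLIntegral_congr_fun measurableSet_Ioi fun s hs => by rw [h2 s (mem_Ioi.1 hs).le]
    _ = ∫⁻ s in Ioo 0 S, volume {x | ENNReal.ofReal s < f x} := by
        rw [← lintegral_indicator measurableSet_Ioi, ← lintegral_indicator measurableSet_Ioo]
        refine lintegral_congr fun s => ?_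
        by_cases hs : 0 < s
        · by_cases hsS : s < S
          · simp [indicator, hs, hsS]
          · have : {x | ENNReal.ofReal s < f x} = ∅ := by
              ext x
              simpa using (hS x).trans (ENNReal.ofReal_le_ofReal (not_lt.1 hsS))
            simp [indicator, hs, hsS, this]
        · simp [indicator, hs]

lemma lintegral_add_le_of_min_le {t : ℝ} (h0 : 0 < t) (h1 : t < 1) {f g h : ℝ → ℝ≥0∞}
    (hf : Measurable f) (hg : Measurable g) (hh : Measurable h) {S : ℝ}
    (hfS : ⨆ x, f x = ENNReal.ofReal S) (hgS : ⨆ x, g x = ENNReal.ofReal S)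
    (hfg : ∀ x y, min (f x) (g y) ≤ h ((1 - t) * x + t * y)) :
    ENNReal.ofReal (1 - t) * (∫⁻ x, f x) + ENNReal.ofReal t * (∫⁻ x, g x) ≤ ∫⁻ x, h x := by
  have hfS' : ∀ x, f x ≤ ENNReal.ofReal S := fun x => hfS ▸ le_iSup f x
  have hgS' : ∀ x, g x ≤ ENNReal.ofReal S := fun x => hgS ▸ le_iSup g x
  let h' : ℝ → ℝ≥0∞ := fun x => min (h x) (ENNReal.ofReal S)
  have hmeas : ∀ u : ℝ → ℝ≥0∞, Measurable fun s : ℝ => volume {x | ENNReal.ofReal s < u x} :=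
    fun u => Antitone.measurable fun s s' hs => measure_mono fun x hx =>
      (ENNReal.ofReal_le_ofReal hs).trans_lt hx
  calc _ = ∫⁻ s in Ioo 0 S, (ENNReal.ofReal (1 - t) * volume {x | ENNReal.ofReal s < f x}
        + ENNReal.ofReal t * volume {x | ENNReal.ofReal s < g x}) := by
        rw [lintegral_add_left ((hmeas f).const_mul _), lintegral_const_mul _ (hmeas f),
          lintegral_const_mul _ (hmeas g), lintegral_eq_setLIntegral_meas_lt hf hfS',
          lintegral_eq_setLIntegral_meas_lt hg hgS']
    _ ≤ ∫⁻ s in Ioo 0 S, volume {x | ENNReal.ofReal s < h' x} := by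
        refine setLIntegral_mono (hmeas h') fun s hs => ?_
        have hsS : ENNReal.ofReal s < ENNReal.ofReal S :=
          (ENNReal.ofReal_lt_ofReal_iff (hs.1.trans hs.2)).2 hs.2
        refine Real.volume_add_le h0 h1 (measurableSet_lt measurable_const hf)
          (measurableSet_lt measurable_const hg) ?_ ?_ ?_
        · exact lt_iSup_iff.1 (hfS ▸ hsS)
        · exact lt_iSup_iff.1 (hgS ▸ hsS)
        · intro x hx y hy
          exact lt_min ((lt_min hx hy).trans_le (hfg x y)) hsS
    _ = ∫⁻ x, h' x := (lintegral_eq_setLIntegral_meas_lt (hh.min measurable_const)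
        fun x => min_le_right _ _).symm
    _ ≤ ∫⁻ x, h x := lintegral_mono fun x => min_le_left _ _

lemma ENNReal.rpow_mul_rpow_le_add {t : ℝ} (h0 : 0 < t) (h1 : t < 1) (a b : ℝ≥0∞) :
    a ^ (1 - t) * b ^ t ≤ ENNReal.ofReal (1 - t) * a + ENNReal.ofReal t * b := by
  rcases eq_or_ne a ∞ with rfl | ha
  · rw [ENNReal.mul_top (by simpa using h1)]; simp
  rcases eq_or_ne b ∞ with rfl | hb
  · rw [ENNReal.mul_top (by simpa using h0)]; simp
  lift a to NNReal using ha
  lift b to NNReal using hb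
  have := NNReal.geom_mean_le_arith_mean2_weighted (Real.toNNReal (1 - t)) (Real.toNNReal t) a b
    (by rw [← Real.toNNReal_add (by linarith) h0.le]; simp)
  rw [Real.coe_toNNReal _ h0.le, Real.coe_toNNReal _ (by linarith : 0 ≤ 1 - t)] at this
  rw [← ENNReal.coe_rpow_of_nonneg _ h0.le,
    ← ENNReal.coe_rpow_of_nonneg _ (by linarith : 0 ≤ 1 - t)]
  rw [← ENNReal.coe_mul]
  exact (ENNReal.coe_le_coe.2 this).trans_eq (by push_cast; rfl)

lemma ENNReal.min_le_rpow_mul_rpow {t : ℝ} (h0 : 0 < t) (h1 : t < 1) (a b : ℝ≥0∞) :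
    min a b ≤ a ^ (1 - t) * b ^ t := by
  calc min a b = (min a b) ^ (1 - t) * (min a b) ^ t := by
        rw [← ENNReal.rpow_add_of_nonneg _ _ (by linarith) h0.le]; simp
    _ ≤ _ := by
        exact mul_le_mul' (ENNReal.rpow_le_rpow (min_le_left _ _) (by linarith))
          (ENNReal.rpow_le_rpow (min_le_right _ _) h0.le)

lemma prekopaLeindler_real_of_bounded {t : ℝ} (h0 : 0 < t) (h1 : t < 1) {f g h : ℝ → ℝ≥0∞}
    (hf : Measurable f) (hg : Measurable g) (hh : Measurable h) {M : ℝ≥0∞} (hM : M ≠ ∞)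
    (hfM : ∀ x, f x ≤ M) (hgM : ∀ x, g x ≤ M)
    (hfg : ∀ x y, f x ^ (1 - t) * g y ^ t ≤ h ((1 - t) * x + t * y)) :
    (∫⁻ x, f x) ^ (1 - t) * (∫⁻ x, g x) ^ t ≤ ∫⁻ x, h x := by
  set α := ⨆ x, f x with hα
  set β := ⨆ x, g x with hβ
  have hsub : 0 < 1 - t := by linarith
  have hαt : α ≠ ∞ := ((iSup_le hfM).trans_lt hM.lt_top).ne
  have hβt : β ≠ ∞ := ((iSup_le hgM).trans_lt hM.lt_top).ne
  rcases eq_or_ne α 0 with hα0 | hα0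
  · have : ∀ x, f x = 0 := by simpa [hα0] using hα.symm
    simp [this, ENNReal.zero_rpow_of_pos hsub]
  rcases eq_or_ne β 0 with hβ0 | hβ0
  · have : ∀ x, g x = 0 := by simpa [hβ0] using hβ.symm
    simp [this, ENNReal.zero_rpow_of_pos h0]
  set S : ℝ≥0∞ := α ^ (1 - t) * β ^ t with hS
  have hS0 : S ≠ 0 := mul_ne_zero (by simp [hα0, hαt]) (by simp [hβ0, hβt])
  have hSt : S ≠ ∞ := ENNReal.mul_ne_top (ENNReal.rpow_ne_top_of_nonneg hsub.le hαt)
    (ENNReal.rpow_ne_top_of_nonneg h0.le hβt)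
  -- rescale so that both suprema are equal to `S`
  have hc : (S / α) ^ (1 - t) * (S / β) ^ t = 1 := by
    refine (ENNReal.mul_left_inj hS0 hSt).1 ?_
    nth_rewrite 3 [hS]
    rw [mul_mul_mul_comm, ← ENNReal.mul_rpow_of_nonneg _ _ hsub.le,
      ← ENNReal.mul_rpow_of_nonneg _ _ h0.le, ENNReal.div_mul_cancel hα0 hαt,
      ENNReal.div_mul_cancel hβ0 hβt, ← ENNReal.rpow_add_of_nonneg _ _ hsub.le h0.le]
    simp
  have key := lintegral_add_le_of_min_le h0 h1 (hf.const_mul (S / α)) (hg.const_mul (S / β)) hh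
    (S := S.toReal) (by rw [← ENNReal.mul_iSup, ← hα, ENNReal.ofReal_toReal hSt,
      ENNReal.div_mul_cancel hα0 hαt])
    (by rw [← ENNReal.mul_iSup, ← hβ, ENNReal.ofReal_toReal hSt, ENNReal.div_mul_cancel hβ0 hβt])
    (by
      intro x y
      refine (ENNReal.min_le_rpow_mul_rpow h0 h1 _ _).trans (le_trans (le_of_eq ?_) (hfg x y))
      rw [ENNReal.mul_rpow_of_nonneg _ _ hsub.le, ENNReal.mul_rpow_of_nonneg _ _ h0.le,
        mul_mul_mul_comm, hc, one_mul])
  rw [lintegral_const_mul _ hf, lintegral_const_mul _ hg] at key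
  refine le_trans (le_of_eq ?_) ((ENNReal.rpow_mul_rpow_le_add h0 h1 _ _).trans key)
  rw [ENNReal.mul_rpow_of_nonneg _ _ hsub.le, ENNReal.mul_rpow_of_nonneg _ _ h0.le,
        mul_mul_mul_comm, hc, one_mul]

/-- The Prékopa–Leindler inequality on the line. -/
lemma prekopaLeindler_real {t : ℝ} (h0 : 0 < t) (h1 : t < 1) {f g h : ℝ → ℝ≥0∞}
    (hf : Measurable f) (hg : Measurable g) (hh : Measurable h)
    (hfg : ∀ x y, f x ^ (1 - t) * g y ^ t ≤ h ((1 - t) * x + t * y)) :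
    (∫⁻ x, f x) ^ (1 - t) * (∫⁻ x, g x) ^ t ≤ ∫⁻ x, h x := by
  have hsub : 0 < 1 - t := by linarith
  have trunc : ∀ {u : ℝ → ℝ≥0∞}, Measurable u →
      ∫⁻ x, u x = ⨆ n : ℕ, ∫⁻ x, min (u x) n := by
    intro u hu
    rw [← lintegral_iSup (fun n => hu.min measurable_const)
      (fun n m hnm x => min_le_min_left _ (by exact_mod_cast hnm))]
    refine lintegral_congr fun x => ?_
    exact (by rw [← inf_iSup_eq, ENNReal.iSup_natCast, inf_top_eq] :
      u x = ⨆ n : ℕ, u x ⊓ n)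
  have mono : ∀ u : ℝ → ℝ≥0∞, Monotone fun n : ℕ => ∫⁻ x, min (u x) n := fun u n m hnm =>
    lintegral_mono fun x => min_le_min_left _ (by exact_mod_cast hnm)
  have hpow : ∀ {p : ℝ}, 0 < p → ∀ u : ℕ → ℝ≥0∞, (⨆ n, u n) ^ p = ⨆ n, u n ^ p :=
    fun hp u => (ENNReal.orderIsoRpow _ hp).map_iSup u
  rw [trunc hf, trunc hg, hpow hsub, hpow h0, ENNReal.iSup_mul]
  refine iSup_le fun n => ?_
  rw [ENNReal.mul_iSup]
  refine iSup_le fun m => ?_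
  refine le_trans (mul_le_mul' (ENNReal.rpow_le_rpow (mono f (le_max_left n m)) hsub.le)
    (ENNReal.rpow_le_rpow (mono g (le_max_right n m)) h0.le)) ?_
  refine prekopaLeindler_real_of_bounded h0 h1 (hf.min measurable_const)
    (hg.min measurable_const) hh (ENNReal.natCast_ne_top (max n m)) (fun x => min_le_right _ _)
    (fun x => min_le_right _ _) fun x y => le_trans (mul_le_mul' ?_ ?_) (hfg x y)
  · exact ENNReal.rpow_le_rpow (min_le_left _ _) hsub.le
  · exact ENNReal.rpow_le_rpow (min_le_left _ _) h0.le

/-- The Prékopa–Leindler inequality on `ℝⁿ`. -/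
lemma prekopaLeindler_pi {t : ℝ} (h0 : 0 < t) (h1 : t < 1) (n : ℕ) {f g h : (Fin n → ℝ) → ℝ≥0∞}
    (hf : Measurable f) (hg : Measurable g) (hh : Measurable h)
    (hfg : ∀ x y, f x ^ (1 - t) * g y ^ t ≤ h ((1 - t) • x + t • y)) :
    (∫⁻ x, f x) ^ (1 - t) * (∫⁻ x, g x) ^ t ≤ ∫⁻ x, h x := by
  induction n with
  | zero =>
    have := hfg default default
    rw [Subsingleton.elim ((1 - t) • (default : Fin 0 → ℝ) + t • default) default] at this
    simpa [volume_pi, Measure.pi_of_empty (fun _ : Fin 0 => (volume : Measure ℝ)) default] using this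
  | succ n ih =>
    let e := MeasurableEquiv.piFinSuccAbove (fun _ : Fin (n + 1) => ℝ) 0
    have he : MeasurePreserving e.symm volume volume :=
      (volume_preserving_piFinSuccAbove (fun _ : Fin (n + 1) => ℝ) 0).symm e
    have hlin : ∀ (x y : ℝ) (p q : Fin n → ℝ), e.symm ((1 - t) * x + t * y, (1 - t) • p + t • q)
        = (1 - t) • e.symm (x, p) + t • e.symm (y, q) := by
      intro x y p q
      ext i
      refine Fin.cases ?_ (fun j => ?_) i <;> simp [e, MeasurableEquiv.piFinSuccAbove,
        Fin.insertNthEquiv]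
    have split : ∀ {u : (Fin (n + 1) → ℝ) → ℝ≥0∞}, Measurable u →
        ∫⁻ x, u x = ∫⁻ a : ℝ, ∫⁻ p : Fin n → ℝ, u (e.symm (a, p)) := by
      intro u hu
      rw [← he.lintegral_comp hu, Measure.volume_eq_prod]
      exact lintegral_prod _ (hu.comp e.symm.measurable).aemeasurable
    have meas : ∀ {u : (Fin (n + 1) → ℝ) → ℝ≥0∞}, Measurable u →
        Measurable fun a : ℝ => ∫⁻ p : Fin n → ℝ, u (e.symm (a, p)) := fun hu =>
      (hu.comp e.symm.measurable).lintegral_prod_right'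
    rw [split hf, split hg, split hh]
    refine prekopaLeindler_real h0 h1 (meas hf) (meas hg) (meas hh) fun x y => ?_
    refine ih (hf.comp (e.symm.measurable.comp measurable_prodMk_left))
      (hg.comp (e.symm.measurable.comp measurable_prodMk_left))
      (hh.comp (e.symm.measurable.comp measurable_prodMk_left)) fun p q => ?_
    have := hfg (e.symm (x, p)) (e.symm (y, q))
    rwa [← hlin] at this

section InnerProductSpace

variable {E : Type*} [NormedAddCommGroup E] [InnerProductSpace ℝ E] [FiniteDimensional ℝ E]
  [MeasurableSpace E] [BorelSpace E]

/-- The multiplicative Brunn–Minkowski inequality. -/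
lemma volume_rpow_mul_rpow_le {t : ℝ} (h0 : 0 < t) (h1 : t < 1) {A B C : Set E}
    (hA : MeasurableSet A) (hB : MeasurableSet B) (hC : MeasurableSet C)
    (h : ∀ x ∈ A, ∀ y ∈ B, (1 - t) • x + t • y ∈ C) :
    volume A ^ (1 - t) * volume B ^ t ≤ volume C := by
  let φ : (Fin (Module.finrank ℝ E) → ℝ) → E := fun v =>
    (stdOrthonormalBasis ℝ E).repr.symm (WithLp.toLp 2 v)
  have hφ : MeasurePreserving φ volume volume :=
    (stdOrthonormalBasis ℝ E).measurePreserving_repr_symm.comp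
      (PiLp.volume_preserving_toLp _)
  have hlin : ∀ x y, φ ((1 - t) • x + t • y) = (1 - t) • φ x + t • φ y := by
    intro x y; simp [φ]
  have hsub : 0 < 1 - t := by linarith
  rw [← hφ.measure_preimage hA.nullMeasurableSet, ← hφ.measure_preimage hB.nullMeasurableSet,
    ← hφ.measure_preimage hC.nullMeasurableSet, ← lintegral_indicator_one (hφ.measurable hA),
    ← lintegral_indicator_one (hφ.measurable hB), ← lintegral_indicator_one (hφ.measurable hC)]
  refine prekopaLeindler_pi h0 h1 _ (measurable_one.indicator (hφ.measurable hA))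
    (measurable_one.indicator (hφ.measurable hB)) (measurable_one.indicator (hφ.measurable hC))
    fun x y => ?_
  by_cases hx : φ x ∈ A
  · by_cases hy : φ y ∈ B
    · have := h _ hx _ hy
      rw [← hlin] at this
      simp [indicator, hx, hy, this]
    · simp [indicator, hy, ENNReal.zero_rpow_of_pos h0]
  · simp [indicator, hx, ENNReal.zero_rpow_of_pos hsub]

/-- The set of all `u` such that the segment with midpoint `w` and half-length vector `u` has both
endpoints in `K`. -/
def chords (K : Set E) (w : E) : Set E := {u | w + u ∈ K ∧ w - u ∈ K}

/-- The volume of `chords K w`. -/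
noncomputable def chordVol (K : Set E) (w : E) : ℝ := volume.real (chords K w)

lemma isCompact_chords {K : Set E} (hK : IsCompact K) (w : E) : IsCompact (chords K w) := by
  have h1 : IsCompact ((fun u => w + u) ⁻¹' K) := (Homeomorph.addLeft w).isCompact_preimage.2 hK
  exact h1.inter_right (hK.isClosed.preimage (by fun_prop : Continuous fun u => w - u))

lemma volume_chords_ne_top {K : Set E} (hK : IsCompact K) (w : E) :
    volume (chords K w) ≠ ∞ := (isCompact_chords hK w).measure_lt_top.ne

lemma chordVol_nonneg (K : Set E) (w : E) : 0 ≤ chordVol K w := measureReal_nonneg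

lemma chordVol_rpow_mul_rpow_le {K : Set E} (hK : IsCompact K) (hKc : Convex ℝ K) {t : ℝ}
    (h0 : 0 < t) (h1 : t < 1) (w₀ w₁ : E) :
    chordVol K w₀ ^ (1 - t) * chordVol K w₁ ^ t ≤ chordVol K ((1 - t) • w₀ + t • w₁) := by
  have key := volume_rpow_mul_rpow_le h0 h1 (isCompact_chords hK w₀).measurableSet
    (isCompact_chords hK w₁).measurableSet (isCompact_chords hK ((1 - t) • w₀ + t • w₁)).measurableSet
    (by
      intro x hx y hy
      have e1 := hKc hx.1 hy.1 (sub_nonneg.2 h1.le) h0.le (by ring)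
      have e2 := hKc hx.2 hy.2 (sub_nonneg.2 h1.le) h0.le (by ring)
      constructor
      · convert e1 using 1; module
      · convert e2 using 1; module)
  have := ENNReal.toReal_mono (volume_chords_ne_top hK _) key
  rwa [ENNReal.toReal_mul, ← ENNReal.toReal_rpow, ← ENNReal.toReal_rpow] at this

lemma chordVol_pos {K : Set E} (hK : IsCompact K) {w : E} (hw : w ∈ interior K) :
    0 < chordVol K w := by
  refine ENNReal.toReal_pos (ne_of_gt ?_) (volume_chords_ne_top hK _)
  have h1 : IsOpen ((fun u => w + u) ⁻¹' interior K ∩ (fun u => w - u) ⁻¹' interior K) :=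
    (isOpen_interior.preimage (by fun_prop)).inter (isOpen_interior.preimage (by fun_prop))
  refine (h1.measure_pos volume ⟨0, by simpa using hw⟩).trans_le (measure_mono ?_)
  exact fun u hu => ⟨interior_subset hu.1, interior_subset hu.2⟩

/-- The volume of chords is dominated by an exponential which is exact at the origin. -/
lemma exists_chordVol_le_exp {K : Set E} (hK : IsCompact K) (hKc : Convex ℝ K)
    (h0 : (0 : E) ∈ interior K) :
    ∃ ξ : E, ∀ w, chordVol K w ≤ chordVol K 0 * Real.exp (inner ℝ ξ w) := by
  have hconc : ConcaveOn ℝ (interior K) fun w => Real.log (chordVol K w) := by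
    refine ⟨hKc.interior, fun x hx y hy a b ha hb hab => ?_⟩
    rcases ha.eq_or_lt with rfl | ha
    · obtain rfl : b = 1 := by linarith
      simp
    rcases hb.eq_or_lt with rfl | hb
    · obtain rfl : a = 1 := by linarith
      simp
    obtain rfl : a = 1 - b := by linarith
    have hx0 := chordVol_pos hK hx
    have hy0 := chordVol_pos hK hy
    have := Real.log_le_log (by positivity)
      (chordVol_rpow_mul_rpow_le hK hKc hb (by linarith) x y)
    rw [Real.log_mul (by positivity) (by positivity), Real.log_rpow hx0, Real.log_rpow hy0] at this
    simpa using this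
  have hcont : ContinuousOn (fun w => Real.log (chordVol K w)) (interior K) :=
    hconc.continuousOn isOpen_interior
  set L : E → ℝ := fun w => Real.log (chordVol K w) with hL
  let C : Set (E × ℝ) := {p | p.1 ∈ interior K ∧ p.2 < L p.1}
  have hCo : IsOpen C := by
    have : ContinuousOn (fun p : E × ℝ => L p.1 - p.2) (interior K ×ˢ univ) :=
      (hcont.comp continuousOn_fst fun p hp => hp.1).sub continuousOn_snd
    convert this.isOpen_inter_preimage (isOpen_interior.prod isOpen_univ) (isOpen_Ioi (a := (0 : ℝ)))
      using 1
    ext p; simp [C]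
  have hCc : Convex ℝ C := hconc.convex_strict_hypograph
  obtain ⟨f, hf⟩ := geometric_hahn_banach_open_point hCc hCo (x := ((0 : E), L 0)) (by simp [C])
  have hsplit : ∀ w τ, f (w, τ) = f (w, 0) + τ * f (0, 1) := by
    intro w τ
    rw [← smul_eq_mul, ← map_smul, ← map_add]; simp
  set c := f ((0 : E), (1 : ℝ)) with hc
  have hc0 : 0 < c := by
    have := hf ((0 : E), L 0 - 1) ⟨h0, by simp⟩
    rw [hsplit, hsplit 0 (L 0)] at this
    linarith
  have hle : ∀ w ∈ interior K, f (w, 0) + L w * c ≤ L 0 * c := by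
    intro w hw
    refine le_of_forall_pos_lt_add fun ε hε => ?_
    have := hf (w, L w - ε / c) ⟨hw, by simpa using by positivity⟩
    rw [hsplit, hsplit 0 (L 0), sub_mul, div_mul_cancel₀ _ hc0.ne'] at this
    have h00 : f ((0 : E), (0 : ℝ)) = 0 := map_zero f
    linarith
  let g : StrongDual ℝ E := (-c⁻¹) • f.comp (ContinuousLinearMap.inl ℝ E ℝ)
  have hg : ∀ w, c * g w = - f (w, 0) := by
    intro w
    simp [g]
    field_simp
  refine ⟨(InnerProductSpace.toDual ℝ E).symm g, fun w => ?_⟩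
  rw [InnerProductSpace.toDual_symm_apply]
  have hF0 := chordVol_pos hK h0
  rcases (chordVol_nonneg K w).eq_or_lt with hw | hw
  · rw [← hw]; positivity
  obtain ⟨t, htw, ht0, ht1⟩ : ∃ t : ℝ, t • w ∈ interior K ∧ 0 < t ∧ t < 1 := by
    have h1 : ∀ᶠ t : ℝ in nhdsWithin 0 (Ioi 0), t • w ∈ interior K := by
      refine nhdsWithin_le_nhds ?_
      have : ContinuousAt (fun t : ℝ => t • w) 0 := by fun_prop
      exact this.eventually_mem (by simpa using isOpen_interior.mem_nhds h0)
    have h2 : ∀ᶠ t : ℝ in nhdsWithin 0 (Ioi 0), t < 1 := nhdsWithin_le_nhds (Iio_mem_nhds one_pos)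
    obtain ⟨t, ht⟩ := (h1.and ((eventually_mem_nhdsWithin (a := (0 : ℝ)) (s := Ioi 0)).and h2)).exists
    exact ⟨t, ht.1, ht.2.1, ht.2.2⟩
  have h1 := Real.log_le_log (by positivity) (chordVol_rpow_mul_rpow_le hK hKc ht0 ht1 0 w)
  rw [Real.log_mul (by positivity) (by positivity), Real.log_rpow hF0, Real.log_rpow hw, smul_zero,
    zero_add] at h1
  have h2 := hle _ htw
  have h3 : f (t • w, (0 : ℝ)) = t * f (w, 0) := by
    rw [← smul_eq_mul, ← map_smul]; simp
  have h4 := hg w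
  have h5 : Real.log (chordVol K w) ≤ Real.log (chordVol K 0) + g w := by
    refine le_of_mul_le_mul_left ?_ (mul_pos hc0 ht0)
    have := mul_le_mul_of_nonneg_left h1 hc0.le
    simp only [hL] at h2
    rw [h3] at h2
    linear_combination this + h2 - t * h4
  rw [← Real.exp_log hF0, ← Real.exp_add, ← Real.log_le_iff_le_exp hw]
  simpa using h5

end InnerProductSpace

section LogLaplace

variable {E : Type*} [NormedAddCommGroup E] [InnerProductSpace ℝ E] [FiniteDimensional ℝ E]
  [MeasurableSpace E] [BorelSpace E]

/-- A convex body whose centre of mass is the origin. -/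
structure IsCentredBody (K : Set E) : Prop where
  isCompact : IsCompact K
  convex : Convex ℝ K
  interior_nonempty : (interior K).Nonempty
  integral_eq_zero : ∫ x in K, x = 0

/-- The Laplace transform of the uniform measure on `K`. -/
noncomputable def lapMass (K : Set E) (y : E) : ℝ := ∫ x in K, Real.exp (inner ℝ y x)

/-- The logarithmic Laplace transform of the uniform probability measure on `K`. -/
noncomputable def logLap (K : Set E) (y : E) : ℝ := Real.log (lapMass K y / volume.real K)

/-- The exponentially tilted uniform measure on `K`. -/
noncomputable def tilt (K : Set E) (y : E) : Measure E :=
  (volume.restrict K).tilted (fun x => inner ℝ y x)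

/-- The barycentre of the tilted measure. -/
noncomputable def tiltMean (K : Set E) (y : E) : E := ∫ x, x ∂tilt K y

/-- The covariance operator of the tilted measure. -/
noncomputable def tiltCov (K : Set E) (y : E) : E →L[ℝ] E :=
  (∫ x, (innerSL ℝ x).smulRight x ∂tilt K y) -
    (innerSL ℝ (tiltMean K y)).smulRight (tiltMean K y)

lemma hasFDerivAt_integral_exp_smul {K : Set E} (hK : IsCompact K) {G : Type*}
    [NormedAddCommGroup G] [NormedSpace ℝ G] {g : E → G} (hg : Continuous g) (y : E) :
    HasFDerivAt (fun y => ∫ x in K, Real.exp (inner ℝ y x) • g x)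
      (∫ x in K, Real.exp (inner ℝ y x) • (innerSL ℝ x).smulRight (g x)) y := by
  obtain ⟨R, hR⟩ := hK.isBounded.exists_norm_le
  obtain ⟨C, hC⟩ := hK.exists_bound_of_continuousOn hg.continuousOn
  have hInt : ∀ {G' : Type _} [NormedAddCommGroup G'] [NormedSpace ℝ G'] {u : E → G'},
      Continuous u → IntegrableOn u K := fun hu => hu.continuousOn.integrableOn_compact hK
  have hsmul : Continuous fun x : E => (innerSL ℝ x).smulRight (g x) :=
    ((ContinuousLinearMap.smulRightL ℝ E G).continuous₂).comp
      ((innerSL ℝ).continuous.prodMk hg)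
  refine hasFDerivAt_integral_of_dominated_of_fderiv_le (s := Metric.ball y 1)
    (bound := fun _ => Real.exp ((‖y‖ + 1) * R) * (R * C))
    (F := fun y x => Real.exp (inner ℝ y x) • g x)
    (F' := fun y x => Real.exp (inner ℝ y x) • (innerSL ℝ x).smulRight (g x))
    (Metric.ball_mem_nhds y one_pos) (.of_forall fun z => ?_) (hInt (by fun_prop)) ?_ ?_ ?_ ?_
  · exact Continuous.aestronglyMeasurable (by fun_prop)
  · exact Continuous.aestronglyMeasurable (by fun_prop)
  · refine (ae_restrict_mem hK.measurableSet).mono fun x hx z hz => ?_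
    rw [norm_smul, ContinuousLinearMap.norm_smulRight_apply, innerSL_apply_norm]
    have hRx := hR x hx
    have hzn : ‖z‖ ≤ ‖y‖ + 1 := by
      have := norm_le_norm_add_norm_sub' z y
      rw [Metric.mem_ball, dist_eq_norm] at hz
      linarith
    have : inner ℝ z x ≤ (‖y‖ + 1) * R := (real_inner_le_norm z x).trans (by gcongr)
    rw [Real.norm_of_nonneg (Real.exp_nonneg _)]
    gcongr
    · exact (norm_nonneg _).trans hRx
    · exact hC x hx
  · exact integrableOn_const hK.measure_lt_top.ne
  · refine .of_forall fun x z _ => ?_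
    have h1 : HasFDerivAt (fun z : E => Real.exp (inner ℝ z x))
        (Real.exp (inner ℝ z x) • innerSL ℝ x) z := by
      have h2 : HasFDerivAt (fun z : E => (inner ℝ z x : ℝ)) (innerSL ℝ x) z := by
        simp_rw [real_inner_comm x]
        exact (innerSL ℝ x).hasFDerivAt
      exact h2.exp
    refine (h1.smul_const (g x)).congr_fderiv ?_
    ext v; simp [smul_smul]

namespace IsCentredBody

variable {K : Set E}

lemma zero_mem_interior (hK : IsCentredBody K) : (0 : E) ∈ interior K := by
  by_contra h
  obtain ⟨f, hf⟩ := geometric_hahn_banach_open_point hK.convex.interior isOpen_interior h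
  simp only [map_zero] at hf
  have hInt : IntegrableOn (fun x : E => x) K := continuousOn_id.integrableOn_compact hK.isCompact
  have h1 : ∫ x in K, f x = 0 := by
    rw [f.integral_comp_comm hInt, hK.integral_eq_zero, map_zero]
  have h2 : ∀ x ∈ K, f x ≤ 0 := by
    intro x hx
    have : x ∈ closure (interior K) := by
      rw [hK.convex.closure_interior_eq_closure_of_nonempty_interior hK.interior_nonempty]
      exact subset_closure hx
    exact closure_minimal (fun z hz => (hf z hz).le) (isClosed_le f.continuous continuous_const) this
  have h3 : (fun x => - f x) =ᵐ[volume.restrict K] 0 := by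
    refine (setIntegral_eq_zero_iff_of_nonneg_ae ?_ (f.integrable_comp hInt).neg).1 ?_
    · exact (ae_restrict_mem hK.isCompact.measurableSet).mono fun x hx => by simpa using h2 x hx
    · exact (integral_neg _).trans (by rw [h1, neg_zero])
  have h4 : volume (interior K) = 0 := by
    have h5 := (ae_restrict_iff' hK.isCompact.measurableSet).1 h3
    refine measure_mono_null (fun x hx => ?_) (mem_ae_iff.1 h5)
    simp only [mem_compl_iff, mem_ofPred_eq, not_forall]
    exact ⟨interior_subset hx, by simpa using (hf x hx).ne⟩
  exact (isOpen_interior.measure_pos volume hK.interior_nonempty).ne' h4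

lemma measurableSet (hK : IsCentredBody K) : MeasurableSet K := hK.isCompact.measurableSet

lemma volume_ne_top (hK : IsCentredBody K) : volume K ≠ ∞ := hK.isCompact.measure_lt_top.ne

lemma volume_ne_zero (hK : IsCentredBody K) : volume K ≠ 0 :=
  ((isOpen_interior.measure_pos volume hK.interior_nonempty).trans_le
    (measure_mono interior_subset)).ne'

lemma volume_pos (hK : IsCentredBody K) : 0 < volume.real K :=
  ENNReal.toReal_pos hK.volume_ne_zero hK.volume_ne_top

lemma integrableOn (hK : IsCentredBody K) {G : Type*} [NormedAddCommGroup G] {g : E → G}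
    (hg : Continuous g) : IntegrableOn g K := hg.continuousOn.integrableOn_compact hK.isCompact

lemma neZero_restrict (hK : IsCentredBody K) : NeZero (volume.restrict K : Measure E) :=
  ⟨by simpa using hK.volume_ne_zero⟩

lemma lapMass_pos (hK : IsCentredBody K) (y : E) : 0 < lapMass K y := by
  have := hK.neZero_restrict
  exact integral_exp_pos (hK.integrableOn (by fun_prop))

lemma isProbabilityMeasure_tilt (hK : IsCentredBody K) (y : E) :
    IsProbabilityMeasure (tilt K y) := by
  have := hK.neZero_restrict
  exact isProbabilityMeasure_tilted (hK.integrableOn (by fun_prop))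

lemma integral_tilt {G : Type*} [NormedAddCommGroup G] [NormedSpace ℝ G] (y : E) (g : E → G) :
    ∫ x, g x ∂tilt K y = (lapMass K y)⁻¹ • ∫ x in K, Real.exp (inner ℝ y x) • g x := by
  rw [tilt, integral_tilted, ← integral_smul]
  simp_rw [div_eq_inv_mul, smul_smul]
  rfl

lemma integrable_tilt (hK : IsCentredBody K) {G : Type*} [NormedAddCommGroup G] [NormedSpace ℝ G]
    (y : E) {g : E → G} (hg : Continuous g) : Integrable g (tilt K y) :=
  (integrable_tilted_iff (hK.integrableOn (by fun_prop)) g).2 (hK.integrableOn (by fun_prop))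

lemma ae_tilt_mem (hK : IsCentredBody K) (y : E) : ∀ᵐ x ∂tilt K y, x ∈ K :=
  (tilted_absolutelyContinuous _ _).ae_le (ae_restrict_mem hK.measurableSet)

lemma tiltMean_mem (hK : IsCentredBody K) (y : E) : tiltMean K y ∈ K := by
  have := hK.isProbabilityMeasure_tilt y
  exact hK.convex.integral_mem hK.isCompact.isClosed (hK.ae_tilt_mem y)
    (hK.integrable_tilt y continuous_id)

lemma tiltMean_zero (hK : IsCentredBody K) : tiltMean K 0 = 0 := by
  rw [tiltMean, integral_tilt]
  simp [hK.integral_eq_zero]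

lemma lapMass_eq (y : E) : lapMass K y = ∫ x in K, Real.exp (inner ℝ y x) • (1 : ℝ) := by
  simp [lapMass]

lemma continuous_smulRight_self : Continuous fun x : E => (innerSL ℝ x).smulRight x :=
  ((ContinuousLinearMap.smulRightL ℝ E E).continuous₂).comp
    ((innerSL ℝ).continuous.prodMk continuous_id)

lemma hasFDerivAt_lapMass (hK : IsCentredBody K) (y : E) :
    HasFDerivAt (lapMass K) (lapMass K y • innerSL ℝ (tiltMean K y)) y := by
  have h := hasFDerivAt_integral_exp_smul hK.isCompact (continuous_const (y := (1 : ℝ))) y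
  simp_rw [← lapMass_eq] at h
  refine h.congr_fderiv ?_
  ext v
  rw [ContinuousLinearMap.integral_apply]
  · symm
    rw [tiltMean, integral_tilt, map_smul, smul_smul, mul_inv_cancel₀ (hK.lapMass_pos y).ne',
      one_smul]
    simp only [innerSL_apply_apply]
    rw [real_inner_comm, ← integral_inner (hK.integrableOn
      (by fun_prop : Continuous fun x : E => Real.exp (inner ℝ y x) • x))]
    refine integral_congr_ae (.of_forall fun x => ?_)
    simp [real_inner_smul_right, real_inner_comm]
  · have hsmul : Continuous fun x : E => (innerSL ℝ x).smulRight (1 : ℝ) :=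
      ((ContinuousLinearMap.smulRightL ℝ E ℝ).continuous₂).comp
        ((innerSL ℝ).continuous.prodMk continuous_const)
    exact hK.integrableOn (by fun_prop)

lemma hasFDerivAt_logLap (hK : IsCentredBody K) (y : E) :
    HasFDerivAt (logLap K) (innerSL ℝ (tiltMean K y)) y := by
  have hv := hK.volume_pos
  have hN := hK.lapMass_pos y
  have h := ((hK.hasFDerivAt_lapMass y).mul_const (volume.real K)⁻¹).log (by positivity)
  refine h.congr_fderiv ?_
  ext v
  simp
  field_simp

lemma hasFDerivAt_tiltMean (hK : IsCentredBody K) (y : E) :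
    HasFDerivAt (tiltMean K) (tiltCov K y) y := by
  have hN := hK.lapMass_pos y
  have h1 := hasFDerivAt_integral_exp_smul hK.isCompact continuous_id y
  have h2 := (hasDerivAt_inv hN.ne').comp_hasFDerivAt y (hK.hasFDerivAt_lapMass y)
  have h3 := h2.smul h1
  have e : tiltMean K = fun y => (lapMass K y)⁻¹ • ∫ x in K, Real.exp (inner ℝ y x) • id x := by
    ext1 z; rw [tiltMean, integral_tilt]; rfl
  have e' : ∫ x in K, Real.exp (inner ℝ y x) • id x = lapMass K y • tiltMean K y := by
    rw [e]; simp only []; rw [smul_smul, mul_inv_cancel₀ hN.ne', one_smul]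
  rw [e]
  refine h3.congr_fderiv ?_
  ext v
  simp only [Function.comp_apply, e']
  symm
  rw [tiltCov, integral_tilt]
  simp [smul_smul]
  rw [sub_eq_add_neg, ← neg_smul]
  congr 2
  field_simp
  rw [neg_smul]

lemma continuous_tiltMean (hK : IsCentredBody K) : Continuous (tiltMean K) :=
  continuous_iff_continuousAt.2 fun y => (hK.hasFDerivAt_tiltMean y).continuousAt

lemma continuous_logLap (hK : IsCentredBody K) : Continuous (logLap K) :=
  continuous_iff_continuousAt.2 fun y => (hK.hasFDerivAt_logLap y).continuousAt

lemma continuous_lapMass (hK : IsCentredBody K) : Continuous (lapMass K) :=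
  continuous_iff_continuousAt.2 fun y => (hK.hasFDerivAt_lapMass y).continuousAt

lemma continuous_tiltCov (hK : IsCentredBody K) : Continuous (tiltCov K) := by
  refine Continuous.sub ?_ (continuous_smulRight_self.comp hK.continuous_tiltMean)
  simp_rw [integral_tilt]
  refine (hK.continuous_lapMass.inv₀ fun y => (hK.lapMass_pos y).ne').smul ?_
  exact continuous_iff_continuousAt.2 fun y =>
    (hasFDerivAt_integral_exp_smul hK.isCompact continuous_smulRight_self y).continuousAt

end IsCentredBody
end LogLaplace

section LogLaplaceConvexity

variable {E : Type*} [NormedAddCommGroup E] [InnerProductSpace ℝ E] [FiniteDimensional ℝ E]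
  [MeasurableSpace E] [BorelSpace E] {K : Set E}

lemma exists_eigenbasis {T : E →L[ℝ] E} (hs : ∀ u v, inner ℝ (T u) v = inner ℝ u (T v))
    (hp : ∀ u, u ≠ 0 → 0 < inner ℝ u (T u)) :
    ∃ (e : OrthonormalBasis (Fin (Module.finrank ℝ E)) ℝ E) (μ : Fin (Module.finrank ℝ E) → ℝ),
      (∀ i, 0 < μ i) ∧ (∀ i, T (e i) = μ i • e i) ∧ T.det = ∏ i, μ i := by
  have hsym : (T : E →ₗ[ℝ] E).IsSymmetric := hs
  have heig : ∀ i, T (hsym.eigenvectorBasis rfl i)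
      = hsym.eigenvalues rfl i • hsym.eigenvectorBasis rfl i := fun i => by
    exact hsym.apply_eigenvectorBasis rfl i
  refine ⟨hsym.eigenvectorBasis rfl, hsym.eigenvalues rfl, fun i => ?_, heig, ?_⟩
  · have h := hp (hsym.eigenvectorBasis rfl i) ((hsym.eigenvectorBasis rfl).orthonormal.ne_zero i)
    rw [heig, real_inner_smul_right, real_inner_self_eq_norm_sq] at h
    simpa using h
  · have := hsym.det_eq_prod_eigenvalues rfl
    simpa using this

lemma det_pos_of_inner_pos {T : E →L[ℝ] E} (hs : ∀ u v, inner ℝ (T u) v = inner ℝ u (T v))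
    (hp : ∀ u, u ≠ 0 → 0 < inner ℝ u (T u)) : 0 < T.det := by
  obtain ⟨e, μ, hμ, -, h⟩ := exists_eigenbasis hs hp
  exact h ▸ Finset.prod_pos fun i _ => hμ i

namespace IsCentredBody

lemma integral_inner_tilt (hK : IsCentredBody K) (y u : E) :
    ∫ x, inner ℝ u x ∂tilt K y = inner ℝ u (tiltMean K y) :=
  integral_inner (hK.integrable_tilt y continuous_id) u

lemma inner_tiltCov (hK : IsCentredBody K) (y u v : E) :
    inner ℝ u (tiltCov K y v) =
      ∫ x, inner ℝ u (x - tiltMean K y) * inner ℝ v (x - tiltMean K y) ∂tilt K y := by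
  have := hK.isProbabilityMeasure_tilt y
  have hi : ∀ {g : E → ℝ}, Continuous g → Integrable g (tilt K y) := fun hg =>
    hK.integrable_tilt y hg
  have h1 : inner ℝ u ((∫ x, (innerSL ℝ x).smulRight x ∂tilt K y) v)
      = ∫ x, inner ℝ u x * inner ℝ v x ∂tilt K y := by
    rw [ContinuousLinearMap.integral_apply (hK.integrable_tilt y continuous_smulRight_self),
      ← integral_inner (hK.integrable_tilt y (by fun_prop))]
    refine integral_congr_ae (.of_forall fun x => ?_)
    simp [real_inner_smul_right, real_inner_comm, mul_comm]
  set a := tiltMean K y with ha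
  have h2 : ∀ x : E, inner ℝ u (x - a) * inner ℝ v (x - a) = inner ℝ u x * inner ℝ v x
      - inner ℝ v a * inner ℝ u x - inner ℝ u a * inner ℝ v x + inner ℝ u a * inner ℝ v a := by
    intro x
    rw [inner_sub_right, inner_sub_right]; ring
  simp_rw [h2]
  rw [integral_add (hi (by fun_prop)) (hi (by fun_prop)), integral_sub (hi (by fun_prop))
    (hi (by fun_prop)), integral_sub (hi (by fun_prop)) (hi (by fun_prop)), integral_const_mul,
    integral_const_mul, hK.integral_inner_tilt, hK.integral_inner_tilt, ← ha, tiltCov]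
  simp only [sub_apply, inner_sub_right, h1]
  simp [real_inner_smul_right, ← ha, real_inner_comm]

lemma inner_tiltCov_comm (hK : IsCentredBody K) (y u v : E) :
    inner ℝ (tiltCov K y u) v = inner ℝ u (tiltCov K y v) := by
  rw [real_inner_comm, hK.inner_tiltCov, hK.inner_tiltCov]
  simp_rw [mul_comm]

lemma inner_tiltCov_self (hK : IsCentredBody K) (y u : E) :
    inner ℝ u (tiltCov K y u) = ∫ x, inner ℝ u (x - tiltMean K y) ^ 2 ∂tilt K y := by
  rw [hK.inner_tiltCov]; simp_rw [sq]

lemma inner_tiltCov_pos (hK : IsCentredBody K) (y : E) {u : E} (hu : u ≠ 0) :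
    0 < inner ℝ u (tiltCov K y u) := by
  have := hK.isProbabilityMeasure_tilt y
  rw [hK.inner_tiltCov_self]
  refine lt_of_le_of_ne (integral_nonneg fun x => sq_nonneg _) fun h => ?_
  have h1 := (integral_eq_zero_iff_of_nonneg (fun x => sq_nonneg _)
    (hK.integrable_tilt y ((continuous_const.inner (continuous_id.sub continuous_const)).pow 2))).1
    h.symm
  have h2 : ∀ᵐ x ∂volume.restrict K, inner ℝ u (x - tiltMean K y) ^ 2 = 0 :=
    (absolutelyContinuous_tilted (hK.integrableOn (by fun_prop))).ae_le h1
  have h3 : ∀ᵐ x ∂volume.restrict (interior K), inner ℝ u (x - tiltMean K y) ^ 2 = 0 :=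
    ae_restrict_of_ae_restrict_of_subset interior_subset h2
  have h4 : ∀ x ∈ interior K, inner ℝ u (x - tiltMean K y) ^ 2 = 0 := by
    have := Measure.eqOn_open_of_ae_eq (μ := volume) (f := fun x => inner ℝ u (x - tiltMean K y) ^ 2)
      (g := 0) h3 isOpen_interior (by fun_prop) (by fun_prop)
    exact this
  have h5 : ∀ᶠ s : ℝ in nhds 0, s • u ∈ interior K := by
    have : ContinuousAt (fun s : ℝ => s • u) 0 := by fun_prop
    exact this.eventually_mem (by simpa using isOpen_interior.mem_nhds hK.zero_mem_interior)
  obtain ⟨s, hs, hs0⟩ := ((h5.filter_mono nhdsWithin_le_nhds).and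
    (self_mem_nhdsWithin : {(0 : ℝ)}ᶜ ∈ nhdsWithin 0 {0}ᶜ)).exists
  have e1 := pow_eq_zero_iff (two_ne_zero) |>.1 (h4 _ hs)
  have e2 := pow_eq_zero_iff (two_ne_zero) |>.1 (h4 _ hK.zero_mem_interior)
  rw [inner_sub_right, real_inner_smul_right] at e1
  rw [zero_sub, inner_neg_right] at e2
  have e3 : s * inner ℝ u u = 0 := by linarith
  rcases mul_eq_zero.1 e3 with h | h
  · exact hs0 h
  · exact hu (inner_self_eq_zero.1 h)

/-- `logLap` lies above its tangent planes. -/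
lemma logLap_add_inner_le (hK : IsCentredBody K) (x y : E) :
    logLap K y + inner ℝ (x - y) (tiltMean K y) ≤ logLap K x := by
  have := hK.isProbabilityMeasure_tilt y
  have hv := hK.volume_pos
  have hNy := hK.lapMass_pos y
  have hNx := hK.lapMass_pos x
  have h1 : ∫ z, Real.exp (inner ℝ (x - y) z) ∂tilt K y = lapMass K x / lapMass K y := by
    rw [integral_tilt, div_eq_inv_mul, smul_eq_mul, lapMass]
    congr 2
    ext z
    rw [smul_eq_mul, ← Real.exp_add, ← inner_add_left]; simp
  set m := inner ℝ (x - y) (tiltMean K y) with hm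
  have h2 : Real.exp m ≤ ∫ z, Real.exp (inner ℝ (x - y) z) ∂tilt K y := by
    have h3 : ∫ z, Real.exp m * (1 + (inner ℝ (x - y) z - m)) ∂tilt K y = Real.exp m := by
      rw [integral_const_mul, integral_add (integrable_const _)
        ((hK.integrable_tilt y (by fun_prop))), integral_sub (hK.integrable_tilt y (by fun_prop))
        (integrable_const _), hK.integral_inner_tilt]
      simp [← hm]
    rw [← h3]
    refine integral_mono (hK.integrable_tilt y (by fun_prop)) (hK.integrable_tilt y (by fun_prop))
      fun z => ?_
    have := Real.add_one_le_exp (inner ℝ (x - y) z - m)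
    calc Real.exp m * (1 + (inner ℝ (x - y) z - m))
        ≤ Real.exp m * Real.exp (inner ℝ (x - y) z - m) := by gcongr; linarith
      _ = Real.exp (inner ℝ (x - y) z) := by rw [← Real.exp_add]; congr 1; ring
  rw [h1, ← Real.le_log_iff_exp_le (by positivity), Real.log_div hNx.ne' hNy.ne'] at h2
  rw [logLap, logLap, Real.log_div hNx.ne' hv.ne', Real.log_div hNy.ne' hv.ne']
  linarith

lemma logLap_zero (hK : IsCentredBody K) : logLap K 0 = 0 := by
  simp [logLap, lapMass, hK.volume_pos.ne']

lemma logLap_nonneg (hK : IsCentredBody K) (y : E) : 0 ≤ logLap K y := by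
  simpa [hK.logLap_zero, hK.tiltMean_zero] using hK.logLap_add_inner_le y 0

lemma logLap_le_inner (hK : IsCentredBody K) (y : E) :
    logLap K y ≤ inner ℝ y (tiltMean K y) := by
  have := hK.logLap_add_inner_le 0 y
  simp only [hK.logLap_zero, zero_sub, inner_neg_left] at this
  linarith

lemma two_mul_logLap_midpoint_le (hK : IsCentredBody K) (x x' : E) :
    2 * logLap K ((1 / 2 : ℝ) • (x + x')) ≤ logLap K x + logLap K x' := by
  have h1 := hK.logLap_add_inner_le x ((1 / 2 : ℝ) • (x + x'))
  have h2 := hK.logLap_add_inner_le x' ((1 / 2 : ℝ) • (x + x'))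
  have e : x' - (1 / 2 : ℝ) • (x + x') = - (x - (1 / 2 : ℝ) • (x + x')) := by module
  rw [e, inner_neg_left] at h2
  linarith

lemma inner_tiltMean_sub_nonneg (hK : IsCentredBody K) (x y : E) :
    0 ≤ inner ℝ (x - y) (tiltMean K x - tiltMean K y) := by
  have h1 := hK.logLap_add_inner_le x y
  have h2 := hK.logLap_add_inner_le y x
  rw [← neg_sub x y, inner_neg_left] at h2
  rw [inner_sub_right]; linarith

lemma inner_tiltMean_sub_pos (hK : IsCentredBody K) {x y : E} (hxy : x ≠ y) :
    0 < inner ℝ (x - y) (tiltMean K x - tiltMean K y) := by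
  let g : ℝ → ℝ := fun t => inner ℝ (x - y) (tiltMean K (y + t • (x - y)))
  have hg : ∀ t, HasDerivAt g (inner ℝ (x - y) (tiltCov K (y + t • (x - y)) (x - y))) t := by
    intro t
    have h1 : HasDerivAt (fun t : ℝ => y + t • (x - y)) (x - y) t := by
      simpa using ((hasDerivAt_id t).smul_const (x - y)).const_add y
    have h2 := (hK.hasFDerivAt_tiltMean (y + t • (x - y))).comp_hasDerivAt t h1
    exact ((innerSL ℝ (x - y)).hasFDerivAt).comp_hasDerivAt t h2
  have hmono : StrictMono g := strictMono_of_deriv_pos fun t => by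
    rw [(hg t).deriv]; exact hK.inner_tiltCov_pos _ (sub_ne_zero.2 hxy)
  have := hmono zero_lt_one
  simp only [g, zero_smul, add_zero, one_smul, add_sub_cancel] at this
  rw [inner_sub_right]; linarith

lemma injective_tiltMean (hK : IsCentredBody K) : Function.Injective (tiltMean K) := by
  intro x y h
  by_contra hxy
  have := hK.inner_tiltMean_sub_pos hxy
  simp [h] at this

lemma exists_norm_tiltCov_le (hK : IsCentredBody K) : ∃ C, ∀ y, ‖tiltCov K y‖ ≤ C := by
  obtain ⟨R, hR⟩ := hK.isCompact.isBounded.exists_norm_le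
  refine ⟨R * R + R * R, fun y => ?_⟩
  have := hK.isProbabilityMeasure_tilt y
  have hR0 : 0 ≤ R := (norm_nonneg _).trans (hR _ (hK.tiltMean_mem y))
  refine (norm_sub_le _ _).trans (add_le_add ?_ ?_)
  · refine (norm_integral_le_of_norm_le_const (C := R * R) ?_).trans_eq (by simp)
    refine (hK.ae_tilt_mem y).mono fun x hx => ?_
    rw [ContinuousLinearMap.norm_smulRight_apply, innerSL_apply_norm]
    have := hR x hx
    gcongr
  · rw [ContinuousLinearMap.norm_smulRight_apply, innerSL_apply_norm]
    have := hR _ (hK.tiltMean_mem y)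
    gcongr

lemma exists_eigenbasis_tiltCov (hK : IsCentredBody K) (y : E) :
    ∃ (e : OrthonormalBasis (Fin (Module.finrank ℝ E)) ℝ E) (μ : Fin (Module.finrank ℝ E) → ℝ),
      (∀ i, 0 < μ i) ∧ (∀ i, tiltCov K y (e i) = μ i • e i) ∧ (tiltCov K y).det = ∏ i, μ i :=
  exists_eigenbasis (hK.inner_tiltCov_comm y) fun _ hu => hK.inner_tiltCov_pos y hu

lemma det_tiltCov_pos (hK : IsCentredBody K) (y : E) : 0 < (tiltCov K y).det :=
  det_pos_of_inner_pos (hK.inner_tiltCov_comm y) fun _ hu => hK.inner_tiltCov_pos y hu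

lemma exists_le_logLap (hK : IsCentredBody K) :
    ∃ ρ C : ℝ, 0 < ρ ∧ ∀ y, ρ * ‖y‖ - C ≤ logLap K y := by
  obtain ⟨r, hr, hball⟩ := Metric.isOpen_iff.1 isOpen_interior 0 hK.zero_mem_interior
  set ρ := r / 3 with hρ
  have hρ0 : 0 < ρ := by positivity
  set b := volume.real (Metric.ball (0 : E) ρ) with hb
  have hb0 : 0 < b := ENNReal.toReal_pos (Metric.measure_ball_pos _ _ hρ0).ne'
    measure_ball_lt_top.ne
  have hv := hK.volume_pos
  refine ⟨ρ, - Real.log (b / volume.real K), hρ0, fun y => ?_⟩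
  let c : E := (2 * ρ * ‖y‖⁻¹) • y
  have hc : ‖c‖ ≤ 2 * ρ := by
    simp only [c, norm_smul, norm_mul, norm_inv, Real.norm_eq_abs, abs_of_pos hρ0,
      Nat.abs_ofNat]
    rcases eq_or_ne ‖y‖ 0 with h | h
    · simp [h]; positivity
    · rw [abs_of_nonneg (norm_nonneg y)]; field_simp; rfl
  have hcy : inner ℝ y c = 2 * ρ * ‖y‖ := by
    simp only [c, real_inner_smul_right, real_inner_self_eq_norm_sq]
    rcases eq_or_ne ‖y‖ 0 with h | h
    · simp [h]
    · field_simp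
  have hsub : Metric.ball c ρ ⊆ K := by
    refine Subset.trans (Subset.trans (fun x hx => ?_) hball) interior_subset
    rw [mem_ball_zero_iff]
    rw [Metric.mem_ball, dist_eq_norm] at hx
    have := norm_le_norm_add_norm_sub' x c
    linarith
  have h1 : b * Real.exp (ρ * ‖y‖) ≤ lapMass K y := by
    calc b * Real.exp (ρ * ‖y‖) = ∫ x in Metric.ball c ρ, Real.exp (ρ * ‖y‖) := by
          rw [setIntegral_const, smul_eq_mul, hb, measureReal_def, measureReal_def,
            Measure.addHaar_ball_center volume c]
      _ ≤ ∫ x in Metric.ball c ρ, Real.exp (inner ℝ y x) := by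
          refine setIntegral_mono_on (integrableOn_const measure_ball_lt_top.ne)
            ((hK.integrableOn (by fun_prop)).mono_set hsub) measurableSet_ball fun x hx => ?_
          rw [Real.exp_le_exp]
          rw [Metric.mem_ball, dist_eq_norm] at hx
          have h2 : inner ℝ y x = inner ℝ y c + inner ℝ y (x - c) := by
            rw [← inner_add_right]; simp
          have h3 : - (‖y‖ * ‖x - c‖) ≤ inner ℝ y (x - c) :=
            neg_le_of_abs_le (abs_real_inner_le_norm _ _)
          have h4 : ‖y‖ * ‖x - c‖ ≤ ‖y‖ * ρ := by gcongr
          linarith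
      _ ≤ lapMass K y := setIntegral_mono_set (hK.integrableOn (by fun_prop))
          (.of_forall fun x => (Real.exp_nonneg _)) hsub.eventuallyLE
  have h2 : Real.log (b / volume.real K) + ρ * ‖y‖ ≤ logLap K y := by
    rw [logLap, Real.le_log_iff_exp_le (div_pos (hK.lapMass_pos y) hv), Real.exp_add,
      Real.exp_log (by positivity), div_mul_eq_mul_div]
    gcongr
  linarith

end IsCentredBody

lemma integrable_exp_neg_mul_norm {c : ℝ} (hc : 0 < c) :
    Integrable fun y : E => Real.exp (-c * ‖y‖) := by
  set r : ℕ := Module.finrank ℝ E + 1 with hr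
  have h1 : Integrable fun y : E => (1 + ‖y‖) ^ (-(r : ℝ)) :=
    integrable_one_add_norm (by simp [hr])
  refine (h1.const_mul (r.factorial * (c⁻¹) ^ r * Real.exp c)).mono'
    (Continuous.aestronglyMeasurable (by fun_prop)) (.of_forall fun y => ?_)
  have h2 := Real.pow_div_factorial_le_exp (c * (1 + ‖y‖)) (by positivity) r
  rw [Real.norm_of_nonneg (Real.exp_nonneg _), Real.rpow_neg (by positivity), Real.rpow_natCast,
    ← div_eq_mul_inv, le_div_iff₀ (by positivity)]
  rw [div_le_iff₀ (by positivity), mul_pow] at h2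
  calc Real.exp (-c * ‖y‖) * (1 + ‖y‖) ^ r
      = Real.exp (-c * ‖y‖) * (c⁻¹ ^ r * (c ^ r * (1 + ‖y‖) ^ r)) := by
        rw [← mul_assoc (c⁻¹ ^ r), ← mul_pow, inv_mul_cancel₀ hc.ne']; simp
    _ ≤ Real.exp (-c * ‖y‖) * (c⁻¹ ^ r * (Real.exp (c * (1 + ‖y‖)) * r.factorial)) := by gcongr
    _ = _ := by
        rw [mul_add, Real.exp_add, mul_one, neg_mul, Real.exp_neg]
        field_simp

end LogLaplaceConvexity

/-- An integral of exponentials of Laurent polynomials in a complex parameter is holomorphic. -/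
theorem differentiableOn_integral_cexp_laurent {Ω : Type*} [MeasurableSpace Ω] {μ : Measure Ω}
    {D q : Ω → ℝ} {c₁ c₂ c₃ : Ω → ℂ} {U : Set ℂ} {C M κ : ℝ}
    (hD : Measurable D) (h₁ : Measurable c₁) (h₂ : Measurable c₂)
    (h₃ : Measurable c₃) (hU : IsOpen U) (hU' : ∀ s ∈ U, 1 / 2 ≤ ‖s‖)
    (hq0 : ∀ ω, 0 ≤ q ω) (hc₁ : ∀ ω, ‖c₁ ω‖ ≤ C * q ω) (hc₂ : ∀ ω, ‖c₂ ω‖ ≤ C * q ω)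
    (hDM : ∀ ω, |D ω| ≤ M) (hκ : 0 < κ)
    (hre : ∀ s ∈ U, ∀ ω, (s * c₁ ω + s⁻¹ * c₂ ω + c₃ ω).re ≤ -κ * q ω)
    (hInt : ∀ k : ℝ, 0 < k → Integrable (fun ω => Real.exp (-k * q ω)) μ) :
    DifferentiableOn ℂ
      (fun s : ℂ => ∫ ω, (D ω : ℂ) * Complex.exp (s * c₁ ω + s⁻¹ * c₂ ω + c₃ ω) ∂μ) U := by
  intro s₀ hs₀
  have hmeas : ∀ s : ℂ, Measurable
      (fun ω => (D ω : ℂ) * Complex.exp (s * c₁ ω + s⁻¹ * c₂ ω + c₃ ω)) := by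
    intro s; fun_prop
  have hexp : ∀ s ∈ U, ∀ ω,
      ‖Complex.exp (s * c₁ ω + s⁻¹ * c₂ ω + c₃ ω)‖ ≤ Real.exp (-κ * q ω) := by
    intro s hs ω
    rw [Complex.norm_exp]
    exact Real.exp_le_exp.2 (hre s hs ω)
  have hM : ∀ ω, 0 ≤ M := fun ω => (abs_nonneg _).trans (hDM ω)
  have hderiv : ∀ ω, ∀ s ∈ U, HasDerivAt
      (fun s : ℂ => (D ω : ℂ) * Complex.exp (s * c₁ ω + s⁻¹ * c₂ ω + c₃ ω))
      ((D ω : ℂ) * (Complex.exp (s * c₁ ω + s⁻¹ * c₂ ω + c₃ ω) *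
        (c₁ ω + -(s ^ 2)⁻¹ * c₂ ω))) s := by
    intro ω s hs
    have hs0 : s ≠ 0 := by
      rintro rfl
      have := hU' 0 hs
      norm_num at this
    have h := ((((hasDerivAt_id s).mul_const (c₁ ω)).add
      ((hasDerivAt_inv hs0).mul_const (c₂ ω))).add_const (c₃ ω)).cexp.const_mul (D ω : ℂ)
    simpa using h
  have key := hasDerivAt_integral_of_dominated_loc_of_deriv_le (μ := μ) (𝕜 := ℂ)
    (F := fun s ω => (D ω : ℂ) * Complex.exp (s * c₁ ω + s⁻¹ * c₂ ω + c₃ ω))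
    (F' := fun s ω => (D ω : ℂ) * (Complex.exp (s * c₁ ω + s⁻¹ * c₂ ω + c₃ ω) *
        (c₁ ω + -(s ^ 2)⁻¹ * c₂ ω)))
    (bound := fun ω => M * (10 * |C| / κ) * Real.exp (-(κ / 2) * q ω))
    (x₀ := s₀) (s := U) (hU.mem_nhds hs₀)
    (Filter.Eventually.of_forall fun s => (hmeas s).aestronglyMeasurable)
    (((hInt κ hκ).const_mul M).mono' (hmeas s₀).aestronglyMeasurable
      (Filter.Eventually.of_forall fun ω => by
        rw [norm_mul, Complex.norm_real]
        exact mul_le_mul (hDM ω) (hexp s₀ hs₀ ω) (norm_nonneg _) (hM ω)))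
    (Measurable.aestronglyMeasurable (by fun_prop))
    (Filter.Eventually.of_forall fun ω s hs => ?_)
    ((hInt (κ / 2) (by positivity)).const_mul _)
    (Filter.Eventually.of_forall fun ω s hs => hderiv ω s hs)
  · exact key.2.differentiableAt.differentiableWithinAt
  · rw [norm_mul, Complex.norm_real, norm_mul]
    have hs2 : ‖-(s ^ 2)⁻¹‖ ≤ 4 := by
      rw [norm_neg, norm_inv, norm_pow]
      have := hU' s hs
      rw [inv_le_comm₀ (by positivity) (by norm_num)]
      nlinarith
    have hc : ‖c₁ ω + -(s ^ 2)⁻¹ * c₂ ω‖ ≤ 5 * |C| * q ω := by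
      refine (norm_add_le _ _).trans ?_
      rw [norm_mul]
      have h1 := hc₁ ω
      have h2 := hc₂ ω
      have h3 : C * q ω ≤ |C| * q ω := mul_le_mul_of_nonneg_right (le_abs_self C) (hq0 ω)
      have h4 : ‖-(s ^ 2)⁻¹‖ * ‖c₂ ω‖ ≤ 4 * ‖c₂ ω‖ :=
        mul_le_mul_of_nonneg_right hs2 (norm_nonneg _)
      linarith
    have hqe : q ω * Real.exp (-κ * q ω) ≤ 2 / κ * Real.exp (-(κ / 2) * q ω) := by
      have h1 : κ / 2 * q ω ≤ Real.exp (κ / 2 * q ω) := by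
        linarith [Real.add_one_le_exp (κ / 2 * q ω)]
      have h2 : Real.exp (-(κ / 2) * q ω) = Real.exp (κ / 2 * q ω) * Real.exp (-κ * q ω) := by
        rw [← Real.exp_add]; congr 1; ring
      rw [h2, ← mul_assoc]
      refine mul_le_mul_of_nonneg_right ?_ (Real.exp_nonneg _)
      rw [div_mul_eq_mul_div, le_div_iff₀ hκ]
      linarith
    calc ‖D ω‖ * (‖Complex.exp (s * c₁ ω + s⁻¹ * c₂ ω + c₃ ω)‖ *
          ‖c₁ ω + -(s ^ 2)⁻¹ * c₂ ω‖)
        ≤ M * (Real.exp (-κ * q ω) * (5 * |C| * q ω)) := by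
          refine mul_le_mul (hDM ω) ?_ (by positivity) (hM ω)
          exact mul_le_mul (hexp s hs ω) hc (norm_nonneg _) (Real.exp_nonneg _)
      _ = M * (5 * |C| * (q ω * Real.exp (-κ * q ω))) := by ring
      _ ≤ M * (5 * |C| * (2 / κ * Real.exp (-(κ / 2) * q ω))) := by
          have := hM ω
          gcongr
      _ = _ := by ring

section StrongMono

variable {E : Type*} [NormedAddCommGroup E] [InnerProductSpace ℝ E] [FiniteDimensional ℝ E]
  [MeasurableSpace E] [BorelSpace E]

/-- `b` is a continuously differentiable strongly monotone vector field with bounded derivative. -/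
structure IsStrongMono (b : E → E) (B : E → E →L[ℝ] E) (m M : ℝ) : Prop where
  hasFDerivAt : ∀ x, HasFDerivAt b (B x) x
  continuous_deriv : Continuous B
  norm_deriv_le : ∀ x, ‖B x‖ ≤ M
  pos : 0 < m
  le_inner : ∀ x y, m * ‖x - y‖ ^ 2 ≤ inner ℝ (b x - b y) (x - y)

namespace IsStrongMono

variable {b : E → E} {B : E → E →L[ℝ] E} {m M : ℝ}

theorem continuous (h : IsStrongMono b B m M) : Continuous b :=
  continuous_iff_continuousAt.2 fun x => (h.hasFDerivAt x).continuousAt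

theorem nonneg (h : IsStrongMono b B m M) : 0 ≤ M := (norm_nonneg _).trans (h.norm_deriv_le 0)

theorem norm_sub_le (h : IsStrongMono b B m M) (x y : E) : ‖b x - b y‖ ≤ M * ‖x - y‖ :=
  convex_univ.norm_image_sub_le_of_norm_hasFDerivWithin_le
    (fun z _ => (h.hasFDerivAt z).hasFDerivWithinAt) (fun z _ => h.norm_deriv_le z)
    (mem_univ y) (mem_univ x)

theorem le_norm_sub (h : IsStrongMono b B m M) (x y : E) : m * ‖x - y‖ ≤ ‖b x - b y‖ := by
  have h1 := h.le_inner x y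
  have h2 := real_inner_le_norm (b x - b y) (x - y)
  by_cases h0 : ‖x - y‖ = 0
  · rw [h0]; simp
  · have : 0 < ‖x - y‖ := lt_of_le_of_ne (norm_nonneg _) (Ne.symm h0)
    nlinarith

theorem injective (h : IsStrongMono b B m M) : Function.Injective b := by
  intro x y hxy
  have := h.le_norm_sub x y
  rw [hxy, sub_self, norm_zero] at this
  have h2 : ‖x - y‖ ≤ 0 := by
    by_contra hc
    push Not at hc
    have := mul_pos h.pos hc
    linarith
  exact sub_eq_zero.1 (norm_le_zero_iff.1 h2)

theorem surjective (h : IsStrongMono b B m M) : Function.Surjective b := by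
  intro w
  set L := max M m with hL
  have hLm : m ≤ L := le_max_right _ _
  have hL0 : 0 < L := h.pos.trans_le hLm
  set t := m / L ^ 2 with ht
  have ht0 : 0 < t := div_pos h.pos (by positivity)
  set T : E → E := fun x => x - t • (b x - w) with hT
  set k : ℝ := Real.sqrt (1 - m ^ 2 / L ^ 2) with hk
  have hk0 : 0 ≤ 1 - m ^ 2 / L ^ 2 := by
    rw [sub_nonneg, div_le_one (by positivity)]
    have := h.pos
    gcongr
  have hk1 : k < 1 := by
    rw [hk, Real.sqrt_lt' one_pos]
    have : 0 < m ^ 2 / L ^ 2 := by have := h.pos; positivity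
    linarith
  have hTk : ∀ x y, ‖T x - T y‖ ≤ k * ‖x - y‖ := by
    intro x y
    have e1 : T x - T y = (x - y) - t • (b x - b y) := by
      simp only [hT, smul_sub]; abel
    have h1 := h.le_inner x y
    have h2 : ‖b x - b y‖ ≤ L * ‖x - y‖ := (h.norm_sub_le x y).trans (by
      gcongr; exact le_max_left _ _)
    have h3 : ‖T x - T y‖ ^ 2 ≤ (1 - m ^ 2 / L ^ 2) * ‖x - y‖ ^ 2 := by
      rw [e1, norm_sub_sq_real, norm_smul, real_inner_smul_right, real_inner_comm,
        Real.norm_of_nonneg ht0.le]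
      have h4 : ‖b x - b y‖ ^ 2 ≤ L ^ 2 * ‖x - y‖ ^ 2 := by
        rw [← mul_pow]; gcongr
      have h5 : t ^ 2 * ‖b x - b y‖ ^ 2 ≤ t ^ 2 * (L ^ 2 * ‖x - y‖ ^ 2) := by gcongr
      have h6 : t * (m * ‖x - y‖ ^ 2) ≤ t * inner ℝ (b x - b y) (x - y) := by gcongr
      have e2 : t ^ 2 * L ^ 2 = m ^ 2 / L ^ 2 := by rw [ht]; field_simp
      have e3 : t * m = m ^ 2 / L ^ 2 := by rw [ht]; ring
      have e4 : t ^ 2 * (L ^ 2 * ‖x - y‖ ^ 2) = m ^ 2 / L ^ 2 * ‖x - y‖ ^ 2 := by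
        rw [← e2]; ring
      have e5 : t * (m * ‖x - y‖ ^ 2) = m ^ 2 / L ^ 2 * ‖x - y‖ ^ 2 := by
        rw [← e3]; ring
      rw [mul_pow]
      linarith
    refine abs_le_of_sq_le_sq' ?_ (by positivity) |>.2
    rw [mul_pow, hk, Real.sq_sqrt hk0]
    exact h3
  have hc : ContractingWith ⟨k, Real.sqrt_nonneg _⟩ T := by
    refine ⟨hk1, LipschitzWith.of_dist_le_mul fun x y => ?_⟩
    rw [dist_eq_norm, dist_eq_norm]
    exact hTk x y
  have hfix := hc.fixedPoint_isFixedPt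
  refine ⟨ContractingWith.fixedPoint T hc, ?_⟩
  have h1 : t • (b (ContractingWith.fixedPoint T hc) - w) = 0 := by
    have := hfix.eq
    simp only [hT] at this
    simpa using this
  exact sub_eq_zero.1 ((smul_eq_zero.1 h1).resolve_left ht0.ne')

theorem integral_abs_det_smul_comp (h : IsStrongMono b B m M) {F : Type*} [NormedAddCommGroup F]
    [NormedSpace ℝ F] (g : E → F) : ∫ x, |(B x).det| • g (b x) = ∫ y, g y := by
  have := integral_image_eq_integral_abs_det_fderiv_smul (μ := (volume : Measure E))
    MeasurableSet.univ (fun x _ => (h.hasFDerivAt x).hasFDerivWithinAt) h.injective.injOn g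
  rw [image_univ, h.surjective.range_eq] at this
  simpa using this.symm

theorem exists_abs_det_le (h : IsStrongMono b B m M) :
    ∃ C, 0 ≤ C ∧ ∀ x y, |(B x + B y).det| ≤ C := by
  have hc : IsCompact (Metric.closedBall (0 : E →L[ℝ] E) (2 * M)) := isCompact_closedBall _ _
  obtain ⟨C, hC⟩ := hc.exists_bound_of_continuousOn
    (ContinuousLinearMap.continuous_det (E := E) (𝕜 := ℝ)).continuousOn
  have hm : ∀ x y, B x + B y ∈ Metric.closedBall (0 : E →L[ℝ] E) (2 * M) := by
    intro x y
    rw [mem_closedBall_zero_iff]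
    have := norm_add_le (B x) (B y)
    linarith [h.norm_deriv_le x, h.norm_deriv_le y]
  exact ⟨C, (norm_nonneg _).trans (hC _ (hm 0 0)), fun x y => hC _ (hm x y)⟩

/-- The sum of a strongly monotone field and a rescaled reflected copy of it. -/
theorem reflect (h : IsStrongMono b B m M) {a : ℝ} (ha : 0 < a) (u : E) :
    IsStrongMono (fun x => a • b x - a⁻¹ • b (a • u - a ^ 2 • x))
      (fun x => a • (B x + B (a • u - a ^ 2 • x))) (a * m) (a * (M + M)) where
  hasFDerivAt x := by
    have h1 : HasFDerivAt (fun x : E => a • u - a ^ 2 • x)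
        (-(a ^ 2 • ContinuousLinearMap.id ℝ E)) x :=
      ((hasFDerivAt_id x).const_smul (a ^ 2)).const_sub _
    have h2 := ((h.hasFDerivAt x).const_smul a).sub
      (((h.hasFDerivAt (a • u - a ^ 2 • x)).comp x h1).const_smul a⁻¹)
    refine h2.congr_fderiv ?_
    ext v
    simp only [sub_apply, smul_apply, ContinuousLinearMap.comp_apply,
      neg_apply, add_apply, map_neg, map_smul,
      ContinuousLinearMap.id_apply, smul_neg, sub_neg_eq_add, smul_add, smul_smul]
    congr 2
    field_simp
  continuous_deriv := by
    have := h.continuous_deriv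
    fun_prop
  norm_deriv_le x := by
    rw [norm_smul, Real.norm_of_nonneg ha.le]
    gcongr
    exact (norm_add_le _ _).trans (add_le_add (h.norm_deriv_le _) (h.norm_deriv_le _))
  pos := mul_pos ha h.pos
  le_inner x y := by
    have h1 := h.le_inner x y
    have h2 := h.le_inner (a • u - a ^ 2 • x) (a • u - a ^ 2 • y)
    have e1 : (a • u - a ^ 2 • x) - (a • u - a ^ 2 • y) = -(a ^ 2 • (x - y)) := by
      rw [smul_sub]; abel
    have h3 : 0 ≤ inner ℝ (b (a • u - a ^ 2 • x) - b (a • u - a ^ 2 • y))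
        ((a • u - a ^ 2 • x) - (a • u - a ^ 2 • y)) :=
      le_trans (by have := h.pos; positivity) h2
    rw [e1, inner_neg_right, real_inner_smul_right] at h3
    have h4 : inner ℝ (b (a • u - a ^ 2 • x) - b (a • u - a ^ 2 • y)) (x - y) ≤ 0 := by
      by_contra hc
      push Not at hc
      have : 0 < a ^ 2 * inner ℝ (b (a • u - a ^ 2 • x) - b (a • u - a ^ 2 • y)) (x - y) := by
        positivity
      linarith
    have e2 : a • b x - a⁻¹ • b (a • u - a ^ 2 • x) - (a • b y - a⁻¹ • b (a • u - a ^ 2 • y))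
        = a • (b x - b y) - a⁻¹ • (b (a • u - a ^ 2 • x) - b (a • u - a ^ 2 • y)) := by
      simp only [smul_sub]; abel
    rw [e2, inner_sub_left, real_inner_smul_left, real_inner_smul_left]
    have h5 : a * (m * ‖x - y‖ ^ 2) ≤ a * inner ℝ (b x - b y) (x - y) := by gcongr
    have h6 : a⁻¹ * inner ℝ (b (a • u - a ^ 2 • x) - b (a • u - a ^ 2 • y)) (x - y) ≤ 0 :=
      mul_nonpos_of_nonneg_of_nonpos (by positivity) h4
    linarith

end IsStrongMono

end StrongMono

section GaussianChange

variable {E : Type*} [NormedAddCommGroup E] [InnerProductSpace ℝ E] [FiniteDimensional ℝ E]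
  [MeasurableSpace E] [BorelSpace E]

theorem integral_comp_smul_sub_const {F : Type*} [NormedAddCommGroup F] [NormedSpace ℝ F]
    (g : E → F) {a : ℝ} (ha : 0 < a) (c : E) :
    ∫ u, g (a • u - c) = (a ^ Module.finrank ℝ E)⁻¹ • ∫ y, g y := by
  rw [Measure.integral_comp_smul_of_nonneg volume (fun y => g (y - c)) a (hR := ha.le),
    integral_sub_right_eq_self]

/-- Substitution `x' = a u - a ^ 2 x` in a double integral. -/
theorem integral_prod_eq_integral_skew {F : Type*} [NormedAddCommGroup F] [NormedSpace ℝ F]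
    [CompleteSpace F] {g : E × E → F} (hgc : Continuous g) (hg : Integrable g) {a : ℝ}
    (ha : 0 < a) :
    ∫ p, g p = ∫ u, ∫ x, (a ^ Module.finrank ℝ E) • g (x, a • u - a ^ 2 • x) := by
  have hn : 0 < a ^ Module.finrank ℝ E := by positivity
  have hg' : Integrable g ((volume : Measure E).prod volume) := hg
  have hmeas : AEStronglyMeasurable (fun p : E × E => g (p.1, a • p.2 - a ^ 2 • p.1))
      ((volume : Measure E).prod volume) := Continuous.aestronglyMeasurable (by fun_prop)
  have hInt : Integrable (fun p : E × E => g (p.1, a • p.2 - a ^ 2 • p.1))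
      ((volume : Measure E).prod volume) := by
    rw [integrable_prod_iff hmeas]
    obtain ⟨h1, h2⟩ := (integrable_prod_iff hg'.aestronglyMeasurable).1 hg'
    constructor
    · filter_upwards [h1] with x hx
      exact (integrable_comp_smul_iff volume
        (fun y => g (x, y - a ^ 2 • x)) ha.ne').2 (hx.comp_sub_right (a ^ 2 • x))
    · simp only
      have : ∀ x : E, ∫ u, ‖g (x, a • u - a ^ 2 • x)‖
          = (a ^ Module.finrank ℝ E)⁻¹ • ∫ y, ‖g (x, y)‖ := fun x =>
        integral_comp_smul_sub_const (fun y => ‖g (x, y)‖) ha _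
      simp_rw [this]
      exact h2.const_mul _
  rw [show (∫ p, g p) = ∫ p, g p ∂((volume : Measure E).prod volume) from rfl,
    integral_prod _ hg', integral_integral_swap (f := fun u x => (a ^ Module.finrank ℝ E) •
      g (x, a • u - a ^ 2 • x)) ((hInt.smul (a ^ Module.finrank ℝ E)).swap)]
  refine integral_congr_ae (Filter.Eventually.of_forall fun x => ?_)
  simp only
  rw [integral_smul, integral_comp_smul_sub_const (fun y => g (x, y)) ha, smul_smul,
    mul_inv_cancel₀ hn.ne', one_smul]

theorem IsStrongMono.integral_det_mul_comp {b : E → E} {B : E → E →L[ℝ] E} {m M : ℝ}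
    (h : IsStrongMono b B m M) (hdet : ∀ x y, 0 ≤ (B x + B y).det) {a : ℝ} (ha : 0 < a)
    {f : E × E → ℂ} (hf : Continuous f)
    (hInt : Integrable fun p : E × E => ((B p.1 + B p.2).det : ℂ) *
      f (a • p.1 + a⁻¹ • p.2, a • b p.1 - a⁻¹ • b p.2)) :
    ∫ p : E × E, ((B p.1 + B p.2).det : ℂ) * f (a • p.1 + a⁻¹ • p.2, a • b p.1 - a⁻¹ • b p.2)
      = ∫ u, ∫ w, f (u, w) := by
  have hb := h.continuous
  have hB := h.continuous_deriv
  have hdc : Continuous fun p : E × E => (B p.1 + B p.2).det :=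
    ContinuousLinearMap.continuous_det.comp
      ((hB.comp continuous_fst).add (hB.comp continuous_snd))
  rw [integral_prod_eq_integral_skew (by fun_prop) hInt ha]
  refine integral_congr_ae (Filter.Eventually.of_forall fun u => ?_)
  simp only
  rw [← (h.reflect ha u).integral_abs_det_smul_comp (fun w => f (u, w))]
  refine integral_congr_ae (Filter.Eventually.of_forall fun x => ?_)
  simp only
  have e1 : a • x + a⁻¹ • (a • u - a ^ 2 • x) = u := by
    rw [smul_sub, smul_smul, smul_smul, inv_mul_cancel₀ ha.ne', one_smul,
      show a⁻¹ * a ^ 2 = a by field_simp]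
    abel
  have e2 : (a • (B x + B (a • u - a ^ 2 • x))).det
      = a ^ Module.finrank ℝ E * (B x + B (a • u - a ^ 2 • x)).det := by
    rw [ContinuousLinearMap.det, ContinuousLinearMap.toLinearMap_smul, LinearMap.det_smul]
  rw [e1, e2, abs_of_nonneg (mul_nonneg (by positivity) (hdet _ _)), mul_smul]
  simp

theorem integral_integral_gaussian_fourier {ε : ℝ} (hε : 0 < ε) :
    ∫ u : E, ∫ w : E, Complex.exp (Complex.I * (inner ℝ u w : ℝ)
        - (ε / 2 : ℝ) * ((‖u‖ ^ 2 + ‖w‖ ^ 2 : ℝ) : ℂ))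
      = (((2 * Real.pi) ^ 2 / (1 + ε ^ 2)) ^ (Module.finrank ℝ E / 2 : ℝ) : ℝ) := by
  have hb : 0 < ((ε / 2 : ℝ) : ℂ).re := by simpa using hε
  have hε' : (ε : ℂ) ≠ 0 := by exact_mod_cast hε.ne'
  have h1 : ∀ u : E, ∫ w : E, Complex.exp (Complex.I * (inner ℝ u w : ℝ)
        - (ε / 2 : ℝ) * ((‖u‖ ^ 2 + ‖w‖ ^ 2 : ℝ) : ℂ))
      = ((Real.pi / (ε / 2)) ^ (Module.finrank ℝ E / 2 : ℝ) *
          Real.exp (-((1 + ε ^ 2) / (2 * ε)) * ‖u‖ ^ 2) : ℝ) := by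
    intro u
    have h2 : ∀ w : E, Complex.exp (Complex.I * (inner ℝ u w : ℝ)
        - (ε / 2 : ℝ) * ((‖u‖ ^ 2 + ‖w‖ ^ 2 : ℝ) : ℂ))
        = Complex.exp (-(ε / 2 : ℝ) * (‖u‖ : ℂ) ^ 2) *
          Complex.exp (-(ε / 2 : ℝ) * (‖w‖ : ℂ) ^ 2 + Complex.I * (inner ℝ u w : ℝ)) := by
      intro w
      rw [← Complex.exp_add]
      congr 1
      push_cast
      ring
    simp_rw [h2]
    rw [integral_const_mul, GaussianFourier.integral_cexp_neg_mul_sq_norm_add hb]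
    rw [Complex.ofReal_mul, Complex.ofReal_cpow (by positivity), mul_left_comm,
      ← Complex.exp_add, Complex.ofReal_exp]
    congr 2
    · push_cast; rfl
    · push_cast; rfl
    · push_cast
      rw [Complex.I_sq]
      field_simp
      ring
  simp_rw [h1]
  rw [integral_complex_ofReal, integral_const_mul,
    GaussianFourier.integral_rexp_neg_mul_sq_norm (by positivity),
    ← Real.mul_rpow (by positivity) (by positivity)]
  congr 2
  field_simp

end GaussianChange

section HolomorphicBound

variable {E : Type*} [NormedAddCommGroup E] [InnerProductSpace ℝ E] [FiniteDimensional ℝ E]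
  [MeasurableSpace E] [BorelSpace E]

theorem integrable_exp_neg_mul_sq_norm {k : ℝ} (hk : 0 < k) :
    Integrable fun x : E => Real.exp (-k * ‖x‖ ^ 2) := by
  have h := (GaussianFourier.integrable_cexp_neg_mul_sq_norm_add (V := E) (b := (k : ℂ))
    (by simpa using hk) 0 0).norm
  refine h.congr (Filter.Eventually.of_forall fun x => ?_)
  simp only [Complex.norm_exp]
  congr 1
  simp [← Complex.ofReal_pow, ← Complex.ofReal_neg, ← Complex.ofReal_mul]

theorem integrable_exp_neg_mul_sq_norm_prod {k : ℝ} (hk : 0 < k) :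
    Integrable fun p : E × E => Real.exp (-k * (‖p.1‖ ^ 2 + ‖p.2‖ ^ 2)) := by
  have h := (integrable_exp_neg_mul_sq_norm (E := E) hk).mul_prod
    (integrable_exp_neg_mul_sq_norm (E := E) hk)
  refine h.congr (Filter.Eventually.of_forall fun p => ?_)
  simp only [← Real.exp_add]
  congr 1
  ring

theorem re_laurent_exponent (σ ρ e α α' β P P' γ : ℝ) :
    (((σ : ℂ) + ρ * Complex.I) * (Complex.I * α - e * P)
      + ((σ : ℂ) + ρ * Complex.I)⁻¹ * (-(Complex.I * α') - e * P')
      + (Complex.I * β - e * γ)).re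
    = -ρ * α - σ * (e * P) + (-ρ * α' - σ * (e * P')) / (σ ^ 2 + ρ ^ 2) - e * γ := by
  simp [Complex.normSq_apply]
  ring

theorem sq_add_sq_bounds {σ ρ : ℝ} (hσ : 0 ≤ σ) (hρ : 0 ≤ ρ) (h : σ + ρ = 1) :
    1 / 2 ≤ σ ^ 2 + ρ ^ 2 ∧ σ ^ 2 + ρ ^ 2 ≤ 1 := by
  constructor <;> nlinarith [sq_nonneg (σ - ρ), mul_nonneg hσ hρ]

theorem re_laurent_exponent_le {σ ρ e α α' β P P' γ q κ : ℝ} (hσ : 0 ≤ σ) (hρ : 0 ≤ ρ)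
    (h : σ + ρ = 1) (he : 0 ≤ e) (hP' : 0 ≤ P') (hα' : 0 ≤ α')
    (h1 : κ * q ≤ e * (P + P' + γ)) (h2 : κ * q ≤ α + α' + e * γ) :
    (((σ : ℂ) + ρ * Complex.I) * (Complex.I * α - e * P)
      + ((σ : ℂ) + ρ * Complex.I)⁻¹ * (-(Complex.I * α') - e * P')
      + (Complex.I * β - e * γ)).re ≤ -κ * q := by
  rw [re_laurent_exponent]
  obtain ⟨h3, h4⟩ := sq_add_sq_bounds hσ hρ h
  have h5 : (-ρ * α' - σ * (e * P')) / (σ ^ 2 + ρ ^ 2) ≤ -ρ * α' - σ * (e * P') := by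
    rw [div_le_iff₀ (by linarith)]
    have : 0 ≤ ρ * α' + σ * (e * P') := by positivity
    nlinarith
  have h6 : σ * (κ * q) ≤ σ * (e * (P + P' + γ)) := by gcongr
  have h7 : ρ * (κ * q) ≤ ρ * (α + α' + e * γ) := by gcongr
  have e1 : κ * q = σ * (κ * q) + ρ * (κ * q) := by rw [← add_mul, h, one_mul]
  have e2 : e * γ = σ * (e * γ) + ρ * (e * γ) := by rw [← add_mul, h, one_mul]
  linarith

theorem exists_segment_of_mem_thickening {η : ℝ} (hη : η ≤ 1 / 10) {s : ℂ}
    (hs : s ∈ Metric.thickening η (segment ℝ (1 : ℂ) Complex.I)) :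
    ∃ σ ρ : ℝ, 0 ≤ σ ∧ 0 ≤ ρ ∧ σ + ρ = 1 ∧ ‖s - (σ + ρ * Complex.I)‖ < η ∧
      1 / 2 ≤ ‖(σ : ℂ) + ρ * Complex.I‖ ∧ 1 / 2 ≤ ‖s‖ := by
  obtain ⟨z, ⟨σ, ρ, hσ, hρ, h, rfl⟩, hz⟩ := Metric.mem_thickening_iff.1 hs
  have e1 : σ • (1 : ℂ) + ρ • Complex.I = σ + ρ * Complex.I := by simp
  rw [e1, dist_eq_norm] at hz
  have h1 : (7 / 10 : ℝ) ≤ ‖(σ : ℂ) + ρ * Complex.I‖ := by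
    rw [Complex.norm_add_mul_I]
    refine Real.le_sqrt_of_sq_le ?_
    have := (sq_add_sq_bounds hσ hρ h).1
    linarith
  refine ⟨σ, ρ, hσ, hρ, h, hz, by linarith, ?_⟩
  have h2 := norm_sub_norm_le ((σ : ℂ) + ρ * Complex.I) s
  rw [norm_sub_rev] at h2
  linarith

theorem norm_laurent_sub_le {s z c₁ c₂ : ℂ} {C η : ℝ} (hs : 1 / 2 ≤ ‖s‖) (hz : 1 / 2 ≤ ‖z‖)
    (h : ‖s - z‖ < η) (h₁ : ‖c₁‖ ≤ C) (h₂ : ‖c₂‖ ≤ C) :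
    ‖(s * c₁ + s⁻¹ * c₂) - (z * c₁ + z⁻¹ * c₂)‖ ≤ 5 * η * C := by
  have hs0 : s ≠ 0 := by rintro rfl; norm_num at hs
  have hz0 : z ≠ 0 := by rintro rfl; norm_num at hz
  have hC : 0 ≤ C := (norm_nonneg _).trans h₁
  have hη : 0 ≤ η := (norm_nonneg _).trans h.le
  have e1 : (s * c₁ + s⁻¹ * c₂) - (z * c₁ + z⁻¹ * c₂) = (s - z) * c₁ + (s⁻¹ - z⁻¹) * c₂ := by
    ring
  have h3 : ‖s⁻¹ - z⁻¹‖ ≤ 4 * η := by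
    rw [inv_sub_inv hs0 hz0, norm_div, norm_mul, norm_sub_rev,
      div_le_iff₀ (by positivity)]
    have : 1 / 4 ≤ ‖s‖ * ‖z‖ := by nlinarith
    nlinarith
  rw [e1]
  calc _ ≤ ‖s - z‖ * ‖c₁‖ + ‖s⁻¹ - z⁻¹‖ * ‖c₂‖ := by
        refine (norm_add_le _ _).trans ?_
        rw [norm_mul, norm_mul]
    _ ≤ η * C + 4 * η * C := by gcongr
    _ = _ := by ring

end HolomorphicBound

section HolomorphicBound

variable {E : Type*} [NormedAddCommGroup E] [InnerProductSpace ℝ E] [FiniteDimensional ℝ E]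
  [MeasurableSpace E] [BorelSpace E]

/-- A determinant inequality for gradients of strongly convex functions, obtained by rotating a
Gaussian integral into the complex domain. -/
theorem IsStrongMono.four_pow_le_integral {b : E → E} {B : E → E →L[ℝ] E} {m M : ℝ}
    (h : IsStrongMono b B m M) (hb0 : b 0 = 0) (hdet : ∀ x y, 0 ≤ (B x + B y).det) :
    (4 : ℝ) ^ Module.finrank ℝ E ≤ ∫ p : E × E, (B p.1 + B p.2).det *
      Real.exp (-(1 / 2) * (inner ℝ p.1 (b p.1) + inner ℝ p.2 (b p.2))) := by
  have hm := h.pos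
  have hM := h.nonneg
  have hb := h.continuous
  have hB := h.continuous_deriv
  have hdc : Continuous fun p : E × E => (B p.1 + B p.2).det :=
    ContinuousLinearMap.continuous_det.comp
      ((hB.comp continuous_fst).add (hB.comp continuous_snd))
  obtain ⟨CD, hCD0, hCD⟩ := h.exists_abs_det_le
  obtain ⟨e, he0, he1, heM⟩ : ∃ e : ℝ, 0 < e ∧ e ≤ 1 / 2 ∧ e * (1 + M ^ 2) ≤ m / 2 := by
    refine ⟨min (1 / 2) (m / 2 / (1 + M ^ 2)), by positivity, min_le_left _ _, ?_⟩
    rw [← le_div_iff₀ (by positivity)]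
    exact min_le_right _ _
  set α : E → ℝ := fun x => inner ℝ x (b x) with hα
  set P : E → ℝ := fun x => ‖x‖ ^ 2 + ‖b x‖ ^ 2 with hP
  set β : E × E → ℝ := fun p => inner ℝ p.2 (b p.1) - inner ℝ p.1 (b p.2) with hβ
  set γ : E × E → ℝ := fun p => 2 * inner ℝ p.1 p.2 - 2 * inner ℝ (b p.1) (b p.2) with hγ
  set q : E × E → ℝ := fun p => ‖p.1‖ ^ 2 + ‖p.2‖ ^ 2 with hq
  have hq0 : ∀ p, 0 ≤ q p := fun p => by positivity
  have hnb : ∀ x, ‖b x‖ ≤ M * ‖x‖ := fun x => by simpa [hb0] using h.norm_sub_le x 0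
  have hαm : ∀ x, m * ‖x‖ ^ 2 ≤ α x := fun x => by
    have := h.le_inner x 0
    rw [hb0, sub_zero, sub_zero, real_inner_comm] at this
    exact this
  have hαM : ∀ x, α x ≤ M * ‖x‖ ^ 2 := fun x => by
    refine (real_inner_le_norm _ _).trans ?_
    have := mul_le_mul_of_nonneg_left (hnb x) (norm_nonneg x)
    linarith
  have hα0 : ∀ x, 0 ≤ α x := fun x => le_trans (by positivity) (hαm x)
  have hP0 : ∀ x, 0 ≤ P x := fun x => by positivity
  have hPM : ∀ x, P x ≤ (1 + M ^ 2) * ‖x‖ ^ 2 := fun x => by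
    have : ‖b x‖ ^ 2 ≤ (M * ‖x‖) ^ 2 := by gcongr; exact hnb x
    simp only [hP]
    linarith
  have heP : ∀ x, e * P x ≤ 1 / 2 * α x := fun x => by
    have h1 : e * P x ≤ e * ((1 + M ^ 2) * ‖x‖ ^ 2) := by gcongr; exact hPM x
    have h2 : e * (1 + M ^ 2) * ‖x‖ ^ 2 ≤ m / 2 * ‖x‖ ^ 2 := by gcongr
    linarith [hαm x]
  have hPPγ : ∀ p : E × E, P p.1 + P p.2 + γ p = ‖p.1 + p.2‖ ^ 2 + ‖b p.1 - b p.2‖ ^ 2 := by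
    intro p
    rw [norm_add_sq_real, norm_sub_sq_real]
    simp only [hP, hγ]
    ring
  have hγP : ∀ p, -(P p.1 + P p.2) ≤ γ p := fun p => by
    have := hPPγ p
    have : 0 ≤ ‖p.1 + p.2‖ ^ 2 + ‖b p.1 - b p.2‖ ^ 2 := by positivity
    linarith
  have hαγ : ∀ p : E × E, 1 / 2 * (α p.1 + α p.2) ≤ α p.1 + α p.2 + e * γ p := fun p => by
    have h1 : e * (-(P p.1 + P p.2)) ≤ e * γ p := by gcongr; exact hγP p
    linarith [heP p.1, heP p.2]
  obtain ⟨κ, hκ0, hκ1, hκ2⟩ : ∃ κ : ℝ, 0 < κ ∧ (∀ p, 2 * κ * q p ≤ e * (P p.1 + P p.2 + γ p)) ∧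
      ∀ p : E × E, 2 * κ * q p ≤ α p.1 + α p.2 + e * γ p := by
    refine ⟨min (e * min 1 (m ^ 2)) (m / 4), by positivity, fun p => ?_, fun p => ?_⟩
    · have h1 : min (e * min 1 (m ^ 2)) (m / 4) ≤ e * min 1 (m ^ 2) := min_le_left _ _
      have h2 : min 1 (m ^ 2) * ‖p.1 + p.2‖ ^ 2 ≤ 1 * ‖p.1 + p.2‖ ^ 2 := by
        gcongr; exact min_le_left _ _
      have h3 : min 1 (m ^ 2) * ‖p.1 - p.2‖ ^ 2 ≤ m ^ 2 * ‖p.1 - p.2‖ ^ 2 := by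
        gcongr; exact min_le_right _ _
      have h4 : (m * ‖p.1 - p.2‖) ^ 2 ≤ ‖b p.1 - b p.2‖ ^ 2 := by
        gcongr; exact h.le_norm_sub _ _
      have h5 : ‖p.1 + p.2‖ ^ 2 + ‖p.1 - p.2‖ ^ 2 = 2 * q p := by
        rw [norm_add_sq_real, norm_sub_sq_real]; simp only [hq]; ring
      rw [hPPγ]
      calc 2 * min (e * min 1 (m ^ 2)) (m / 4) * q p ≤ 2 * (e * min 1 (m ^ 2)) * q p := by
            have := hq0 p
            gcongr
        _ = e * (min 1 (m ^ 2) * (‖p.1 + p.2‖ ^ 2 + ‖p.1 - p.2‖ ^ 2)) := by rw [h5]; ring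
        _ ≤ _ := by
            gcongr
            rw [mul_pow] at h4
            linarith
    · have h1 : min (e * min 1 (m ^ 2)) (m / 4) * q p ≤ m / 4 * q p := by
        have := hq0 p
        gcongr
        exact min_le_right _ _
      refine le_trans ?_ (hαγ p)
      have h2 := hαm p.1
      have h3 := hαm p.2
      have h4 : m * q p = m * ‖p.1‖ ^ 2 + m * ‖p.2‖ ^ 2 := by simp only [hq]; ring
      linarith
  set c₁ : E × E → ℂ := fun p => Complex.I * α p.1 - e * P p.1 with hc₁
  set c₂ : E × E → ℂ := fun p => -(Complex.I * α p.2) - e * P p.2 with hc₂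
  set c₃ : E × E → ℂ := fun p => Complex.I * β p - e * γ p with hc₃
  set C : ℝ := 1 + M + M ^ 2 with hC
  have hC0 : 0 < C := by positivity
  have hxC : ∀ x, |α x| + |e * P x| ≤ C * ‖x‖ ^ 2 := fun x => by
    rw [abs_of_nonneg (hα0 x), abs_of_nonneg (mul_nonneg he0.le (hP0 x))]
    have h1 : e * P x ≤ 1 * ((1 + M ^ 2) * ‖x‖ ^ 2) :=
      mul_le_mul (by linarith) (hPM x) (hP0 x) zero_le_one
    have := hαM x
    simp only [hC]
    linarith
  have hc₁C : ∀ p, ‖c₁ p‖ ≤ C * q p := fun p => by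
    refine (_root_.norm_sub_le _ _).trans ?_
    rw [norm_mul, Complex.norm_I, one_mul, ← Complex.ofReal_mul, Complex.norm_real,
      Complex.norm_real, Real.norm_eq_abs, Real.norm_eq_abs]
    refine (hxC p.1).trans ?_
    gcongr
    simp only [hq]
    linarith [sq_nonneg ‖p.2‖]
  have hc₂C : ∀ p, ‖c₂ p‖ ≤ C * q p := fun p => by
    refine (_root_.norm_sub_le _ _).trans ?_
    rw [norm_neg, norm_mul, Complex.norm_I, one_mul, ← Complex.ofReal_mul, Complex.norm_real,
      Complex.norm_real, Real.norm_eq_abs, Real.norm_eq_abs]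
    refine (hxC p.2).trans ?_
    gcongr
    simp only [hq]
    linarith [sq_nonneg ‖p.1‖]
  obtain ⟨η, hη0, hη1, hηκ⟩ : ∃ η : ℝ, 0 < η ∧ η ≤ 1 / 10 ∧ 5 * η * C ≤ κ := by
    refine ⟨min (1 / 10) (κ / (5 * C)), by positivity, min_le_left _ _, ?_⟩
    have : min (1 / 10) (κ / (5 * C)) ≤ κ / (5 * C) := min_le_right _ _
    rw [le_div_iff₀ (by positivity)] at this
    linarith
  set U : Set ℂ := Metric.thickening η (segment ℝ (1 : ℂ) Complex.I) with hU
  have hUo : IsOpen U := Metric.isOpen_thickening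
  have hUc : IsPreconnected U := ((convex_segment _ _).thickening η).isPreconnected
  have hsegU : segment ℝ (1 : ℂ) Complex.I ⊆ U := Metric.self_subset_thickening hη0 _
  have h1U : (1 : ℂ) ∈ U := hsegU (left_mem_segment ℝ _ _)
  have hIU : Complex.I ∈ U := hsegU (right_mem_segment ℝ _ _)
  have hre : ∀ s ∈ U, ∀ p, (s * c₁ p + s⁻¹ * c₂ p + c₃ p).re ≤ -κ * q p := by
    intro s hs p
    obtain ⟨σ, ρ, hσ, hρ, h1, hn, hz, hs'⟩ := exists_segment_of_mem_thickening hη1 hs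
    have h2 := re_laurent_exponent_le (β := β p) hσ hρ h1 he0.le (hP0 p.2) (hα0 p.2)
      (hκ1 p) (hκ2 p)
    have h3 := norm_laurent_sub_le hs' hz hn (hc₁C p) (hc₂C p)
    have h4 := (Complex.re_le_norm _).trans h3
    have h5 : 5 * η * (C * q p) ≤ κ * q p := by
      rw [← mul_assoc]; have := hq0 p; gcongr
    simp only [Complex.add_re, Complex.sub_re, hc₁, hc₂, hc₃] at h2 h4 ⊢
    linarith
  have hInt : ∀ k : ℝ, 0 < k → Integrable (fun p : E × E => Real.exp (-k * q p)) :=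
    fun k hk => integrable_exp_neg_mul_sq_norm_prod hk
  have hcα : Continuous α := by fun_prop
  have hcP : Continuous P := by fun_prop
  have hcβ : Continuous β := by fun_prop
  have hcγ : Continuous γ := by fun_prop
  have hcc₁ : Continuous c₁ := by fun_prop
  have hcc₂ : Continuous c₂ := by fun_prop
  have hcc₃ : Continuous c₃ := by fun_prop
  set J : ℂ → ℂ := fun s => ∫ p : E × E, (((B p.1 + B p.2).det : ℝ) : ℂ) *
    Complex.exp (s * c₁ p + s⁻¹ * c₂ p + c₃ p) with hJ
  have hUhalf : ∀ s ∈ U, 1 / 2 ≤ ‖s‖ := fun s hs => by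
    obtain ⟨_, _, _, _, _, _, _, hs'⟩ := exists_segment_of_mem_thickening hη1 hs
    exact hs'
  have hJd : DifferentiableOn ℂ J U :=
    differentiableOn_integral_cexp_laurent hdc.measurable hcc₁.measurable hcc₂.measurable
      hcc₃.measurable hUo hUhalf hq0 hc₁C hc₂C (fun p => hCD p.1 p.2) hκ0 hre hInt
  have hJint : ∀ s ∈ U, Integrable (fun p : E × E => (((B p.1 + B p.2).det : ℝ) : ℂ) *
      Complex.exp (s * c₁ p + s⁻¹ * c₂ p + c₃ p)) := by
    intro s hs
    refine ((hInt κ hκ0).const_mul CD).mono' (Continuous.aestronglyMeasurable (by fun_prop))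
      (Filter.Eventually.of_forall fun p => ?_)
    rw [norm_mul, Complex.norm_real, Complex.norm_exp]
    exact mul_le_mul (hCD p.1 p.2) (Real.exp_le_exp.2 (hre s hs p)) (Real.exp_nonneg _) hCD0
  set V : ℝ := ((2 * Real.pi) ^ 2 / (1 + (2 * e) ^ 2)) ^ (Module.finrank ℝ E / 2 : ℝ) with hV
  have hreal : ∀ t : ℝ, 0 < t → (t : ℂ) ∈ U → J t = V := by
    intro t ht htU
    obtain ⟨a, ha, rfl⟩ : ∃ a : ℝ, 0 < a ∧ t = a ^ 2 :=
      ⟨Real.sqrt t, Real.sqrt_pos.2 ht, (Real.sq_sqrt ht.le).symm⟩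
    set f : E × E → ℂ := fun z => Complex.exp (Complex.I * (inner ℝ z.1 z.2 : ℝ)
        - (2 * e / 2 : ℝ) * ((‖z.1‖ ^ 2 + ‖z.2‖ ^ 2 : ℝ) : ℂ)) with hf
    have hfc : Continuous f := by fun_prop
    have key : ∀ p : E × E, Complex.exp (((a ^ 2 : ℝ) : ℂ) * c₁ p + ((a ^ 2 : ℝ) : ℂ)⁻¹ * c₂ p
        + c₃ p) = f (a • p.1 + a⁻¹ • p.2, a • b p.1 - a⁻¹ • b p.2) := by
      intro p
      simp only [hf]
      have e1 : inner ℝ (a • p.1 + a⁻¹ • p.2) (a • b p.1 - a⁻¹ • b p.2)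
          = a ^ 2 * α p.1 - (a ^ 2)⁻¹ * α p.2 + β p := by
        simp only [inner_add_left, inner_sub_right, real_inner_smul_left, real_inner_smul_right,
          hα, hβ]
        field_simp
        ring
      have e2 : ‖a • p.1 + a⁻¹ • p.2‖ ^ 2 + ‖a • b p.1 - a⁻¹ • b p.2‖ ^ 2
          = a ^ 2 * P p.1 + (a ^ 2)⁻¹ * P p.2 + γ p := by
        rw [norm_add_sq_real, norm_sub_sq_real]
        simp only [norm_smul, real_inner_smul_left, real_inner_smul_right, hP, hγ, norm_inv,
          Real.norm_of_nonneg ha.le]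
        field_simp
        ring
      rw [e1, e2]
      congr 1
      simp only [hc₁, hc₂, hc₃]
      push_cast
      ring
    have hJi := hJint _ htU
    simp only [hJ]
    simp_rw [key] at hJi ⊢
    rw [h.integral_det_mul_comp hdet ha hfc hJi]
    exact integral_integral_gaussian_fourier (E := E) (ε := 2 * e) (by positivity)
  have hJI : J Complex.I = V := by
    have hev : ∀ᶠ t : ℝ in nhdsWithin 1 (Ioi 1), J (t : ℂ) = V := by
      have h1 : ∀ᶠ t : ℝ in nhds (1 : ℝ), (t : ℂ) ∈ U :=
        Complex.continuous_ofReal.continuousAt.eventually_mem (hUo.mem_nhds (by simpa using h1U))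
      filter_upwards [h1.filter_mono nhdsWithin_le_nhds, self_mem_nhdsWithin] with t ht ht1
      exact hreal t (zero_lt_one.trans ht1) ht
    have htend : Filter.Tendsto (fun t : ℝ => (t : ℂ)) (nhdsWithin 1 (Ioi 1))
        (nhdsWithin 1 {1}ᶜ) := by
      refine tendsto_nhdsWithin_iff.2 ⟨?_, ?_⟩
      · have := (Complex.continuous_ofReal.tendsto (1 : ℝ)).mono_left
          (nhdsWithin_le_nhds (s := Ioi 1))
        simpa using this
      · filter_upwards [self_mem_nhdsWithin] with t ht
        simp only [mem_compl_iff, mem_singleton_iff]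
        exact_mod_cast (ne_of_gt ht)
    exact (hJd.analyticOnNhd hUo).eqOn_of_preconnected_of_frequently_eq
      (analyticOnNhd_const (v := (V : ℂ))) hUc h1U (htend.frequently hev.frequently) hIU
  have hVle : (4 : ℝ) ^ Module.finrank ℝ E ≤ V := by
    have h1 : (16 : ℝ) ≤ (2 * Real.pi) ^ 2 / (1 + (2 * e) ^ 2) := by
      rw [le_div_iff₀ (by positivity)]
      nlinarith [Real.pi_gt_three]
    calc (4 : ℝ) ^ Module.finrank ℝ E = (16 : ℝ) ^ (Module.finrank ℝ E / 2 : ℝ) := by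
          rw [show (16 : ℝ) = 4 ^ (2 : ℝ) by norm_num, ← Real.rpow_mul (by norm_num),
            mul_div_cancel₀ _ (two_ne_zero), Real.rpow_natCast]
      _ ≤ V := Real.rpow_le_rpow (by norm_num) h1 (by positivity)
  refine hVle.trans ?_
  have hVn : V = ‖J Complex.I‖ := by
    rw [hJI, Complex.norm_real, Real.norm_of_nonneg]
    positivity
  rw [hVn]
  refine norm_integral_le_of_norm_le ?_ (Filter.Eventually.of_forall fun p => ?_)
  · refine ((hInt (m / 2) (by positivity)).const_mul CD).mono'
      (Continuous.aestronglyMeasurable (by fun_prop)) (Filter.Eventually.of_forall fun p => ?_)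
    rw [norm_mul, Real.norm_of_nonneg (Real.exp_nonneg _)]
    refine mul_le_mul (hCD p.1 p.2) (Real.exp_le_exp.2 ?_) (Real.exp_nonneg _) hCD0
    have := hαm p.1
    have := hαm p.2
    simp only [hq, hα] at *
    linarith
  · rw [norm_mul, Complex.norm_real, Complex.norm_exp, Real.norm_of_nonneg (hdet _ _)]
    refine mul_le_mul_of_nonneg_left (Real.exp_le_exp.2 ?_) (hdet _ _)
    have h1 := re_laurent_exponent 0 1 e (α p.1) (α p.2) (β p) (P p.1) (P p.2) (γ p)
    simp only [Complex.ofReal_zero, Complex.ofReal_one, zero_add, one_mul] at h1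
    simp only [hc₁, hc₂, hc₃]
    rw [h1]
    have := hαγ p
    simp only [hα] at this ⊢
    linarith

end HolomorphicBound

section SelfDifference

variable {E : Type*} [NormedAddCommGroup E] [InnerProductSpace ℝ E] [FiniteDimensional ℝ E]
  [MeasurableSpace E] [BorelSpace E]

/-- A weak form of the Rogers–Shephard inequality. -/
theorem IsCentredBody.volume_sub_self_le {K : Set E} (hK : IsCentredBody K) :
    volume (K - K) ≤ 4 ^ Module.finrank ℝ E * volume K := by
  set n := Module.finrank ℝ E with hn
  have hKm := hK.measurableSet
  have hv0 := hK.volume_ne_zero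
  have hvt := hK.volume_ne_top
  have hS : MeasurableSet ((1 / 2 : ℝ) • (K - K)) := by
    rw [sub_eq_add_neg]
    exact ((hK.isCompact.add hK.isCompact.neg).smul _).measurableSet
  have h1 : ∫⁻ z : E, ∫⁻ x : E, K.indicator 1 x * K.indicator 1 (x - z) = volume K * volume K := by
    rw [lintegral_lintegral_swap]
    · have : ∀ x : E, ∫⁻ z : E, K.indicator (1 : E → ℝ≥0∞) x * K.indicator 1 (x - z)
          = K.indicator 1 x * volume K := by
        intro x
        rw [lintegral_const_mul]
        · rw [lintegral_sub_left_eq_self (fun y => K.indicator (1 : E → ℝ≥0∞) y) x,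
            lintegral_indicator_one hKm]
        · exact (measurable_one.indicator hKm).comp (by fun_prop)
      simp_rw [this]
      rw [lintegral_mul_const _ (measurable_one.indicator hKm), lintegral_indicator_one hKm]
    · refine Measurable.aemeasurable ?_
      exact ((measurable_one.indicator hKm).comp measurable_snd).mul
        ((measurable_one.indicator hKm).comp (measurable_snd.sub measurable_fst))
  have h2 : ∀ z ∈ (1 / 2 : ℝ) • (K - K), ENNReal.ofReal ((1 / 2) ^ n) * volume K
      ≤ ∫⁻ x : E, K.indicator 1 x * K.indicator 1 (x - z) := by
    rintro z ⟨y, ⟨p, hp, p', hp', rfl⟩, rfl⟩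
    have h3 := Measure.addHaar_image_homothety (volume : Measure E) p (1 / 2) K
    rw [abs_of_nonneg (by positivity)] at h3
    rw [← h3, ← lintegral_indicator_one
      ((hK.isCompact.image (AffineMap.homothety_continuous p _)).measurableSet)]
    refine lintegral_mono fun x => ?_
    refine indicator_le (g := fun x => K.indicator 1 x * K.indicator 1
      (x - (1 / 2 : ℝ) • (p - p'))) ?_ x
    rintro x ⟨k, hk, rfl⟩
    have e1 : AffineMap.homothety p (1 / 2 : ℝ) k = (1 / 2 : ℝ) • k + (1 / 2 : ℝ) • p := by
      simp only [AffineMap.homothety_apply, vsub_eq_sub, vadd_eq_add]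
      module
    have m1 : AffineMap.homothety p (1 / 2 : ℝ) k ∈ K := by
      rw [e1]
      exact hK.convex hk hp (by norm_num) (by norm_num) (by norm_num)
    have m2 : AffineMap.homothety p (1 / 2 : ℝ) k - (1 / 2 : ℝ) • (p - p') ∈ K := by
      rw [e1]
      have := hK.convex hk hp' (by norm_num : (0 : ℝ) ≤ 1 / 2) (by norm_num : (0 : ℝ) ≤ 1 / 2)
        (by norm_num)
      convert! this using 1
      module
    rw [indicator_of_mem m1, indicator_of_mem m2]
    simp
  have h3 : ENNReal.ofReal ((1 / 2) ^ n) * volume K * volume ((1 / 2 : ℝ) • (K - K))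
      ≤ volume K * volume K := by
    rw [← h1, ← setLIntegral_const]
    refine (setLIntegral_mono' hS h2).trans (setLIntegral_le_lintegral _ _)
  rw [Measure.addHaar_smul, abs_of_nonneg (by positivity), ← hn] at h3
  have h4 : (ENNReal.ofReal ((1 / 2) ^ n) * ENNReal.ofReal ((1 / 2) ^ n) * volume (K - K))
      * volume K ≤ volume K * volume K := by
    refine le_trans (le_of_eq ?_) h3
    ring
  rw [ENNReal.mul_le_mul_iff_left hv0 hvt, ← ENNReal.ofReal_mul (by positivity), ← mul_pow,
    ENNReal.ofReal_pow (by norm_num)] at h4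
  calc volume (K - K) = 4 ^ n * (ENNReal.ofReal (1 / 2 * (1 / 2)) ^ n * volume (K - K)) := by
        rw [← mul_assoc, ← mul_pow, ← ENNReal.ofReal_ofNat 4, ← ENNReal.ofReal_mul (by norm_num)]
        norm_num
    _ ≤ _ := by gcongr

end SelfDifference

section Partition

variable {E : Type*} [NormedAddCommGroup E] [InnerProductSpace ℝ E] [FiniteDimensional ℝ E]
  [MeasurableSpace E] [BorelSpace E] {K : Set E}

/-- The partition function of the logarithmic Laplace transform at inverse temperature `β`. -/
noncomputable def lapPartition (K : Set E) (β : ℝ) : ℝ := ∫ y, Real.exp (-β * logLap K y)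

namespace IsCentredBody

theorem integrable_exp_logLap_smul (hK : IsCentredBody K) {β : ℝ} (hβ : 0 < β) {G : Type*}
    [NormedAddCommGroup G] [NormedSpace ℝ G] {g : E → G} (hg : Continuous g) {C : ℝ}
    (hC : ∀ y, ‖g y‖ ≤ C * (1 + ‖y‖)) :
    Integrable fun y => Real.exp (-β * logLap K y) • g y := by
  obtain ⟨ρ, c, hρ, hc⟩ := hK.exists_le_logLap
  have hlc := hK.continuous_logLap
  have hC0 : 0 ≤ C := by
    have := (norm_nonneg _).trans (hC 0)
    simpa using this
  refine ((integrable_exp_neg_mul_norm (E := E) (c := β * ρ / 2) (by positivity)).const_mul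
    (Real.exp (β * c) * (C * (1 + 2 / (β * ρ))))).mono'
    (Continuous.aestronglyMeasurable (by fun_prop)) (Filter.Eventually.of_forall fun y => ?_)
  have h1 : Real.exp (-β * logLap K y) ≤ Real.exp (β * c) * (Real.exp (-(β * ρ / 2) * ‖y‖) *
      Real.exp (-(β * ρ / 2) * ‖y‖)) := by
    rw [← Real.exp_add, ← Real.exp_add]
    refine Real.exp_le_exp.2 ?_
    have := mul_le_mul_of_nonneg_left (hc y) hβ.le
    linarith
  have h2 : (1 + ‖y‖) * Real.exp (-(β * ρ / 2) * ‖y‖) ≤ 1 + 2 / (β * ρ) := by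
    rw [neg_mul, Real.exp_neg, ← div_eq_mul_inv, div_le_iff₀ (Real.exp_pos _)]
    have h3 := Real.add_one_le_exp (β * ρ / 2 * ‖y‖)
    have h4 : (1 : ℝ) ≤ Real.exp (β * ρ / 2 * ‖y‖) := Real.one_le_exp (by positivity)
    have h5 : ‖y‖ = 2 / (β * ρ) * (β * ρ / 2 * ‖y‖) := by field_simp
    have h6 : 2 / (β * ρ) * (β * ρ / 2 * ‖y‖) ≤ 2 / (β * ρ) * Real.exp (β * ρ / 2 * ‖y‖) := by
      gcongr
      linarith
    linarith
  rw [norm_smul, Real.norm_of_nonneg (Real.exp_nonneg _)]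
  calc Real.exp (-β * logLap K y) * ‖g y‖
      ≤ (Real.exp (β * c) * (Real.exp (-(β * ρ / 2) * ‖y‖) *
      Real.exp (-(β * ρ / 2) * ‖y‖))) * (C * (1 + ‖y‖)) := by
        gcongr
        exact hC y
    _ = Real.exp (β * c) * C * ((1 + ‖y‖) * Real.exp (-(β * ρ / 2) * ‖y‖)) *
        Real.exp (-(β * ρ / 2) * ‖y‖) := by ring
    _ ≤ Real.exp (β * c) * C * (1 + 2 / (β * ρ)) * Real.exp (-(β * ρ / 2) * ‖y‖) := by
        gcongr
    _ = _ := by ring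

theorem integrable_exp_logLap (hK : IsCentredBody K) {β : ℝ} (hβ : 0 < β) :
    Integrable fun y => Real.exp (-β * logLap K y) := by
  have := hK.integrable_exp_logLap_smul hβ (g := fun _ => (1 : ℝ)) continuous_const (C := 1)
    (fun y => by simp)
  simpa using this

theorem lapPartition_pos (hK : IsCentredBody K) {β : ℝ} (hβ : 0 < β) : 0 < lapPartition K β :=
  integral_exp_pos (hK.integrable_exp_logLap hβ)

theorem lintegral_det_tiltCov_le (hK : IsCentredBody K) :
    ∫⁻ y, ENNReal.ofReal (tiltCov K y).det ≤ volume K := by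
  have h := lintegral_abs_det_fderiv_eq_addHaar_image (volume : Measure E) MeasurableSet.univ
    (fun x _ => (hK.hasFDerivAt_tiltMean x).hasFDerivWithinAt) hK.injective_tiltMean.injOn
  simp_rw [fun y => abs_of_pos (hK.det_tiltCov_pos y), Measure.restrict_univ] at h
  rw [h]
  refine measure_mono ?_
  rintro _ ⟨y, -, rfl⟩
  exact hK.tiltMean_mem y

theorem det_tiltCov_add_pos (hK : IsCentredBody K) (x y : E) :
    0 < (tiltCov K x + tiltCov K y).det := by
  refine det_pos_of_inner_pos (fun u v => ?_) (fun u hu => ?_)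
  · simp only [add_apply, inner_add_left, inner_add_right, hK.inner_tiltCov_comm]
  · rw [add_apply, inner_add_right]
    exact add_pos (hK.inner_tiltCov_pos x hu) (hK.inner_tiltCov_pos y hu)

theorem lintegral_det_tiltCov_add_le (hK : IsCentredBody K) (u : E) :
    ∫⁻ x, ENNReal.ofReal (tiltCov K x + tiltCov K (u - x)).det ≤ volume (K - K) := by
  have hd : ∀ x, HasFDerivAt (fun x => tiltMean K x - tiltMean K (u - x))
      (tiltCov K x + tiltCov K (u - x)) x := by
    intro x
    have h1 : HasFDerivAt (fun x : E => u - x) (-ContinuousLinearMap.id ℝ E) x :=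
      (hasFDerivAt_id x).const_sub _
    have h2 := (hK.hasFDerivAt_tiltMean x).sub ((hK.hasFDerivAt_tiltMean (u - x)).comp x h1)
    refine h2.congr_fderiv ?_
    ext v
    simp
  have hinj : Function.Injective (fun x => tiltMean K x - tiltMean K (u - x)) := by
    intro x y hxy
    by_contra hne
    have h1 := hK.inner_tiltMean_sub_pos hne
    have h2 := hK.inner_tiltMean_sub_nonneg (u - y) (u - x)
    have e1 : (u - y) - (u - x) = x - y := by abel
    rw [e1] at h2
    have e2 : tiltMean K x - tiltMean K y = -(tiltMean K (u - y) - tiltMean K (u - x)) := by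
      have h3 : tiltMean K x - tiltMean K (u - x) = tiltMean K y - tiltMean K (u - y) := hxy
      rw [sub_eq_iff_eq_add.1 h3]
      abel
    rw [e2, inner_neg_right] at h1
    linarith
  have h := lintegral_abs_det_fderiv_eq_addHaar_image (volume : Measure E) MeasurableSet.univ
    (fun x _ => (hd x).hasFDerivWithinAt) hinj.injOn
  simp_rw [fun y => abs_of_pos (hK.det_tiltCov_add_pos y (u - y)), Measure.restrict_univ] at h
  rw [h]
  refine measure_mono ?_
  rintro _ ⟨y, -, rfl⟩
  exact sub_mem_sub (hK.tiltMean_mem y) (hK.tiltMean_mem _)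

end IsCentredBody

end Partition

section Partition

variable {E : Type*} [NormedAddCommGroup E] [InnerProductSpace ℝ E] [FiniteDimensional ℝ E]
  [MeasurableSpace E] [BorelSpace E] {K : Set E}

namespace IsCentredBody

theorem integrable_exp_logLap_prod (hK : IsCentredBody K) :
    Integrable fun p : E × E => Real.exp (-(1 / 2) * (logLap K p.1 + logLap K p.2)) := by
  have h := (hK.integrable_exp_logLap (β := 1 / 2) (by norm_num)).mul_prod
    (hK.integrable_exp_logLap (β := 1 / 2) (by norm_num))
  refine h.congr (Filter.Eventually.of_forall fun p => ?_)
  simp only [← Real.exp_add]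
  congr 1
  ring

theorem isStrongMono_add_smul (hK : IsCentredBody K) {C : ℝ} (hC : ∀ y, ‖tiltCov K y‖ ≤ C)
    {t : ℝ} (ht : 0 < t) :
    IsStrongMono (fun x => tiltMean K x + t • x)
      (fun x => tiltCov K x + t • ContinuousLinearMap.id ℝ E) t (C + t) where
  hasFDerivAt x := (hK.hasFDerivAt_tiltMean x).add ((hasFDerivAt_id x).const_smul t)
  continuous_deriv := hK.continuous_tiltCov.add continuous_const
  norm_deriv_le x := by
    refine (norm_add_le _ _).trans (add_le_add (hC x) ?_)
    rw [norm_smul, Real.norm_of_nonneg ht.le]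
    exact mul_le_of_le_one_right ht.le ContinuousLinearMap.norm_id_le
  pos := ht
  le_inner x y := by
    have h1 := hK.inner_tiltMean_sub_nonneg x y
    have e1 : tiltMean K x + t • x - (tiltMean K y + t • y)
        = (tiltMean K x - tiltMean K y) + t • (x - y) := by module
    rw [e1, inner_add_left, real_inner_smul_left, real_inner_self_eq_norm_sq, real_inner_comm]
    linarith

theorem det_tiltCov_add_smul_nonneg (hK : IsCentredBody K) {t : ℝ} (ht : 0 ≤ t) (x y : E) :
    0 ≤ ((tiltCov K x + t • ContinuousLinearMap.id ℝ E) +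
      (tiltCov K y + t • ContinuousLinearMap.id ℝ E)).det := by
  refine (det_pos_of_inner_pos (fun u v => ?_) (fun u hu => ?_)).le
  · simp only [add_apply, inner_add_left, inner_add_right, hK.inner_tiltCov_comm, smul_apply,
      ContinuousLinearMap.id_apply, real_inner_smul_left, real_inner_smul_right]
  · simp only [add_apply, inner_add_right, smul_apply,
      ContinuousLinearMap.id_apply, real_inner_smul_right, real_inner_self_eq_norm_sq]
    have h1 := hK.inner_tiltCov_pos x hu
    have h2 := hK.inner_tiltCov_pos y hu
    positivity

theorem exists_abs_det_tiltCov_add_le (hK : IsCentredBody K) :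
    ∃ D : ℝ, 0 ≤ D ∧ ∀ t : ℝ, 0 < t → t ≤ 1 → ∀ x y,
      |((tiltCov K x + t • ContinuousLinearMap.id ℝ E) +
        (tiltCov K y + t • ContinuousLinearMap.id ℝ E)).det| ≤ D := by
  obtain ⟨C, hC⟩ := hK.exists_norm_tiltCov_le
  have hc : IsCompact (Metric.closedBall (0 : E →L[ℝ] E) ((C + 1) + (C + 1))) :=
    isCompact_closedBall _ _
  obtain ⟨D, hD⟩ := hc.exists_bound_of_continuousOn
    (ContinuousLinearMap.continuous_det (E := E) (𝕜 := ℝ)).continuousOn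
  have hm : ∀ t : ℝ, 0 < t → t ≤ 1 → ∀ x y, ((tiltCov K x + t • ContinuousLinearMap.id ℝ E) +
        (tiltCov K y + t • ContinuousLinearMap.id ℝ E)) ∈
        Metric.closedBall (0 : E →L[ℝ] E) ((C + 1) + (C + 1)) := by
    intro t ht ht1 x y
    rw [mem_closedBall_zero_iff]
    have h1 := (hK.isStrongMono_add_smul hC ht).norm_deriv_le x
    have h2 := (hK.isStrongMono_add_smul hC ht).norm_deriv_le y
    refine (norm_add_le _ _).trans ?_
    linarith
  exact ⟨D, (norm_nonneg _).trans (hD _ (hm 1 one_pos le_rfl 0 0)),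
    fun t ht ht1 x y => hD _ (hm t ht ht1 x y)⟩

theorem four_pow_le_integral (hK : IsCentredBody K) :
    (4 : ℝ) ^ Module.finrank ℝ E ≤ ∫ p : E × E, (tiltCov K p.1 + tiltCov K p.2).det *
      Real.exp (-(1 / 2) * (inner ℝ p.1 (tiltMean K p.1) + inner ℝ p.2 (tiltMean K p.2))) := by
  obtain ⟨C, hC⟩ := hK.exists_norm_tiltCov_le
  obtain ⟨D, hD0, hD⟩ := hK.exists_abs_det_tiltCov_add_le
  have hca := hK.continuous_tiltMean
  have hcA := hK.continuous_tiltCov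
  set F : ℝ → E × E → ℝ := fun t p => ((tiltCov K p.1 + t • ContinuousLinearMap.id ℝ E) +
      (tiltCov K p.2 + t • ContinuousLinearMap.id ℝ E)).det *
    Real.exp (-(1 / 2) * (inner ℝ p.1 (tiltMean K p.1 + t • p.1) +
      inner ℝ p.2 (tiltMean K p.2 + t • p.2))) with hF
  have hcF : Continuous (Function.uncurry F) := by
    have h1 : Continuous fun z : ℝ × E × E => ((tiltCov K z.2.1 + z.1 • ContinuousLinearMap.id ℝ E)
        + (tiltCov K z.2.2 + z.1 • ContinuousLinearMap.id ℝ E)).det :=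
      ContinuousLinearMap.continuous_det.comp (by fun_prop)
    refine h1.mul ?_
    fun_prop
  have hnear : ∀ᶠ t : ℝ in nhdsWithin 0 (Ioi 0), 0 < t ∧ t ≤ 1 := by
    have h1 : ∀ᶠ t : ℝ in nhds 0, t ≤ 1 :=
      (eventually_lt_nhds zero_lt_one).mono fun t ht => le_of_lt ht
    filter_upwards [h1.filter_mono nhdsWithin_le_nhds, self_mem_nhdsWithin] with t ht ht0
    exact ⟨ht0, ht⟩
  have hlim : Filter.Tendsto (fun t => ∫ p, F t p) (nhdsWithin 0 (Ioi 0))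
      (nhds (∫ p, F 0 p)) := by
    refine tendsto_integral_filter_of_dominated_convergence
      (fun p => D * Real.exp (-(1 / 2) * (logLap K p.1 + logLap K p.2)))
      (Filter.Eventually.of_forall fun t =>
        (hcF.comp (Continuous.prodMk_right t)).aestronglyMeasurable) ?_
      (hK.integrable_exp_logLap_prod.const_mul D) (Filter.Eventually.of_forall fun p => ?_)
    · filter_upwards [hnear] with t ⟨ht, ht1⟩
      refine Filter.Eventually.of_forall fun p => ?_
      rw [hF, norm_mul, Real.norm_of_nonneg (Real.exp_nonneg _)]
      refine mul_le_mul (hD t ht ht1 _ _) (Real.exp_le_exp.2 ?_) (Real.exp_nonneg _) hD0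
      have h1 := hK.logLap_le_inner p.1
      have h2 := hK.logLap_le_inner p.2
      simp only [inner_add_right, real_inner_smul_right, real_inner_self_eq_norm_sq]
      have h3 : 0 ≤ t * ‖p.1‖ ^ 2 := by positivity
      have h4 : 0 ≤ t * ‖p.2‖ ^ 2 := by positivity
      linarith
    · exact ((hcF.comp (Continuous.prodMk_left p)).tendsto 0).mono_left nhdsWithin_le_nhds
  have h0 : ∀ p, F 0 p = (tiltCov K p.1 + tiltCov K p.2).det *
      Real.exp (-(1 / 2) * (inner ℝ p.1 (tiltMean K p.1) + inner ℝ p.2 (tiltMean K p.2))) := by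
    intro p
    simp [hF]
  simp_rw [h0] at hlim
  refine ge_of_tendsto hlim ?_
  filter_upwards [hnear] with t ⟨ht, ht1⟩
  exact (hK.isStrongMono_add_smul hC ht).four_pow_le_integral (by simp [hK.tiltMean_zero])
    (hK.det_tiltCov_add_smul_nonneg ht.le)

/-- The volume product of `K` and its Laplace transform is at least `2⁻ⁿ`. -/
theorem one_le_two_pow_mul_lapPartition (hK : IsCentredBody K) :
    1 ≤ 2 ^ Module.finrank ℝ E * (volume.real K * lapPartition K 1) := by
  set n := Module.finrank ℝ E with hn
  have hca := hK.continuous_tiltMean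
  have hcA := hK.continuous_tiltCov
  have hcl := hK.continuous_logLap
  have hdc : Continuous fun p : E × E => (tiltCov K p.1 + tiltCov K p.2).det :=
    ContinuousLinearMap.continuous_det.comp
      ((hcA.comp continuous_fst).add (hcA.comp continuous_snd))
  have hpos : ∀ x y, 0 ≤ (tiltCov K x + tiltCov K y).det :=
    fun x y => (hK.det_tiltCov_add_pos x y).le
  have hInt0 : Integrable fun p : E × E => (tiltCov K p.1 + tiltCov K p.2).det *
      Real.exp (-(1 / 2) * (logLap K p.1 + logLap K p.2)) := by
    obtain ⟨C, hC⟩ := hK.exists_norm_tiltCov_le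
    have hc : IsCompact (Metric.closedBall (0 : E →L[ℝ] E) (C + C)) := isCompact_closedBall _ _
    obtain ⟨D, hD⟩ := hc.exists_bound_of_continuousOn
      (ContinuousLinearMap.continuous_det (E := E) (𝕜 := ℝ)).continuousOn
    refine (hK.integrable_exp_logLap_prod.const_mul D).mono'
      (Continuous.aestronglyMeasurable (by fun_prop)) (Filter.Eventually.of_forall fun p => ?_)
    rw [norm_mul, Real.norm_of_nonneg (Real.exp_nonneg _)]
    refine mul_le_mul_of_nonneg_right (hD _ ?_) (Real.exp_nonneg _)
    rw [mem_closedBall_zero_iff]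
    exact (norm_add_le _ _).trans (add_le_add (hC _) (hC _))
  have h1 : ENNReal.ofReal (4 ^ n) ≤ ∫⁻ p : E × E,
      ENNReal.ofReal (tiltCov K p.1 + tiltCov K p.2).det *
        ENNReal.ofReal (Real.exp (-1 * logLap K ((1 / 2 : ℝ) • (p.1 + p.2)))) := by
    refine (ENNReal.ofReal_le_ofReal hK.four_pow_le_integral).trans ?_
    refine (ENNReal.ofReal_le_ofReal (integral_mono_of_nonneg (g := fun p : E × E =>
      (tiltCov K p.1 + tiltCov K p.2).det *
        Real.exp (-(1 / 2) * (logLap K p.1 + logLap K p.2)))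
      (Filter.Eventually.of_forall fun p => mul_nonneg (hpos _ _) (Real.exp_nonneg _)) ?_
      (Filter.Eventually.of_forall fun p => ?_))).trans ?_
    · exact hInt0
    · refine mul_le_mul_of_nonneg_left (Real.exp_le_exp.2 ?_) (hpos _ _)
      linarith [hK.logLap_le_inner p.1, hK.logLap_le_inner p.2]
    · rw [ofReal_integral_eq_lintegral_ofReal hInt0 (Filter.Eventually.of_forall fun p =>
        mul_nonneg (hpos _ _) (Real.exp_nonneg _))]
      refine lintegral_mono fun p => ?_
      rw [← ENNReal.ofReal_mul (hpos _ _)]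
      refine ENNReal.ofReal_le_ofReal
        (mul_le_mul_of_nonneg_left (Real.exp_le_exp.2 ?_) (hpos _ _))
      linarith [hK.two_mul_logLap_midpoint_le p.1 p.2]
  have h2 : (∫⁻ p : E × E, ENNReal.ofReal (tiltCov K p.1 + tiltCov K p.2).det *
        ENNReal.ofReal (Real.exp (-1 * logLap K ((1 / 2 : ℝ) • (p.1 + p.2)))))
      = ∫⁻ u : E, ∫⁻ x : E, ENNReal.ofReal (tiltCov K x + tiltCov K (u - x)).det *
        ENNReal.ofReal (Real.exp (-1 * logLap K ((1 / 2 : ℝ) • u))) := by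
    rw [lintegral_lintegral_swap]
    · rw [show (volume : Measure (E × E)) = (volume : Measure E).prod volume from rfl,
        lintegral_prod]
      · refine lintegral_congr fun x => ?_
        simp only
        rw [← lintegral_sub_right_eq_self _ x]
        simp only [add_sub_cancel]
      · exact (hdc.measurable.ennreal_ofReal.mul
          (Continuous.measurable (by fun_prop)).ennreal_ofReal).aemeasurable
    · have : Continuous fun z : E × E => (tiltCov K z.2 + tiltCov K (z.1 - z.2)).det :=
        ContinuousLinearMap.continuous_det.comp (by fun_prop)
      exact (this.measurable.ennreal_ofReal.mul
        (Continuous.measurable (by fun_prop)).ennreal_ofReal).aemeasurable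
  have h3 : ∀ u : E, (∫⁻ x : E, ENNReal.ofReal (tiltCov K x + tiltCov K (u - x)).det *
        ENNReal.ofReal (Real.exp (-1 * logLap K ((1 / 2 : ℝ) • u))))
      ≤ volume (K - K) * ENNReal.ofReal (Real.exp (-1 * logLap K ((1 / 2 : ℝ) • u))) := by
    intro u
    rw [lintegral_mul_const' _ _ ENNReal.ofReal_ne_top]
    gcongr
    exact hK.lintegral_det_tiltCov_add_le u
  have hInt := hK.integrable_exp_logLap one_pos
  have h4 : (∫⁻ u : E, ENNReal.ofReal (Real.exp (-1 * logLap K ((1 / 2 : ℝ) • u))))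
      = ENNReal.ofReal (2 ^ n * lapPartition K 1) := by
    rw [← ofReal_integral_eq_lintegral_ofReal
      ((integrable_comp_smul_iff volume _ (by norm_num)).2 hInt)
      (Filter.Eventually.of_forall fun u => Real.exp_nonneg _),
      Measure.integral_comp_smul_of_nonneg volume (fun y => Real.exp (-1 * logLap K y))
        (1 / 2) (hR := by norm_num)]
    congr 1
    simp [lapPartition, hn]
  have hvt := hK.volume_ne_top
  have h5 : ENNReal.ofReal (4 ^ n) ≤ ENNReal.ofReal (4 ^ n *
      (2 ^ n * (volume.real K * lapPartition K 1))) := by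
    calc ENNReal.ofReal (4 ^ n) ≤ volume (K - K) * ENNReal.ofReal (2 ^ n * lapPartition K 1) := by
          refine h1.trans (h2.le.trans ((lintegral_mono h3).trans ?_))
          rw [lintegral_const_mul, h4]
          exact (Continuous.measurable (by fun_prop)).ennreal_ofReal
      _ ≤ (4 ^ n * volume K) * ENNReal.ofReal (2 ^ n * lapPartition K 1) := by
          gcongr
          exact hK.volume_sub_self_le
      _ = _ := by
          rw [← ENNReal.ofReal_toReal hvt, ← Measure.real,
            ← ENNReal.ofReal_ofNat 4, ← ENNReal.ofReal_pow (by norm_num),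
            ← ENNReal.ofReal_mul (by positivity), ← ENNReal.ofReal_mul (by positivity)]
          congr 1
          ring
  have hZ := hK.lapPartition_pos one_pos
  have hv := hK.volume_pos
  rw [ENNReal.ofReal_le_ofReal_iff (by positivity)] at h5
  exact le_of_mul_le_mul_left (by linarith) (by positivity : (0 : ℝ) < 4 ^ n)

end IsCentredBody

end Partition

section DyadicAverage

variable {E : Type*} [NormedAddCommGroup E] [InnerProductSpace ℝ E] [FiniteDimensional ℝ E]
  [MeasurableSpace E] [BorelSpace E] {K : Set E}

/-- The law of the average of `2 ^ j` independent samples of `μ`. -/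
noncomputable def dyadicAverage (μ : Measure E) : ℕ → Measure E
  | 0 => μ
  | j + 1 => ((dyadicAverage μ j).prod (dyadicAverage μ j)).map
      fun p => (1 / 2 : ℝ) • (p.1 + p.2)

theorem isProbabilityMeasure_dyadicAverage (μ : Measure E) [IsProbabilityMeasure μ] (j : ℕ) :
    IsProbabilityMeasure (dyadicAverage μ j) := by
  induction j with
  | zero => assumption
  | succ j ih => exact Measure.isProbabilityMeasure_map (Continuous.aemeasurable (by fun_prop))

theorem lintegral_comp_two_smul_sub (p : E) {ψ : E → ℝ≥0∞} (hψ : Measurable ψ) :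
    ∫⁻ x, ψ x = 2 ^ Module.finrank ℝ E * ∫⁻ w, ψ ((2 : ℝ) • w - p) := by
  have h1 : ∫⁻ w, ψ ((2 : ℝ) • w - p)
      = ENNReal.ofReal |((2 : ℝ) ^ Module.finrank ℝ E)⁻¹| * ∫⁻ x, ψ (x - p) := by
    have h2 := Measure.map_addHaar_smul (volume : Measure E) (r := (2 : ℝ)) two_ne_zero
    have h3 : Measurable fun x : E => ψ (x - p) := hψ.comp (by fun_prop)
    rw [← lintegral_map (f := fun x => ψ (x - p)) (g := fun w : E => (2 : ℝ) • w) h3 (by fun_prop)]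
    rw [show (fun w : E => (2 : ℝ) • w) = ((2 : ℝ) • ·) from rfl, h2, lintegral_smul_measure,
      smul_eq_mul]
  rw [h1, lintegral_sub_right_eq_self ψ p, ← mul_assoc, abs_of_pos (by positivity),
    ENNReal.ofReal_inv_of_pos (by positivity), ENNReal.ofReal_pow (by norm_num),
    ENNReal.ofReal_ofNat, ENNReal.mul_inv_cancel (by simp) (by simp), one_mul]

theorem volume_chords_eq (hK : IsCompact K) (w : E) :
    volume (chords K w) = ENNReal.ofReal (chordVol K w) :=
  (ENNReal.ofReal_toReal (volume_chords_ne_top hK w)).symm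

theorem indicator_mul_indicator_le (hKc : Convex ℝ K) (w u : E) :
    K.indicator (1 : E → ℝ≥0∞) (w + u) * K.indicator 1 (w - u)
      ≤ K.indicator 1 w * (chords K w).indicator 1 u := by
  by_cases h1 : w + u ∈ K
  · by_cases h2 : w - u ∈ K
    · have hw : w ∈ K := by
        have := hKc h1 h2 (by norm_num : (0 : ℝ) ≤ 1 / 2) (by norm_num : (0 : ℝ) ≤ 1 / 2)
          (by norm_num)
        convert! this using 1
        module
      have hu : u ∈ chords K w := ⟨h1, h2⟩
      simp [h1, h2, hw, hu]
    · simp [h2]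
  · simp [h1]

theorem lintegral_dyadicAverage_le (hK : IsCompact K) (hKc : Convex ℝ K) {μ : Measure E}
    [IsProbabilityMeasure μ] {ξ y : E} {N : ℝ} (hN : 0 < N)
    (hξ : ∀ w, chordVol K w ≤ chordVol K 0 * Real.exp (inner ℝ ξ w))
    (hμ : ∀ φ : E → ℝ≥0∞, Measurable φ → ∫⁻ w, φ w ∂μ
      ≤ ∫⁻ w, φ w * (ENNReal.ofReal (N⁻¹ * Real.exp (inner ℝ y w)) * K.indicator 1 w))
    (j : ℕ) (φ : E → ℝ≥0∞) (hφ : Measurable φ) :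
    ∫⁻ w, φ w ∂dyadicAverage μ j ≤ ∫⁻ w, φ w * (ENNReal.ofReal
      ((2 ^ Module.finrank ℝ E * chordVol K 0) ^ (2 ^ j - 1) * N⁻¹ ^ 2 ^ j *
        Real.exp (inner ℝ (((2 : ℝ) ^ j - 1) • ξ + (2 : ℝ) ^ j • y) w)) * K.indicator 1 w) := by
  have hF0 := chordVol_nonneg K 0
  induction j generalizing φ with
  | zero => simpa [dyadicAverage] using hμ φ hφ
  | succ j ih =>
    have := isProbabilityMeasure_dyadicAverage μ j
    set n := Module.finrank ℝ E with hn
    set c : ℝ := (2 ^ n * chordVol K 0) ^ (2 ^ j - 1) * N⁻¹ ^ 2 ^ j with hc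
    have hc0 : 0 ≤ c := by positivity
    set η : E := ((2 : ℝ) ^ j - 1) • ξ + (2 : ℝ) ^ j • y with hη
    set g : E → ℝ≥0∞ := fun w => ENNReal.ofReal (c * Real.exp (inner ℝ η w)) * K.indicator 1 w
      with hg
    have hgm : Measurable g :=
      (Continuous.measurable (by fun_prop)).ennreal_ofReal.mul
        (measurable_one.indicator hK.measurableSet)
    have hmid : Measurable fun p : E × E => (1 / 2 : ℝ) • (p.1 + p.2) := by fun_prop
    have hφm : Measurable fun p : E × E => φ ((1 / 2 : ℝ) • (p.1 + p.2)) := hφ.comp hmid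
    have hin : Measurable fun p : E => ∫⁻ p', φ ((1 / 2 : ℝ) • (p + p')) * g p' :=
      (hφm.mul (hgm.comp measurable_snd)).lintegral_prod_right'
    have hgg : ∀ w : E, 2 ^ n * ∫⁻ p, g p * g ((2 : ℝ) • w - p) ≤ ENNReal.ofReal
        ((2 ^ n * chordVol K 0) ^ (2 ^ (j + 1) - 1) * N⁻¹ ^ 2 ^ (j + 1) *
        Real.exp (inner ℝ (((2 : ℝ) ^ (j + 1) - 1) • ξ + (2 : ℝ) ^ (j + 1) • y) w)) *
          K.indicator 1 w := by
      intro w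
      rw [← lintegral_add_left_eq_self _ w]
      have h1 : ∀ u : E, g (w + u) * g ((2 : ℝ) • w - (w + u)) ≤
          ENNReal.ofReal (c ^ 2 * Real.exp (2 * inner ℝ η w)) * K.indicator 1 w *
            (chords K w).indicator 1 u := by
        intro u
        have e1 : (2 : ℝ) • w - (w + u) = w - u := by module
        rw [e1]
        calc g (w + u) * g (w - u) = ENNReal.ofReal (c * Real.exp (inner ℝ η (w + u))) *
              ENNReal.ofReal (c * Real.exp (inner ℝ η (w - u))) *
              (K.indicator 1 (w + u) * K.indicator 1 (w - u)) := by
              simp only [hg]; ring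
          _ = ENNReal.ofReal (c ^ 2 * Real.exp (2 * inner ℝ η w)) *
              (K.indicator 1 (w + u) * K.indicator 1 (w - u)) := by
              rw [← ENNReal.ofReal_mul (by positivity)]
              congr 2
              rw [show 2 * inner ℝ η w = inner ℝ η (w + u) + inner ℝ η (w - u) by
                rw [inner_add_right, inner_sub_right]; ring, Real.exp_add]
              ring
          _ ≤ _ := by
              rw [mul_assoc]
              exact mul_le_mul' le_rfl (indicator_mul_indicator_le hKc w u)
      refine (mul_le_mul_right (lintegral_mono h1) _).trans ?_
      have hcm : MeasurableSet (chords K w) := (isCompact_chords hK w).measurableSet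
      rw [lintegral_const_mul _ (measurable_one.indicator hcm), lintegral_indicator_one hcm,
        volume_chords_eq hK w]
      rw [← ENNReal.ofReal_ofNat 2, ← ENNReal.ofReal_pow (by norm_num), mul_right_comm,
        ← mul_assoc, ← mul_assoc, ← ENNReal.ofReal_mul (by positivity),
        ← ENNReal.ofReal_mul (by positivity)]
      refine mul_le_mul' (ENNReal.ofReal_le_ofReal ?_) le_rfl
      have e2 : 2 ^ (j + 1) - 1 = (2 ^ j - 1) * 2 + 1 := by
        have : 1 ≤ 2 ^ j := Nat.one_le_two_pow
        rw [pow_succ]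
        omega
      have e3 : inner ℝ (((2 : ℝ) ^ (j + 1) - 1) • ξ + (2 : ℝ) ^ (j + 1) • y) w
          = 2 * inner ℝ η w + inner ℝ ξ w := by
        simp only [hη, inner_add_left, real_inner_smul_left, pow_succ]
        ring
      rw [e2, e3, Real.exp_add, pow_succ _ ((2 ^ j - 1) * 2), pow_mul, pow_succ 2 j, pow_mul N⁻¹]
      calc 2 ^ n * (c ^ 2 * Real.exp (2 * inner ℝ η w)) * chordVol K w
          ≤ 2 ^ n * (c ^ 2 * Real.exp (2 * inner ℝ η w)) *
            (chordVol K 0 * Real.exp (inner ℝ ξ w)) := by gcongr; exact hξ w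
        _ = _ := by simp only [hc]; ring
    calc ∫⁻ w, φ w ∂dyadicAverage μ (j + 1)
        = ∫⁻ p, ∫⁻ p', φ ((1 / 2 : ℝ) • (p + p')) ∂dyadicAverage μ j ∂dyadicAverage μ j := by
          rw [dyadicAverage, lintegral_map hφ hmid, lintegral_prod _ hφm.aemeasurable]
      _ ≤ ∫⁻ p, ∫⁻ p', φ ((1 / 2 : ℝ) • (p + p')) * g p' ∂volume ∂dyadicAverage μ j :=
          lintegral_mono fun p => ih _ (hφ.comp (by fun_prop))
      _ ≤ ∫⁻ p, (∫⁻ p', φ ((1 / 2 : ℝ) • (p + p')) * g p') * g p := ih _ hin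
      _ = ∫⁻ p, ∫⁻ w, 2 ^ n * (φ w * (g p * g ((2 : ℝ) • w - p))) := by
          refine lintegral_congr fun p => ?_
          have h1 : Measurable fun p' : E => φ ((1 / 2 : ℝ) • (p + p')) * g p' :=
            (hφ.comp (by fun_prop)).mul hgm
          rw [lintegral_comp_two_smul_sub p h1, ← hn,
            lintegral_const_mul' _ _ (by simp), mul_assoc, ← lintegral_mul_const']
          · congr 1
            refine lintegral_congr fun w => ?_
            rw [show (1 / 2 : ℝ) • (p + ((2 : ℝ) • w - p)) = w by module]
            ring
          · simp only [hg]
            refine ENNReal.mul_ne_top ENNReal.ofReal_ne_top ?_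
            by_cases hp : p ∈ K <;> simp [hp]
      _ = ∫⁻ w, ∫⁻ p, 2 ^ n * (φ w * (g p * g ((2 : ℝ) • w - p))) := by
          refine lintegral_lintegral_swap (Measurable.aemeasurable ?_)
          have h1 : Measurable fun z : E × E => g ((2 : ℝ) • z.2 - z.1) :=
            hgm.comp (by fun_prop)
          exact ((hφ.comp measurable_snd).mul ((hgm.comp measurable_fst).mul h1)).const_mul _
      _ = ∫⁻ w, φ w * (2 ^ n * ∫⁻ p, g p * g ((2 : ℝ) • w - p)) := by
          refine lintegral_congr fun w => ?_
          have h1 : Measurable fun p : E => g p * g ((2 : ℝ) • w - p) :=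
            hgm.mul (hgm.comp (by fun_prop))
          rw [lintegral_const_mul _ (h1.const_mul _), lintegral_const_mul _ h1]
          ring
      _ ≤ _ := by
          refine lintegral_mono fun w => ?_
          exact mul_le_mul' le_rfl (hgg w)

end DyadicAverage

section GaussianComparison

variable {E : Type*} [NormedAddCommGroup E] [InnerProductSpace ℝ E] [FiniteDimensional ℝ E]
  [MeasurableSpace E] [BorelSpace E] {K : Set E}

theorem lintegral_prod_gaussianPDFReal {ι : Type*} [Fintype ι] (e : OrthonormalBasis ι ℝ E)
    (s : ι → NNReal) (hs : ∀ i, s i ≠ 0) (a : E) :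
    ∫⁻ w, ENNReal.ofReal
      (∏ i, ProbabilityTheory.gaussianPDFReal 0 (s i) (inner ℝ (e i) (w - a))) = 1 := by
  rw [lintegral_sub_right_eq_self (fun w : E => ENNReal.ofReal
      (∏ i, ProbabilityTheory.gaussianPDFReal 0 (s i) (inner ℝ (e i) w))) a]
  have hmp : MeasurePreserving (fun x : ι → ℝ => e.repr.symm (WithLp.toLp 2 x)) :=
    e.measurePreserving_repr_symm.comp (PiLp.volume_preserving_toLp ι)
  have hm : Measurable fun w : E => ENNReal.ofReal
      (∏ i, ProbabilityTheory.gaussianPDFReal 0 (s i) (inner ℝ (e i) w)) := by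
    refine Measurable.ennreal_ofReal (Finset.measurable_prod _ fun i _ => ?_)
    exact (ProbabilityTheory.measurable_gaussianPDFReal _ _).comp (by fun_prop)
  rw [← hmp.lintegral_comp hm]
  have h1 : ∀ x : ι → ℝ, ∀ i, inner ℝ (e i) (e.repr.symm (WithLp.toLp 2 x)) = x i := by
    intro x i
    rw [← e.repr_apply_apply]
    simp
  simp only [h1]
  rw [← ofReal_integral_eq_lintegral_ofReal]
  · rw [integral_fintype_prod_volume_eq_prod]
    simp [ProbabilityTheory.integral_gaussianPDFReal_eq_one, hs]
  · exact Integrable.fintype_prod fun i => ProbabilityTheory.integrable_gaussianPDFReal _ _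
  · exact ae_of_all _ fun x => Finset.prod_nonneg fun i _ =>
      ProbabilityTheory.gaussianPDFReal_nonneg _ _ _

theorem integral_dyadicAverage_succ (μ : Measure E) [IsProbabilityMeasure μ] (j : ℕ) {φ : E → ℝ}
    (hφ : Continuous φ) : ∫ w, φ w ∂dyadicAverage μ (j + 1)
      = ∫ p, φ ((1 / 2 : ℝ) • (p.1 + p.2)) ∂(dyadicAverage μ j).prod (dyadicAverage μ j) := by
  rw [dyadicAverage, integral_map (Continuous.aemeasurable (by fun_prop))
    hφ.aestronglyMeasurable]

namespace IsCentredBody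

theorem lintegral_tilt_le (hK : IsCentredBody K) (y : E) (φ : E → ℝ≥0∞) :
    ∫⁻ w, φ w ∂tilt K y ≤ ∫⁻ w, φ w *
      (ENNReal.ofReal ((lapMass K y)⁻¹ * Real.exp (inner ℝ y w)) * K.indicator 1 w) := by
  rw [tilt, lintegral_tilted, ← lintegral_indicator hK.measurableSet]
  refine lintegral_mono fun w => ?_
  by_cases hw : w ∈ K
  · simp only [hw, indicator_of_mem, Pi.one_apply, mul_one]
    rw [mul_comm, div_eq_inv_mul, lapMass]
  · simp [hw]

theorem ae_dyadicAverage_mem (hK : IsCentredBody K) (y : E) (j : ℕ) :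
    ∀ᵐ w ∂dyadicAverage (tilt K y) j, w ∈ K := by
  have := hK.isProbabilityMeasure_tilt y
  induction j with
  | zero => exact hK.ae_tilt_mem y
  | succ j ih =>
    have := isProbabilityMeasure_dyadicAverage (tilt K y) j
    refine (ae_map_iff (p := fun w => w ∈ K) (Continuous.aemeasurable (by fun_prop))
      hK.measurableSet).2 ?_
    have h1 := (Measure.quasiMeasurePreserving_fst (μ := dyadicAverage (tilt K y) j)
      (ν := dyadicAverage (tilt K y) j)).ae ih
    have h2 := (Measure.quasiMeasurePreserving_snd (μ := dyadicAverage (tilt K y) j)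
      (ν := dyadicAverage (tilt K y) j)).ae ih
    filter_upwards [h1, h2] with p hp1 hp2
    rw [smul_add]
    exact hK.convex hp1 hp2 (by norm_num) (by norm_num) (by norm_num)

theorem integrable_dyadicAverage (hK : IsCentredBody K) (y : E) (j : ℕ) {φ : E → ℝ}
    (hφ : Continuous φ) : Integrable φ (dyadicAverage (tilt K y) j) := by
  have := hK.isProbabilityMeasure_tilt y
  have := isProbabilityMeasure_dyadicAverage (tilt K y) j
  obtain ⟨C, hC⟩ := hK.isCompact.exists_bound_of_continuousOn hφ.continuousOn
  refine Integrable.of_bound hφ.aestronglyMeasurable C ?_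
  filter_upwards [hK.ae_dyadicAverage_mem y j] with w hw using hC w hw

theorem integral_inner_dyadicAverage (hK : IsCentredBody K) (y : E) (j : ℕ) (u : E) :
    ∫ w, inner ℝ u w ∂dyadicAverage (tilt K y) j = inner ℝ u (tiltMean K y) := by
  have := hK.isProbabilityMeasure_tilt y
  induction j with
  | zero => exact hK.integral_inner_tilt y u
  | succ j ih =>
    have := isProbabilityMeasure_dyadicAverage (tilt K y) j
    rw [integral_dyadicAverage_succ _ _ (by fun_prop)]
    have hi := hK.integrable_dyadicAverage y j (φ := fun w => inner ℝ u w) (by fun_prop)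
    simp only [real_inner_smul_right, inner_add_right]
    rw [integral_const_mul, integral_add (hi.comp_fst _) (hi.comp_snd _),
      integral_fun_fst (f := fun w => inner ℝ u w), integral_fun_snd (f := fun w => inner ℝ u w), ih]
    simp
    ring

theorem integral_sq_dyadicAverage (hK : IsCentredBody K) (y : E) (j : ℕ) (u : E) :
    ∫ w, inner ℝ u (w - tiltMean K y) ^ 2 ∂dyadicAverage (tilt K y) j
      = inner ℝ u (tiltCov K y u) / 2 ^ j := by
  have := hK.isProbabilityMeasure_tilt y
  induction j with
  | zero => simpa [dyadicAverage] using (hK.inner_tiltCov_self y u).symm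
  | succ j ih =>
    have := isProbabilityMeasure_dyadicAverage (tilt K y) j
    rw [integral_dyadicAverage_succ _ _ (by fun_prop)]
    set f : E → ℝ := fun w => inner ℝ u (w - tiltMean K y) with hf
    have hf0 : ∫ w, f w ∂dyadicAverage (tilt K y) j = 0 := by
      simp only [hf, inner_sub_right]
      rw [integral_sub (hK.integrable_dyadicAverage y j (by fun_prop)) (integrable_const _),
        hK.integral_inner_dyadicAverage y j u]
      simp
    have hi := hK.integrable_dyadicAverage y j (φ := f) (by fun_prop)
    have hi2 := hK.integrable_dyadicAverage y j (φ := fun w => f w ^ 2) (by fun_prop)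
    have h1 : ∀ p : E × E, inner ℝ u ((1 / 2 : ℝ) • (p.1 + p.2) - tiltMean K y) ^ 2
        = (1 / 4) * (f p.1 ^ 2 + f p.2 ^ 2) + (1 / 2) * (f p.1 * f p.2) := by
      intro p
      simp only [hf, inner_sub_right, real_inner_smul_right, inner_add_right]
      ring
    simp only [h1]
    have hs : Integrable (fun p : E × E => f p.1 ^ 2 + f p.2 ^ 2)
        ((dyadicAverage (tilt K y) j).prod (dyadicAverage (tilt K y) j)) :=
      (hi2.comp_fst _).add (hi2.comp_snd _)
    rw [integral_add (hs.const_mul _) ((hi.mul_prod hi).const_mul _), integral_const_mul, integral_const_mul,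
      integral_add (hi2.comp_fst _) (hi2.comp_snd _), integral_prod_mul, hf0,
      integral_fun_fst (f := fun w => f w ^ 2), integral_fun_snd (f := fun w => f w ^ 2), ih]
    simp
    ring

/-- Comparison of the dyadic averages of a tilt of `K` with the Gaussian of the same mean and
covariance. -/
theorem gaussian_comparison (hK : IsCentredBody K) {ξ : E}
    (hξ : ∀ w, chordVol K w ≤ chordVol K 0 * Real.exp (inner ℝ ξ w)) (y : E) (j : ℕ) :
    Module.finrank ℝ E / 2 * Real.log (2 ^ j / (2 * Real.pi)) - Module.finrank ℝ E / 2
        - Real.log (tiltCov K y).det / 2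
      ≤ (2 ^ j - 1) * Real.log (2 ^ Module.finrank ℝ E * chordVol K 0 / volume.real K)
        - Real.log (volume.real K) - 2 ^ j * logLap K y
        + inner ℝ (((2 : ℝ) ^ j - 1) • ξ + (2 : ℝ) ^ j • y) (tiltMean K y) := by
  have hprob := hK.isProbabilityMeasure_tilt y
  have hprobj := isProbabilityMeasure_dyadicAverage (tilt K y) j
  have hF0 : 0 < chordVol K 0 := chordVol_pos hK.isCompact hK.zero_mem_interior
  have hN := hK.lapMass_pos y
  have hv := hK.volume_pos
  set n := Module.finrank ℝ E with hn
  obtain ⟨e, l, hl, he, hdet⟩ := hK.exists_eigenbasis_tiltCov y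
  set a := tiltMean K y with ha
  set η : E := ((2 : ℝ) ^ j - 1) • ξ + (2 : ℝ) ^ j • y with hη
  set c : ℝ := (2 ^ n * chordVol K 0) ^ (2 ^ j - 1) * (lapMass K y)⁻¹ ^ 2 ^ j with hc
  have hc0 : 0 < c := by positivity
  have hk0 : (0 : ℝ) < 2 ^ j := by positivity
  have hlogc : Real.log c = (2 ^ j - 1) * Real.log (2 ^ n * chordVol K 0 / volume.real K)
      - Real.log (volume.real K) - 2 ^ j * logLap K y := by
    rw [hc, Real.log_mul (by positivity) (by positivity), Real.log_pow, Real.log_pow, Real.log_inv,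
      Real.log_div (by positivity) hv.ne', logLap, Real.log_div hN.ne' hv.ne',
      Nat.cast_sub Nat.one_le_two_pow]
    push_cast
    ring
  let s : Fin n → NNReal := fun i => ⟨l i / 2 ^ j, (div_pos (hl i) hk0).le⟩
  have hs : ∀ i, s i ≠ 0 := fun i => by
    rw [← NNReal.coe_ne_zero]
    exact (div_pos (hl i) hk0).ne'
  let q : Fin n → E → ℝ := fun i w => -(Real.log (2 * Real.pi * (l i / 2 ^ j)) / 2)
    - 2 ^ j / (2 * l i) * inner ℝ (e i) (w - a) ^ 2
  have hq : ∀ i w, Real.exp (q i w)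
      = ProbabilityTheory.gaussianPDFReal 0 (s i) (inner ℝ (e i) (w - a)) := by
    intro i w
    have hli := hl i
    have hpos : 0 < 2 * Real.pi * (l i / 2 ^ j) := by positivity
    rw [ProbabilityTheory.gaussianPDFReal]
    simp only [q]
    rw [sub_eq_add_neg, Real.exp_add, Real.exp_neg,
      Real.exp_half, Real.exp_log hpos]
    congr 2
    change _ = -(_ - 0) ^ 2 / (2 * (l i / 2 ^ j))
    field_simp
    ring
  let f : E → ℝ := fun w => ∑ i, q i w - Real.log c - inner ℝ η w
  have hfc : Continuous f := by fun_prop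
  have hfe : ∀ w, Real.exp (f w) * (c * Real.exp (inner ℝ η w))
      = ∏ i, ProbabilityTheory.gaussianPDFReal 0 (s i) (inner ℝ (e i) (w - a)) := by
    intro w
    simp_rw [← hq, ← Real.exp_sum]
    conv_lhs => rw [← Real.exp_log hc0, ← Real.exp_add, ← Real.exp_add]
    congr 1
    simp only [f]
    ring
  have h1 : ∫⁻ w, ENNReal.ofReal (Real.exp (f w)) ∂dyadicAverage (tilt K y) j ≤ 1 := by
    rw [← lintegral_prod_gaussianPDFReal e s hs a]
    refine (lintegral_dyadicAverage_le hK.isCompact hK.convex hN hξ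
      (fun φ _ => hK.lintegral_tilt_le y φ) j _
      (Continuous.measurable (by fun_prop)).ennreal_ofReal).trans (lintegral_mono fun w => ?_)
    rw [← hfe, ENNReal.ofReal_mul (Real.exp_nonneg _)]
    refine mul_le_mul' le_rfl ?_
    by_cases hw : w ∈ K <;> simp [hw, hc, hη, hn]
  have h2 : ∫ w, Real.exp (f w) ∂dyadicAverage (tilt K y) j ≤ 1 := by
    rw [integral_eq_lintegral_of_nonneg_ae (ae_of_all _ fun _ => Real.exp_nonneg _)
      (Continuous.aestronglyMeasurable (by fun_prop))]
    exact ENNReal.toReal_le_of_le_ofReal zero_le_one (by simpa using h1)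
  have hif := hK.integrable_dyadicAverage y j hfc
  have hie := hK.integrable_dyadicAverage y j (φ := fun w => Real.exp (f w)) (by fun_prop)
  have h3 : ∫ w, f w ∂dyadicAverage (tilt K y) j ≤ 0 := by
    have : ∫ w, f w ∂dyadicAverage (tilt K y) j
        ≤ ∫ w, (Real.exp (f w) - 1) ∂dyadicAverage (tilt K y) j :=
      integral_mono hif (hie.sub (integrable_const _)) fun w => by
        have := Real.add_one_le_exp (f w)
        simp only
        linarith
    rw [integral_sub hie (integrable_const _)] at this
    simp only [integral_const, probReal_univ, smul_eq_mul, mul_one] at this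
    linarith
  have hq_int : ∀ i, ∫ w, q i w ∂dyadicAverage (tilt K y) j
      = -(Real.log (2 * Real.pi * (l i / 2 ^ j)) / 2) - 1 / 2 := by
    intro i
    have hli := hl i
    rw [integral_sub (integrable_const _) (hK.integrable_dyadicAverage y j (by fun_prop)),
      integral_const_mul, hK.integral_sq_dyadicAverage, he i, real_inner_smul_right,
      real_inner_self_eq_norm_sq, e.orthonormal.1 i]
    simp only [integral_const, probReal_univ, smul_eq_mul, one_mul]
    congr 1
    field_simp
  have h4 : ∫ w, f w ∂dyadicAverage (tilt K y) j
      = ∑ i, (-(Real.log (2 * Real.pi * (l i / 2 ^ j)) / 2) - 1 / 2) - Real.log c - inner ℝ η a := by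
    have hi1 : Integrable (fun w => ∑ i, q i w) (dyadicAverage (tilt K y) j) :=
      hK.integrable_dyadicAverage y j (by fun_prop)
    have hi2 : Integrable (fun w => ∑ i, q i w - Real.log c) (dyadicAverage (tilt K y) j) :=
      hK.integrable_dyadicAverage y j (by fun_prop)
    have hi3 : Integrable (fun w => inner ℝ η w) (dyadicAverage (tilt K y) j) :=
      hK.integrable_dyadicAverage y j (by fun_prop)
    simp only [f]
    rw [integral_sub hi2 hi3, integral_sub hi1 (integrable_const _),
      integral_finsetSum _ fun i _ => hK.integrable_dyadicAverage y j (by fun_prop),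
      hK.integral_inner_dyadicAverage]
    simp only [hq_int, integral_const, probReal_univ, smul_eq_mul, one_mul, ha]
    rfl
  have h5 : ∑ i, (-(Real.log (2 * Real.pi * (l i / 2 ^ j)) / 2) - 1 / 2)
      = n / 2 * Real.log (2 ^ j / (2 * Real.pi)) - n / 2 - Real.log (tiltCov K y).det / 2 := by
    rw [hdet, Real.log_prod fun i _ => (hl i).ne', Finset.sum_div, Finset.sum_sub_distrib]
    have : ∀ i, -(Real.log (2 * Real.pi * (l i / 2 ^ j)) / 2)
        = Real.log (2 ^ j / (2 * Real.pi)) / 2 - Real.log (l i) / 2 := by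
      intro i
      have hli := hl i
      rw [Real.log_mul (by positivity) (by positivity), Real.log_div hli.ne' hk0.ne',
        Real.log_div hk0.ne' (by positivity)]
      ring
    simp only [this, Finset.sum_sub_distrib, Finset.sum_const, Finset.card_univ, Fintype.card_fin,
      nsmul_eq_mul]
    ring
  rw [h4, h5, hlogc] at h3
  linarith

end IsCentredBody

end GaussianComparison

section Energy

variable {E : Type*} [NormedAddCommGroup E] [InnerProductSpace ℝ E] [FiniteDimensional ℝ E]
  [MeasurableSpace E] [BorelSpace E] {K : Set E}

/-- The mean of `logLap K` under the density proportional to `exp (-β * logLap K)`. -/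
noncomputable def lapEnergy (K : Set E) (β : ℝ) : ℝ :=
  (∫ y, Real.exp (-β * logLap K y) * logLap K y) / lapPartition K β

namespace IsCentredBody

theorem exists_norm_tiltMean_le (hK : IsCentredBody K) : ∃ R, 0 ≤ R ∧ ∀ y, ‖tiltMean K y‖ ≤ R := by
  obtain ⟨R, hR⟩ := hK.isCompact.isBounded.exists_norm_le
  exact ⟨R, (norm_nonneg _).trans (hR _ (hK.tiltMean_mem 0)), fun y => hR _ (hK.tiltMean_mem y)⟩

theorem integrable_exp_logLap_mul (hK : IsCentredBody K) {β : ℝ} (hβ : 0 < β) {g : E → ℝ}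
    (hg : Continuous g) {C : ℝ} (hC : ∀ y, |g y| ≤ C * (1 + ‖y‖)) :
    Integrable fun y => Real.exp (-β * logLap K y) * g y :=
  hK.integrable_exp_logLap_smul hβ hg hC

theorem integrable_exp_logLap_mul_logLap (hK : IsCentredBody K) {β : ℝ} (hβ : 0 < β) :
    Integrable fun y => Real.exp (-β * logLap K y) * logLap K y := by
  obtain ⟨R, hR0, hR⟩ := hK.exists_norm_tiltMean_le
  refine hK.integrable_exp_logLap_mul hβ hK.continuous_logLap (C := R) fun y => ?_
  rw [abs_of_nonneg (hK.logLap_nonneg y)]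
  calc logLap K y ≤ inner ℝ y (tiltMean K y) := hK.logLap_le_inner y
    _ ≤ ‖y‖ * ‖tiltMean K y‖ := real_inner_le_norm _ _
    _ ≤ ‖y‖ * R := by gcongr; exact hR y
    _ ≤ R * (1 + ‖y‖) := by linarith

theorem integrable_exp_logLap_mul_inner (hK : IsCentredBody K) {β : ℝ} (hβ : 0 < β) (v w : E)
    (t : ℝ) : Integrable fun y =>
      Real.exp (-β * logLap K y) * (inner ℝ v (tiltMean K y) * (t + inner ℝ w y)) := by
  obtain ⟨R, hR0, hR⟩ := hK.exists_norm_tiltMean_le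
  have := hK.continuous_tiltMean
  refine hK.integrable_exp_logLap_mul hβ (by fun_prop) (C := ‖v‖ * R * (|t| + ‖w‖)) fun y => ?_
  rw [abs_mul]
  calc |inner ℝ v (tiltMean K y)| * |t + inner ℝ w y|
      ≤ (‖v‖ * ‖tiltMean K y‖) * (|t| + ‖w‖ * ‖y‖) := by
        gcongr
        · exact abs_real_inner_le_norm _ _
        · exact (abs_add_le _ _).trans (by gcongr; exact abs_real_inner_le_norm _ _)
    _ ≤ (‖v‖ * R) * (|t| * (1 + ‖y‖) + ‖w‖ * (1 + ‖y‖)) := by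
        gcongr
        · exact hR y
        · nlinarith [abs_nonneg t, norm_nonneg y]
        · linarith
    _ = _ := by ring

theorem integral_exp_logLap_by_parts (hK : IsCentredBody K) {β : ℝ} (hβ : 0 < β) (v w : E)
    (t : ℝ) : β * ∫ y, Real.exp (-β * logLap K y) * (inner ℝ v (tiltMean K y) * (t + inner ℝ w y))
      = inner ℝ w v * lapPartition K β := by
  have hf : ∀ y, HasFDerivAt (fun y => Real.exp (-β * logLap K y))
      (Real.exp (-β * logLap K y) • ((-β) • innerSL ℝ (tiltMean K y))) y := fun y =>
    ((hK.hasFDerivAt_logLap y).const_mul (-β)).exp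
  have hg : ∀ y : E, HasFDerivAt (fun y : E => t + inner ℝ w y) (innerSL ℝ w) y := fun y =>
    (innerSL ℝ w).hasFDerivAt.const_add t
  have h0 := hK.integrable_exp_logLap_mul_inner hβ v w t
  have h1 := integral_bilinear_hasFDerivAt_right_eq_neg_left_of_integrable (μ := volume)
    (B := ContinuousLinearMap.mul ℝ ℝ) (v := v) ?_ ?_ ?_ (fun y _ => hf y) (fun y _ => hg y)
  · simp only [ContinuousLinearMap.mul_apply', innerSL_apply_apply, smul_apply, smul_eq_mul] at h1
    rw [integral_mul_const] at h1
    rw [lapPartition, mul_comm, mul_comm (inner ℝ w v), h1, ← integral_neg, ← integral_mul_const]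
    refine integral_congr_ae (.of_forall fun y => ?_)
    simp only [real_inner_comm v]
    ring
  · refine (h0.const_mul (-β)).congr (.of_forall fun y => ?_)
    simp [real_inner_comm v]
    ring
  · simpa using (hK.integrable_exp_logLap hβ).mul_const (inner ℝ w v)
  · refine hK.integrable_exp_logLap_mul hβ (by fun_prop) (C := |t| + ‖w‖) fun y => ?_
    have h2 := abs_add_le t (inner ℝ w y)
    have h3 := abs_real_inner_le_norm w y
    nlinarith [abs_nonneg t, norm_nonneg y, norm_nonneg w]

theorem integral_exp_logLap_mul_inner_tiltMean (hK : IsCentredBody K) {β : ℝ} (hβ : 0 < β) (v : E) :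
    ∫ y, Real.exp (-β * logLap K y) * inner ℝ v (tiltMean K y) = 0 := by
  have := hK.integral_exp_logLap_by_parts hβ v 0 1
  simpa [hβ.ne'] using this

theorem inner_tiltMean_eq_sum (K : Set E) (y : E) : inner ℝ y (tiltMean K y)
    = ∑ i, inner ℝ (stdOrthonormalBasis ℝ E i) (tiltMean K y) *
      (0 + inner ℝ (stdOrthonormalBasis ℝ E i) y) := by
  rw [← (stdOrthonormalBasis ℝ E).sum_inner_mul_inner y (tiltMean K y)]
  refine Finset.sum_congr rfl fun i _ => ?_
  rw [real_inner_comm y]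
  ring

theorem integrable_exp_logLap_mul_inner_self (hK : IsCentredBody K) {β : ℝ} (hβ : 0 < β) :
    Integrable fun y => Real.exp (-β * logLap K y) * inner ℝ y (tiltMean K y) := by
  simp_rw [inner_tiltMean_eq_sum, Finset.mul_sum]
  exact integrable_finsetSum _ fun i _ => hK.integrable_exp_logLap_mul_inner hβ _ _ _

theorem integral_exp_logLap_mul_inner_self (hK : IsCentredBody K) {β : ℝ} (hβ : 0 < β) :
    β * ∫ y, Real.exp (-β * logLap K y) * inner ℝ y (tiltMean K y)
      = Module.finrank ℝ E * lapPartition K β := by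
  simp_rw [inner_tiltMean_eq_sum, Finset.mul_sum]
  rw [integral_finsetSum _ fun i _ => hK.integrable_exp_logLap_mul_inner hβ _ _ _, Finset.mul_sum]
  simp_rw [hK.integral_exp_logLap_by_parts hβ]
  simp

theorem lapEnergy_nonneg (hK : IsCentredBody K) {β : ℝ} (hβ : 0 < β) : 0 ≤ lapEnergy K β :=
  div_nonneg (integral_nonneg fun y => mul_nonneg (Real.exp_nonneg _) (hK.logLap_nonneg y))
    (hK.lapPartition_pos hβ).le

theorem lapEnergy_mul_lapPartition (hK : IsCentredBody K) {β : ℝ} (hβ : 0 < β) :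
    ∫ y, Real.exp (-β * logLap K y) * logLap K y = lapEnergy K β * lapPartition K β := by
  rw [lapEnergy, div_mul_cancel₀ _ (hK.lapPartition_pos hβ).ne']

theorem log_lapPartition_sub_le (hK : IsCentredBody K) {β β' : ℝ} (hβ : 0 < β) (hβ' : 0 < β') :
    Real.log (lapPartition K β) - (β' - β) * lapEnergy K β ≤ Real.log (lapPartition K β') := by
  have hZ := hK.lapPartition_pos hβ
  have hZ' := hK.lapPartition_pos hβ'
  set m := (β' - β) * lapEnergy K β with hm
  have hi := hK.integrable_exp_logLap hβ
  have hi2 := hK.integrable_exp_logLap_mul_logLap hβ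
  have h1 : Real.exp (-m) * lapPartition K β ≤ lapPartition K β' := by
    calc Real.exp (-m) * lapPartition K β
        = ∫ y, Real.exp (-m) * ((1 + m) * Real.exp (-β * logLap K y)
          - (β' - β) * (Real.exp (-β * logLap K y) * logLap K y)) := by
          rw [integral_const_mul, integral_sub (hi.const_mul _) (hi2.const_mul _),
            integral_const_mul, integral_const_mul, hK.lapEnergy_mul_lapPartition hβ,
            ← lapPartition, hm]
          ring
      _ ≤ lapPartition K β' := by
          refine integral_mono (((hi.const_mul _).sub (hi2.const_mul _)).const_mul _)
            (hK.integrable_exp_logLap hβ') fun y => ?_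
          have h2 := Real.add_one_le_exp (m - (β' - β) * logLap K y)
          calc Real.exp (-m) * ((1 + m) * Real.exp (-β * logLap K y)
                - (β' - β) * (Real.exp (-β * logLap K y) * logLap K y))
              = Real.exp (-m) * Real.exp (-β * logLap K y) *
                (m - (β' - β) * logLap K y + 1) := by ring
            _ ≤ Real.exp (-m) * Real.exp (-β * logLap K y) *
                Real.exp (m - (β' - β) * logLap K y) := by gcongr
            _ = Real.exp (-β' * logLap K y) := by
                rw [← Real.exp_add, ← Real.exp_add]
                congr 1
                ring
  have h2 := Real.log_le_log (by positivity) h1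
  rw [Real.log_mul (Real.exp_ne_zero _) hZ.ne', Real.log_exp] at h2
  linarith

theorem integrable_det_tiltCov (hK : IsCentredBody K) :
    Integrable fun y => (tiltCov K y).det := by
  have := hK.continuous_tiltCov
  refine ⟨(ContinuousLinearMap.continuous_det.comp this).aestronglyMeasurable, ?_⟩
  rw [hasFiniteIntegral_iff_ofReal (ae_of_all _ fun y => (hK.det_tiltCov_pos y).le)]
  exact hK.lintegral_det_tiltCov_le.trans_lt hK.isCompact.measure_lt_top

theorem integral_det_tiltCov_le (hK : IsCentredBody K) :
    ∫ y, (tiltCov K y).det ≤ volume.real K := by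
  rw [integral_eq_lintegral_of_nonneg_ae (ae_of_all _ fun y => (hK.det_tiltCov_pos y).le)
    hK.integrable_det_tiltCov.1]
  exact ENNReal.toReal_mono hK.volume_ne_top hK.lintegral_det_tiltCov_le

/-- The Gaussian comparison averaged over the density proportional to `exp (-β * logLap K)`. -/
theorem energy_inequality (hK : IsCentredBody K) {β : ℝ} (hβ : 0 < β) (j : ℕ) :
    Module.finrank ℝ E / 2 * Real.log (2 ^ j / (2 * Real.pi)) - Module.finrank ℝ E / 2
        + Real.log (volume.real K * lapPartition K β) / 2 + β * lapEnergy K β / 2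
        - 2 ^ j * (Module.finrank ℝ E / β - lapEnergy K β)
      ≤ (2 ^ j - 1) * Real.log (2 ^ Module.finrank ℝ E * chordVol K 0 / volume.real K) := by
  obtain ⟨ξ, hξ⟩ := exists_chordVol_le_exp hK.isCompact hK.convex hK.zero_mem_interior
  have hZ := hK.lapPartition_pos hβ
  have hv := hK.volume_pos
  set n := Module.finrank ℝ E with hn
  set Z := lapPartition K β with hZdef
  set v := volume.real K with hvdef
  set δ := Real.log (2 ^ n * chordVol K 0 / v) with hδ
  set G : E → ℝ := fun y => Real.exp (-β * logLap K y) with hG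
  have hGi : Integrable G := hK.integrable_exp_logLap hβ
  have hGL : Integrable fun y => G y * logLap K y := hK.integrable_exp_logLap_mul_logLap hβ
  have hGξ : Integrable fun y => G y * inner ℝ ξ (tiltMean K y) := by
    simpa [hG] using hK.integrable_exp_logLap_mul_inner hβ ξ 0 1
  have hGy : Integrable fun y => G y * inner ℝ y (tiltMean K y) :=
    hK.integrable_exp_logLap_mul_inner_self hβ
  have hdet := hK.integrable_det_tiltCov
  set A : ℝ := n / 2 * Real.log (2 ^ j / (2 * Real.pi)) - n / 2 - (Real.log v - Real.log Z - 1) / 2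
    with hA
  set B : ℝ := (2 ^ j - 1) * δ - Real.log v with hB
  have hpt : ∀ y, A * G y + β / 2 * (G y * logLap K y) - Z / (2 * v) * (tiltCov K y).det
      ≤ B * G y - 2 ^ j * (G y * logLap K y) + (2 ^ j - 1) * (G y * inner ℝ ξ (tiltMean K y))
        + 2 ^ j * (G y * inner ℝ y (tiltMean K y)) := by
    intro y
    have hD := hK.det_tiltCov_pos y
    have h1 := hK.gaussian_comparison hξ y j
    rw [inner_add_left, real_inner_smul_left, real_inner_smul_left] at h1
    have h2 : Real.log (tiltCov K y).det ≤ Real.log v - Real.log Z - β * logLap K y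
        + Z / v * (tiltCov K y).det * Real.exp (β * logLap K y) - 1 := by
      have h3 := Real.log_le_sub_one_of_pos
        (x := Z / v * (tiltCov K y).det * Real.exp (β * logLap K y)) (by positivity)
      rw [Real.log_mul (by positivity) (by positivity), Real.log_mul (by positivity) hD.ne',
        Real.log_div hZ.ne' hv.ne', Real.log_exp] at h3
      linarith
    have hGp : 0 < G y := Real.exp_pos _
    have h4 : Real.exp (β * logLap K y) * G y = 1 := by
      simp only [hG]
      rw [← Real.exp_add]
      simp
    have h5 : n / 2 * Real.log (2 ^ j / (2 * Real.pi)) - n / 2 - (Real.log v - Real.log Z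
        - β * logLap K y + Z / v * (tiltCov K y).det * Real.exp (β * logLap K y) - 1) / 2
        ≤ (2 ^ j - 1) * δ - Real.log v - 2 ^ j * logLap K y
          + ((2 ^ j - 1) * inner ℝ ξ (tiltMean K y) + 2 ^ j * inner ℝ y (tiltMean K y)) := by
      linarith
    have h6 := mul_le_mul_of_nonneg_right h5 hGp.le
    have h7 : Z / v * (tiltCov K y).det * Real.exp (β * logLap K y) * G y
        = Z / v * (tiltCov K y).det := by rw [mul_assoc, h4, mul_one]
    calc A * G y + β / 2 * (G y * logLap K y) - Z / (2 * v) * (tiltCov K y).det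
        = (n / 2 * Real.log (2 ^ j / (2 * Real.pi)) - n / 2 - (Real.log v - Real.log Z
        - β * logLap K y + Z / v * (tiltCov K y).det * Real.exp (β * logLap K y) - 1) / 2) * G y := by
          rw [hA]
          linear_combination (1 / 2) * h7
      _ ≤ _ := h6
      _ = _ := by rw [hB]; ring
  have hi₁ : Integrable fun y => A * G y + β / 2 * (G y * logLap K y) :=
    (hGi.const_mul A).add (hGL.const_mul (β / 2))
  have hi₂ : Integrable fun y => B * G y - 2 ^ j * (G y * logLap K y) :=
    (hGi.const_mul B).sub (hGL.const_mul (2 ^ j))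
  have hi₃ : Integrable fun y => B * G y - 2 ^ j * (G y * logLap K y)
      + (2 ^ j - 1) * (G y * inner ℝ ξ (tiltMean K y)) := hi₂.add (hGξ.const_mul (2 ^ j - 1))
  have hInt := integral_mono (hi₁.sub (hdet.const_mul (Z / (2 * v))))
    (hi₃.add (hGy.const_mul (2 ^ j))) hpt
  have hL : ∫ y, (A * G y + β / 2 * (G y * logLap K y) - Z / (2 * v) * (tiltCov K y).det)
      = A * Z + β / 2 * (lapEnergy K β * Z) - Z / (2 * v) * ∫ y, (tiltCov K y).det := by
    rw [integral_sub hi₁ (hdet.const_mul _),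
      integral_add (hGi.const_mul A) (hGL.const_mul (β / 2)), integral_const_mul,
      integral_const_mul, integral_const_mul, hK.lapEnergy_mul_lapPartition hβ]
    rfl
  have hyy : ∫ y, G y * inner ℝ y (tiltMean K y) = n / β * Z := by
    have := hK.integral_exp_logLap_mul_inner_self hβ
    field_simp
    linarith
  have hR : ∫ y, (B * G y - 2 ^ j * (G y * logLap K y)
      + (2 ^ j - 1) * (G y * inner ℝ ξ (tiltMean K y))
        + 2 ^ j * (G y * inner ℝ y (tiltMean K y)))
      = B * Z - 2 ^ j * (lapEnergy K β * Z) + 2 ^ j * (n / β * Z) := by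
    rw [integral_add hi₃ (hGy.const_mul (2 ^ j)), integral_add hi₂ (hGξ.const_mul (2 ^ j - 1)),
      integral_sub (hGi.const_mul B) (hGL.const_mul (2 ^ j)), integral_const_mul,
      integral_const_mul, integral_const_mul, integral_const_mul,
      hK.lapEnergy_mul_lapPartition hβ, hK.integral_exp_logLap_mul_inner_tiltMean hβ, hyy]
    simp only [mul_zero, add_zero]
    rfl
  have hdl : Z / (2 * v) * ∫ y, (tiltCov K y).det ≤ Z / 2 := by
    calc Z / (2 * v) * ∫ y, (tiltCov K y).det ≤ Z / (2 * v) * v := by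
          gcongr
          exact hK.integral_det_tiltCov_le
      _ = Z / 2 := by field_simp
  have hfin : (A + β / 2 * lapEnergy K β - 1 / 2) * Z
      ≤ (B - 2 ^ j * lapEnergy K β + 2 ^ j * (n / β)) * Z := by
    have h := hL.symm.le.trans (hInt.trans hR.le)
    linarith
  have := le_of_mul_le_mul_right hfin hZ
  rw [Real.log_mul hv.ne' hZ.ne']
  rw [hA, hB] at this
  linarith

end IsCentredBody

end Energy

section LinearGain

theorem exists_growth_or_slow_step {a : ℕ → ℝ} {b s : ℝ} (h0 : b ≤ a 0) (hs : 0 ≤ s) (m : ℕ) :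
    b + m * s ≤ a m ∨ ∃ i < m, b ≤ a i ∧ a (i + 1) ≤ a i + s := by
  induction m with
  | zero => left; simpa using h0
  | succ m ih =>
    rcases ih with ih | ⟨i, hi, h1, h2⟩
    · by_cases h : a (m + 1) ≤ a m + s
      · exact Or.inr ⟨m, by omega, le_trans (by nlinarith [(m.cast_nonneg : (0 : ℝ) ≤ m)]) ih, h⟩
      · left
        push_cast
        linarith
    · exact Or.inr ⟨i, by omega, h1, h2⟩

variable {E : Type*} [NormedAddCommGroup E] [InnerProductSpace ℝ E] [FiniteDimensional ℝ E]
  [MeasurableSpace E] [BorelSpace E] {K : Set E}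

/-- The scale-invariant free energy `n log β + log (|K| Z(β))`. -/
noncomputable def freeEnergy (K : Set E) (β : ℝ) : ℝ :=
  Module.finrank ℝ E * Real.log β + Real.log (volume.real K * lapPartition K β)

namespace IsCentredBody

theorem neg_mul_log_two_le_freeEnergy_one (hK : IsCentredBody K) :
    -(Module.finrank ℝ E * Real.log 2) ≤ freeEnergy K 1 := by
  have hv := hK.volume_pos
  have hZ := hK.lapPartition_pos one_pos
  have h := Real.log_le_log one_pos hK.one_le_two_pow_mul_lapPartition
  rw [Real.log_one, Real.log_mul (by positivity) (by positivity), Real.log_pow] at h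
  rw [freeEnergy, Real.log_one]
  linarith

theorem freeEnergy_add_le (hK : IsCentredBody K) {β ε : ℝ} (hβ : 0 < β) (hε : 0 < ε) :
    freeEnergy K β + ε * (Module.finrank ℝ E * (1 - ε) - β * lapEnergy K β)
      ≤ freeEnergy K (β * (1 + ε)) := by
  have hv := hK.volume_pos
  have hβ' : 0 < β * (1 + ε) := by positivity
  have hZ := hK.lapPartition_pos hβ
  have hZ' := hK.lapPartition_pos hβ'
  have h1 := hK.log_lapPartition_sub_le hβ hβ'
  have h2 : ε * (1 - ε) ≤ Real.log (1 + ε) := by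
    refine le_trans ?_ (Real.one_sub_inv_le_log_of_pos (by positivity))
    have : 1 - (1 + ε)⁻¹ = ε / (1 + ε) := by field_simp; ring
    rw [this, le_div_iff₀ (by positivity)]
    nlinarith [pow_pos hε 3]
  have h3 := mul_le_mul_of_nonneg_left h2 (Nat.cast_nonneg (α := ℝ) (Module.finrank ℝ E))
  rw [freeEnergy, freeEnergy, Real.log_mul hv.ne' hZ.ne', Real.log_mul hv.ne' hZ'.ne',
    Real.log_mul hβ.ne' (by positivity)]
  linarith

theorem gain_of_freeEnergy (hK : IsCentredBody K) {β κ : ℝ} (hβ : 1 ≤ β) (hκ1 : 1 ≤ κ)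
    (hκ : Real.log (κ / (2 * Real.pi)) = Real.log 2 + 3) :
    ∃ k : ℝ, 1 < k ∧ k ≤ 2 * κ * β ∧
      Module.finrank ℝ E / 2 * (Real.log 2 + 2) + freeEnergy K β / 2 + β * lapEnergy K β / 2
        - k / β * (Module.finrank ℝ E - β * lapEnergy K β)
      ≤ (k - 1) * Real.log (2 ^ Module.finrank ℝ E * chordVol K 0 / volume.real K) := by
  have hβ0 : 0 < β := by linarith
  have hκ0 : 0 < κ := by linarith
  have hκβ : 1 ≤ κ * β := one_le_mul_of_one_le_of_one_le hκ1 hβ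
  obtain ⟨j, hj1, hj2⟩ := exists_nat_pow_near (x := 2 * κ * β) (y := 2) (by linarith) one_lt_two
  rw [pow_succ] at hj2
  have hk : κ * β < 2 ^ j := by linarith
  refine ⟨2 ^ j, by linarith, hj1, le_trans ?_ (hK.energy_inequality hβ0 j)⟩
  have h1 : Real.log 2 + 3 + Real.log β ≤ Real.log (2 ^ j / (2 * Real.pi)) := by
    rw [← hκ, ← Real.log_mul (by positivity) hβ0.ne']
    refine Real.log_le_log (by positivity) ?_
    rw [div_mul_eq_mul_div]
    gcongr
  have h2 := mul_le_mul_of_nonneg_left h1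
    (by positivity : 0 ≤ (Module.finrank ℝ E : ℝ) / 2)
  have h3 : (2 : ℝ) ^ j / β * (Module.finrank ℝ E - β * lapEnergy K β)
      = 2 ^ j * (Module.finrank ℝ E / β - lapEnergy K β) := by
    field_simp
  rw [h3, freeEnergy]
  linarith

theorem le_mul_log_of_step {n δ κ ε τ M : ℝ} {J : ℕ} (hn : n = Module.finrank ℝ E)
    (hδ : δ = Real.log (2 ^ Module.finrank ℝ E * chordVol K 0 / volume.real K))
    (hK : IsCentredBody K) (hκ1 : 1 ≤ κ)
    (hκ : Real.log (κ / (2 * Real.pi)) = Real.log 2 + 3) (hε : ε = 1 / (8 * κ))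
    (hτ : τ = ε / (8 * κ)) (hJ : 4 * κ ≤ J * τ) (hM : M = 2 * κ * (1 + ε) ^ J) :
    n / 2 ≤ M * δ := by
  have hκ0 : 0 < κ := by linarith
  have hε0 : 0 < ε := by rw [hε]; positivity
  have hn0 : 0 ≤ n := by rw [hn]; positivity
  have hτ0 : 0 < τ := by rw [hτ]; positivity
  suffices h : ∃ i ≤ J, ∃ k : ℝ, 1 < k ∧ k ≤ 2 * κ * (1 + ε) ^ i ∧ n / 2 ≤ (k - 1) * δ by
    obtain ⟨i, hi, k, hk1, hk2, hk3⟩ := h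
    have hδ0 : 0 ≤ δ := by
      by_contra! hneg
      nlinarith
    have : (1 + ε) ^ i ≤ (1 + ε) ^ J := pow_le_pow_right₀ (by linarith) hi
    refine hk3.trans (mul_le_mul_of_nonneg_right ?_ hδ0)
    rw [hM]
    nlinarith
  have hstep := exists_growth_or_slow_step (a := fun i => freeEnergy K ((1 + ε) ^ i))
    (b := -(n * Real.log 2)) (s := τ * n)
    (by simpa [hn] using hK.neg_mul_log_two_le_freeEnergy_one) (by positivity) J
  have hβ : ∀ i, 1 ≤ (1 + ε) ^ i := fun i => one_le_pow₀ (by linarith)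
  rcases hstep with h | ⟨i, hi, h1, h2⟩
  · obtain ⟨k, hk1, hk2, hk3⟩ := hK.gain_of_freeEnergy (hβ J) hκ1 hκ
    refine ⟨J, le_rfl, k, hk1, hk2, ?_⟩
    rw [← hn, ← hδ] at hk3
    set β := (1 + ε) ^ J
    have hβ0 : 0 < β := by linarith [hβ J]
    have he := hK.lapEnergy_nonneg hβ0
    have hβe : 0 ≤ β * lapEnergy K β := by positivity
    have h4 : k / β * (n - β * lapEnergy K β) ≤ 2 * κ * n := by
      have : k / β ≤ 2 * κ := by rwa [div_le_iff₀ hβ0]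
      have h5 : 0 < k / β := by positivity
      nlinarith
    have h6 : 4 * κ * n ≤ J * (τ * n) := by nlinarith
    linarith
  · obtain ⟨k, hk1, hk2, hk3⟩ := hK.gain_of_freeEnergy (hβ i) hκ1 hκ
    refine ⟨i, hi.le, k, hk1, hk2, ?_⟩
    have h3 := hK.freeEnergy_add_le (by linarith [hβ i] : 0 < (1 + ε) ^ i) hε0
    simp only [pow_succ] at h2
    rw [← hn] at h3
    rw [← hn, ← hδ] at hk3
    set β := (1 + ε) ^ i
    have hβ0 : 0 < β := by linarith [hβ i]
    have h4 : n - β * lapEnergy K β ≤ n * (1 / (4 * κ)) := by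
      have h5 : ε * (n * (1 - ε) - β * lapEnergy K β) ≤ ε * (n / (8 * κ)) := by
        calc ε * (n * (1 - ε) - β * lapEnergy K β) ≤ τ * n := by linarith
          _ = ε * (n / (8 * κ)) := by rw [hτ]; ring
      have h6 := le_of_mul_le_mul_left h5 hε0
      have h7 : n * (1 / (4 * κ)) = n * ε + n / (8 * κ) := by rw [hε]; field_simp; ring
      linarith
    have h8 : k / β * (n - β * lapEnergy K β) ≤ n / 2 := by
      have h9 : k / β ≤ 2 * κ := by rwa [div_le_iff₀ hβ0]
      have h10 : 0 < k / β := by positivity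
      calc k / β * (n - β * lapEnergy K β) ≤ k / β * (n * (1 / (4 * κ))) := by gcongr
        _ ≤ 2 * κ * (n * (1 / (4 * κ))) := by gcongr
        _ = n / 2 := by field_simp; ring
    have h11 : n * (1 / (4 * κ)) ≤ n := by
      have : 1 / (4 * κ) ≤ 1 := by rw [div_le_one (by positivity)]; linarith
      nlinarith
    linarith

end IsCentredBody

/-- A centred convex body `K` satisfies `|K| ≤ 2ᵈ exp(-c d) |K ∩ -K|` for an absolute constant
`c > 0`. -/
theorem exists_linear_gain : ∃ c : ℝ, 0 < c ∧ ∀ (d : ℕ) (K : Set (EuclideanSpace ℝ (Fin d))),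
    IsCentredBody K → c * d ≤ Real.log (2 ^ d * chordVol K 0 / volume.real K) := by
  obtain ⟨κ, hκdef⟩ : ∃ κ : ℝ, κ = 4 * Real.pi * Real.exp 3 := ⟨_, rfl⟩
  have hπ := Real.pi_gt_three
  have hκ1 : 1 ≤ κ := by
    have := Real.one_le_exp (by norm_num : (0 : ℝ) ≤ 3)
    nlinarith
  have hκ : Real.log (κ / (2 * Real.pi)) = Real.log 2 + 3 := by
    have : κ / (2 * Real.pi) = 2 * Real.exp 3 := by rw [hκdef]; field_simp; norm_num
    rw [this, Real.log_mul two_ne_zero (Real.exp_ne_zero _), Real.log_exp]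
  have hκ0 : 0 < κ := by linarith
  obtain ⟨J, hJ⟩ := exists_nat_ge (4 * κ / (1 / (8 * κ) / (8 * κ)))
  rw [div_le_iff₀ (by positivity)] at hJ
  refine ⟨1 / (2 * (2 * κ * (1 + 1 / (8 * κ)) ^ J)), by positivity, fun d K hK => ?_⟩
  have h := IsCentredBody.le_mul_log_of_step rfl rfl hK hκ1 hκ rfl rfl hJ rfl
  rw [finrank_euclideanSpace_fin] at h
  rw [div_mul_eq_mul_div, div_le_iff₀ (by positivity)]
  linarith

end LinearGain

section Lattice

/-- Minkowski theorem for `K ∩ -K`. -/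
theorem chordVol_zero_le_of_inter_intLattice {d : ℕ} {K : Set (EuclideanSpace ℝ (Fin d))}
    (hK : Convex ℝ K) (hKL : K ∩ {x | ∀ i, ∃ n : ℤ, x i = (n : ℝ)} = {0}) :
    chordVol K 0 ≤ 2 ^ d := by
  set b := (EuclideanSpace.basisFun (Fin d) ℝ).toBasis with hb
  have hF : volume (ZSpan.fundamentalDomain b) = 1 := by
    rw [measure_congr (ZSpan.fundamentalDomain_ae_parallelepiped b volume), hb,
      OrthonormalBasis.coe_toBasis, OrthonormalBasis.volume_parallelepiped]
  by_contra! h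
  have hlt : volume (ZSpan.fundamentalDomain b) * 2 ^ Module.finrank ℝ (EuclideanSpace ℝ (Fin d))
      < volume (chords K 0) := by
    rw [hF, one_mul, finrank_euclideanSpace_fin]
    refine (ENNReal.lt_ofReal_iff_toReal_lt (by simp)).2 ?_ |>.trans_le ENNReal.ofReal_toReal_le
    simpa [chordVol, Measure.real] using h
  have hconv : Convex ℝ (chords K 0) := by
    have : chords K 0 = K ∩ -K := by ext x; simp [chords]
    rw [this]
    exact hK.inter hK.neg
  have : Countable (Submodule.span ℤ (Set.range b)).toAddSubgroup :=
    inferInstanceAs (Countable (Submodule.span ℤ (Set.range b)))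
  obtain ⟨x, hx0, hx⟩ := exists_ne_zero_mem_lattice_of_measure_mul_two_pow_lt_measure
    (ZSpan.isAddFundamentalDomain' b volume) (fun x hx => by simpa [chords, and_comm] using hx)
    hconv hlt
  refine hx0 (Subtype.ext ?_)
  have hxK : (x : EuclideanSpace ℝ (Fin d)) ∈ K := by simpa using hx.1
  have hxL : ∀ i, ∃ n : ℤ, (x : EuclideanSpace ℝ (Fin d)) i = (n : ℝ) := by
    intro i
    obtain ⟨n, hn⟩ := (b.mem_span_iff_repr_mem ℤ (x : EuclideanSpace ℝ (Fin d))).1 x.2 i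
    refine ⟨n, ?_⟩
    simpa [hb] using hn.symm
  have := hKL.subset ⟨hxK, hxL⟩
  simpa using this

end Lattice

end Auxiliary

theorem isCentredBody_of_centroid_eq_zero {d : ℕ} {K : Set (EuclideanSpace ℝ (Fin d))}
    (hK : IsCompact K) (hKc : Convex ℝ K) (hKi : (interior K).Nonempty) (h : centroid K = 0) :
    IsCentredBody K := by
  refine ⟨hK, hKc, hKi, ?_⟩
  have h0 : volume K ≠ 0 := (Measure.measure_pos_of_nonempty_interior _ hKi).ne'
  have h1 : (volume K).toReal ≠ 0 := ENNReal.toReal_ne_zero.2 ⟨h0, hK.measure_lt_top.ne⟩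
  simpa [centroid, h1] using h

/-- There exist `c > 0` and `d₀` such that the following holds for every `d ≥ d₀`: if
`K ⊆ ℝ^d` is a convex body whose centre of mass is the origin and `K ∩ ℤ^d = {0}`,
then `vol(K) ≤ exp(-c d / (log d)^8) · 4^d`. -/
theorem ehrhart_polylog :
    ∃ c : ℝ, 0 < c ∧ ∃ d₀ : ℕ, ∀ d : ℕ, d₀ ≤ d →
      ∀ K : Set (EuclideanSpace ℝ (Fin d)),
        IsCompact K → Convex ℝ K → (interior K).Nonempty →
        centroid K = 0 → K ∩ intLattice d = {0} →
        (volume K).toReal ≤ Real.exp (-c * d / (Real.log d) ^ 8) * 4 ^ d := by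
  obtain ⟨c, hc, hgain⟩ := exists_linear_gain
  refine ⟨c, hc, 3, fun d hd K hK hKc hKi hcen hKL => ?_⟩
  have hbody := isCentredBody_of_centroid_eq_zero hK hKc hKi hcen
  have hv := hbody.volume_pos
  have hF0 : 0 < chordVol K 0 := chordVol_pos hK hbody.zero_mem_interior
  have hF : chordVol K 0 ≤ 2 ^ d := chordVol_zero_le_of_inter_intLattice hKc hKL
  have h1 := hgain d K hbody
  rw [Real.le_log_iff_exp_le (by positivity), le_div_iff₀ hv] at h1
  have h2 : volume.real K ≤ Real.exp (-(c * d)) * 4 ^ d := by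
    rw [Real.exp_neg, inv_mul_eq_div, le_div_iff₀ (Real.exp_pos _), mul_comm]
    calc Real.exp (c * d) * volume.real K ≤ 2 ^ d * chordVol K 0 := h1
      _ ≤ 2 ^ d * 2 ^ d := by gcongr
      _ = 4 ^ d := by rw [← mul_pow]; norm_num
  refine h2.trans ?_
  have hlog : 1 ≤ Real.log d := by
    rw [Real.le_log_iff_exp_le (by positivity)]
    have : (3 : ℝ) ≤ d := by exact_mod_cast hd
    linarith [Real.exp_one_lt_three]
  have h3 : c * d / Real.log d ^ 8 ≤ c * d := div_le_self (by positivity) (one_le_pow₀ hlog)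
  gcongr
  rw [neg_mul, neg_div]
  linarith
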